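/- arXiv:2509.20505 — 2 statements merged into one kernel-verified Lean document; each statement's English description precedes it below -/
import Mathlib

section
/- There exists a constant C > 0 such that for all κ > 0, t > 0, k ∈ ℤ and x ∈ ℝ³: |∫_{ℝ³} e^{i(t·Ω_κ(ξ) + x·ξ)}·φ(2⁻ᵏ|ξ|) dξ| ≤ C·κ⁻²·t⁻¹·(1 + (2ᵏκ)²)^{3/2}, and |∫_{ℝ³} e^{i(t·Σ_κ(ξ) + x·ξ)}·φ(2⁻ᵏ|ξ|) dξ| ≤ C·κ^{−5/3}·t⁻¹·(1 + (2ᵏκ)²)^{7/6}·2^{k/3}. (This is the convolution-kernel form of the t⁻¹ dispersive decay estimates ‖e^{itΩ_κ}P_k f‖_{L^∞} ≤ Cκ⁻²t⁻¹⟨2ᵏκ⟩³‖P_k f‖_{L¹} and ‖e^{itΣ_κ}P_k f‖_{L^∞} ≤ Cκ^{−5/3}t⁻¹⟨2ᵏκ⟩^{7/3}2^{k/3}‖P_k f‖_{L¹}.) -/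
noncomputable section

open MeasureTheory

/-- `ℝ³` with the Euclidean norm. -/
abbrev E3 : Type := EuclideanSpace ℝ (Fin 3)

/-- `d₁(ξ)`, the distance from `ξ` to `(0,0,κ⁻¹)`. -/
def d1 (κ : ℝ) (ξ : E3) : ℝ := Real.sqrt ((ξ 0) ^ 2 + (ξ 1) ^ 2 + (ξ 2 - κ⁻¹) ^ 2)

/-- `d₂(ξ)`, the distance from `ξ` to `(0,0,−κ⁻¹)`. -/
def d2 (κ : ℝ) (ξ : E3) : ℝ := Real.sqrt ((ξ 0) ^ 2 + (ξ 1) ^ 2 + (ξ 2 + κ⁻¹) ^ 2)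

/-- `Σ_κ(ξ) = (d₂(ξ) + d₁(ξ))/2`, the sound wave dispersion relation. -/
def Sig (κ : ℝ) (ξ : E3) : ℝ := (d2 κ ξ + d1 κ ξ) / 2

/-- `Ω_κ(ξ) = (d₂(ξ) − d₁(ξ))/2`, the inertial wave dispersion relation. -/
def Om (κ : ℝ) (ξ : E3) : ℝ := (d2 κ ξ - d1 κ ξ) / 2

/-- The horizontal norm `|ξ_h| = √(ξ₁² + ξ₂²)`. -/
def nrmh (ξ : E3) : ℝ := Real.sqrt ((ξ 0) ^ 2 + (ξ 1) ^ 2)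

/-- `x·ξ`, the Euclidean dot product on `ℝ³`. -/
def dot3 (x ξ : E3) : ℝ := x 0 * ξ 0 + x 1 * ξ 1 + x 2 * ξ 2

/-- The Littlewood–Paley bump `φ(x) = ψ(x/2) − ψ(x)` built from the cutoff `ψ`. -/
def lpBump (ψ : ℝ → ℝ) (y : ℝ) : ℝ := ψ (y / 2) - ψ y

/-- The hypotheses on the cutoff function `ψ`: smooth, `0 ≤ ψ ≤ 1`, supported in `[−2,2]`
and equal to `1` on `[−1,1]`. -/
def IsCutoff (ψ : ℝ → ℝ) : Prop :=
  ContDiff ℝ (⊤ : ℕ∞) ψ ∧ (∀ y, 0 ≤ ψ y ∧ ψ y ≤ 1) ∧ (∀ y, 2 < |y| → ψ y = 0) ∧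
    (∀ y, |y| ≤ 1 → ψ y = 1)

theorem abs_integral_sinc_sqrt_le_of_one_le {E α β : ℝ} (hα : 1 ≤ α) (hab : α ≤ β)
    (hE : 0 ≤ α ^ 2 + E) : |∫ s in α..β, Real.sinc √(s ^ 2 + E)| ≤ 3 := by
  have hpos : ∀ s ∈ Set.uIcc α β, s ≠ 0 := by
    intro s hs
    rw [Set.uIcc_of_le hab] at hs
    exact (by linarith [hs.1] : 0 < s).ne'
  have hu : IntervalIntegrable (fun s : ℝ => Real.sinc √(s ^ 2 + E)) volume α β :=
    (Real.continuous_sinc.comp (by fun_prop)).intervalIntegrable _ _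
  have hv : IntervalIntegrable (fun s : ℝ => Real.cos √(s ^ 2 + E) / s ^ 2) volume α β := by
    apply ContinuousOn.intervalIntegrable
    apply ContinuousOn.div (by fun_prop) (by fun_prop)
    intro s hs
    exact pow_ne_zero _ (hpos s hs)
  have hw : IntervalIntegrable (fun s : ℝ => 1 / s ^ 2) volume α β := by
    apply ContinuousOn.intervalIntegrable
    apply ContinuousOn.div (by fun_prop) (by fun_prop)
    intro s hs
    exact pow_ne_zero _ (hpos s hs)
  have key : ∫ s in α..β, (Real.sinc √(s ^ 2 + E) + Real.cos √(s ^ 2 + E) / s ^ 2)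
      = -Real.cos √(β ^ 2 + E) / β - -Real.cos √(α ^ 2 + E) / α := by
    refine intervalIntegral.integral_eq_sub_of_hasDerivAt_of_le
      (f := fun s : ℝ => -Real.cos √(s ^ 2 + E) / s) hab ?_ ?_ (hu.add hv)
    · apply ContinuousOn.div (by fun_prop) (by fun_prop)
      intro s hs
      exact hpos s (by rwa [Set.uIcc_of_le hab])
    · intro s hs
      have hs1 : 1 < s := lt_of_le_of_lt hα hs.1
      have hQ : 0 < s ^ 2 + E := by nlinarith [hs.1]
      have hy : √(s ^ 2 + E) ≠ 0 := (Real.sqrt_pos.2 hQ).ne'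
      have h1 : HasDerivAt (fun s : ℝ => √(s ^ 2 + E)) (s / √(s ^ 2 + E)) s := by
        have := (((hasDerivAt_pow 2 s).add_const E).sqrt hQ.ne')
        convert this using 1
        field_simp
        norm_num
        ring
      have hs0 : s ≠ 0 := by positivity
      have h2 : HasDerivAt (fun s : ℝ => -Real.cos √(s ^ 2 + E) / s) _ s :=
        (h1.cos.neg).div (hasDerivAt_id s) hs0
      refine h2.congr_deriv ?_
      rw [Real.sinc_of_ne_zero hy]
      simp only [Pi.neg_apply]
      field_simp
      ring
  have hw' : ∫ s in α..β, 1 / s ^ 2 = -1 / β - -1 / α := by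
    refine intervalIntegral.integral_eq_sub_of_hasDerivAt
      (f := fun s : ℝ => -1 / s) ?_ hw
    intro s hs
    have : HasDerivAt (fun s : ℝ => -1 / s) _ s :=
      (hasDerivAt_const s (-1 : ℝ)).div (hasDerivAt_id s) (hpos s hs)
    exact this.congr_deriv (by simp)
  rw [intervalIntegral.integral_add hu hv] at key
  have hc : |∫ s in α..β, Real.cos √(s ^ 2 + E) / s ^ 2| ≤ ∫ s in α..β, 1 / s ^ 2 := by
    refine intervalIntegral.abs_integral_le_integral_abs hab |>.trans ?_
    refine intervalIntegral.integral_mono_on hab hv.abs hw fun s hs => ?_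
    rw [abs_div, abs_of_nonneg (sq_nonneg s)]
    gcongr
    exact Real.abs_cos_le_one _
  have hβ : 1 ≤ β := hα.trans hab
  have b1 : |Real.cos √(β ^ 2 + E) / β| ≤ 1 / β := by
    rw [abs_div, abs_of_pos (by linarith : 0 < β)]
    gcongr
    exact Real.abs_cos_le_one _
  have b2 : |Real.cos √(α ^ 2 + E) / α| ≤ 1 / α := by
    rw [abs_div, abs_of_pos (by linarith : 0 < α)]
    gcongr
    exact Real.abs_cos_le_one _
  have b3 : 1 / α ≤ 1 := by rw [div_le_one (by linarith)]; exact hα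
  rw [hw'] at hc
  simp only [neg_div] at *
  rw [abs_le] at *
  constructor <;> linarith [b1.1, b1.2, b2.1, b2.2, hc.1, hc.2]

theorem abs_integral_sinc_le {f : ℝ → ℝ} {α β : ℝ} (hab : α ≤ β) :
    |∫ s in α..β, Real.sinc (f s)| ≤ β - α := by
  have := intervalIntegral.norm_integral_le_of_norm_le_const (a := α) (b := β) (C := 1)
    (f := fun s => Real.sinc (f s)) fun s _ => by simpa using Real.abs_sinc_le_one _
  simpa [abs_of_nonneg (sub_nonneg.2 hab)] using this

theorem intervalIntegrable_sinc_sqrt {g : ℝ → ℝ} (hg : Continuous g) (α β : ℝ) :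
    IntervalIntegrable (fun s => Real.sinc √(g s)) volume α β :=
  (Real.continuous_sinc.comp (by fun_prop)).intervalIntegrable _ _

theorem abs_integral_sinc_sqrt_le_of_nonneg {E α β : ℝ} (hα : 0 ≤ α) (hab : α ≤ β)
    (hE : 0 ≤ α ^ 2 + E) : |∫ s in α..β, Real.sinc √(s ^ 2 + E)| ≤ 4 := by
  rcases le_total 1 α with h1 | h1
  · exact (abs_integral_sinc_sqrt_le_of_one_le h1 hab hE).trans (by norm_num)
  rcases le_total β 1 with h2 | h2
  · exact (abs_integral_sinc_le hab).trans (by linarith)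
  rw [← intervalIntegral.integral_add_adjacent_intervals
    (intervalIntegrable_sinc_sqrt (g := fun s => s ^ 2 + E) (by fun_prop) α 1)
    (intervalIntegrable_sinc_sqrt (g := fun s => s ^ 2 + E) (by fun_prop) 1 β)]
  have e1 := abs_integral_sinc_le (f := fun s => √(s ^ 2 + E)) h1
  have e2 := abs_integral_sinc_sqrt_le_of_one_le (E := E) le_rfl h2 (by nlinarith)
  exact (abs_add_le _ _).trans (by linarith)

theorem abs_integral_sinc_sqrt_le {E α β : ℝ} (hab : α ≤ β)
    (hE : ∀ s ∈ Set.Icc α β, 0 ≤ s ^ 2 + E) :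
    |∫ s in α..β, Real.sinc √(s ^ 2 + E)| ≤ 8 := by
  have hneg : ∀ a b : ℝ, ∫ s in a..b, Real.sinc √(s ^ 2 + E)
      = ∫ s in -b..-a, Real.sinc √(s ^ 2 + E) := by
    intro a b
    rw [← intervalIntegral.integral_comp_neg]
    simp
  rcases le_total 0 α with h0 | h0
  · exact (abs_integral_sinc_sqrt_le_of_nonneg h0 hab (hE _ (by simp [hab]))).trans (by norm_num)
  rcases le_total β 0 with h1 | h1
  · rw [hneg]
    refine (abs_integral_sinc_sqrt_le_of_nonneg (by linarith) (by linarith) ?_).trans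
      (by norm_num)
    simpa using hE β (by simp [hab])
  rw [← intervalIntegral.integral_add_adjacent_intervals
    (intervalIntegrable_sinc_sqrt (g := fun s => s ^ 2 + E) (by fun_prop) α 0)
    (intervalIntegrable_sinc_sqrt (g := fun s => s ^ 2 + E) (by fun_prop) 0 β), hneg α]
  have e0 := hE 0 ⟨h0, h1⟩
  have e1 := abs_integral_sinc_sqrt_le_of_nonneg (E := E) (α := -0) (β := -α) (by simp)
    (by linarith) (by simpa using e0)
  have e2 := abs_integral_sinc_sqrt_le_of_nonneg (E := E) le_rfl h1 e0
  exact (abs_add_le _ _).trans (by linarith)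

theorem abs_integral_sinc_inertial_le {r x τ M : ℝ} (hτ : 0 < τ) (hM : 1 ≤ M) :
    |∫ σ in (1 : ℝ)..M, Real.sinc √((σ ^ 2 - 1) * r ^ 2 + (τ + σ * x) ^ 2)| ≤ 16 * M / τ := by
  set A := r ^ 2 + x ^ 2 with hA
  have hA0 : 0 ≤ A := by positivity
  have hM0 : 0 < M := by linarith
  by_cases hc : τ / (2 * M) ≤ √A
  · have hsA : 0 < √A := lt_of_lt_of_le (by positivity) hc
    have hAp : 0 < A := Real.sqrt_pos.1 hsA
    have hsq : √A ^ 2 = A := Real.sq_sqrt hA0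
    set E := τ ^ 2 - r ^ 2 - (τ * x / √A) ^ 2 with hE
    have hQ : ∀ σ : ℝ, (σ ^ 2 - 1) * r ^ 2 + (τ + σ * x) ^ 2
        = (√A * σ + τ * x / √A) ^ 2 + E := by
      intro σ
      have : √A * σ * (τ * x / √A) = σ * τ * x := by field_simp
      rw [hE]
      linear_combination (-σ ^ 2) * hsq - 2 * this + σ ^ 2 * hA
    simp_rw [hQ]
    rw [intervalIntegral.integral_comp_mul_add (fun s => Real.sinc √(s ^ 2 + E)) hsA.ne',
      smul_eq_mul, abs_mul, abs_of_pos (inv_pos.2 hsA)]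
    have hb : |∫ s in √A * 1 + τ * x / √A..√A * M + τ * x / √A, Real.sinc √(s ^ 2 + E)| ≤ 8 := by
      refine abs_integral_sinc_sqrt_le (by gcongr) fun s hs => ?_
      have h1 : 1 ≤ (s - τ * x / √A) / √A := by
        rw [le_div_iff₀ hsA]; linarith [hs.1]
      have h2 := hQ ((s - τ * x / √A) / √A)
      rw [mul_div_cancel₀ _ hsA.ne', sub_add_cancel] at h2
      rw [← h2]
      have : 0 ≤ ((s - τ * x / √A) / √A) ^ 2 - 1 := by nlinarith
      positivity
    have hi : (√A)⁻¹ ≤ 2 * M / τ := by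
      rw [inv_le_comm₀ hsA (by positivity)]
      simpa using hc
    calc _ ≤ 2 * M / τ * 8 := by gcongr
      _ = _ := by ring
  · push Not at hc
    have hx : |x| ≤ √A := Real.abs_le_sqrt (by rw [hA]; nlinarith [sq_nonneg r])
    have hx2 : |x| * (2 * M) < τ := by
      rw [← lt_div_iff₀ (by positivity)]
      exact lt_of_le_of_lt hx hc
    have hb : ∀ σ ∈ Set.uIoc (1 : ℝ) M,
        ‖Real.sinc √((σ ^ 2 - 1) * r ^ 2 + (τ + σ * x) ^ 2)‖ ≤ 2 / τ := by
      intro σ hσ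
      rw [Set.uIoc_of_le hM] at hσ
      have hσ1 := hσ.1
      have h1 : |σ * x| ≤ τ / 2 := by
        rw [abs_mul, abs_of_pos (by linarith)]
        nlinarith [hσ.2, abs_nonneg x]
      have h2 : τ / 2 ≤ τ + σ * x := by linarith [(abs_le.1 h1).1]
      have h3 : τ / 2 ≤ √((σ ^ 2 - 1) * r ^ 2 + (τ + σ * x) ^ 2) := by
        apply Real.le_sqrt_of_sq_le
        have : 0 ≤ (σ ^ 2 - 1) * r ^ 2 := mul_nonneg (by nlinarith) (sq_nonneg _)
        nlinarith
      have h4 : 0 < √((σ ^ 2 - 1) * r ^ 2 + (τ + σ * x) ^ 2) := by linarith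
      rw [Real.sinc_of_ne_zero h4.ne', norm_div, Real.norm_eq_abs, Real.norm_eq_abs,
        abs_of_pos h4, div_le_div_iff₀ h4 hτ]
      have := Real.abs_sin_le_one √((σ ^ 2 - 1) * r ^ 2 + (τ + σ * x) ^ 2)
      nlinarith
    have := intervalIntegral.norm_integral_le_of_norm_le_const hb
    rw [Real.norm_eq_abs, abs_of_nonneg (by linarith : 0 ≤ M - 1)] at this
    refine this.trans ?_
    rw [div_mul_eq_mul_div]
    gcongr <;> linarith

theorem abs_mul_cos_sub_sin_le {z : ℝ} (h0 : 0 < z) (h1 : z ≤ 1) :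
    |z * Real.cos z - Real.sin z| ≤ z ^ 2 := by
  have a1 := Real.sin_gt_sub_cube h0
  have a2 := Real.sin_lt h0
  have a3 := Real.cos_le_one z
  have a4 := Real.one_sub_sq_div_two_le_cos (x := z)
  have a5 : z ^ 3 ≤ z ^ 2 := by nlinarith [sq_nonneg z]
  have a6 : 0 < z ^ 3 := by positivity
  rw [abs_le]
  constructor <;> nlinarith

theorem hasDerivAt_sinc {z : ℝ} (hz : z ≠ 0) :
    HasDerivAt Real.sinc ((z * Real.cos z - Real.sin z) / z ^ 2) z := by
  have h : HasDerivAt (fun y => Real.sin y / y) _ z :=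
    (Real.hasDerivAt_sin z).div (hasDerivAt_id z) hz
  refine (h.congr_of_eventuallyEq ?_).congr_deriv ?_
  · filter_upwards [isOpen_ne.mem_nhds hz] with y hy
    exact Real.sinc_of_ne_zero hy
  · ring

theorem hasDerivAt_sqrt_sq_add {r z : ℝ} (hz : 0 < z) :
    HasDerivAt (fun y : ℝ => √(y ^ 2 + r ^ 2)) (z / √(z ^ 2 + r ^ 2)) z := by
  have hQ : 0 < z ^ 2 + r ^ 2 := by positivity
  refine (((hasDerivAt_pow 2 z).add_const (r ^ 2)).sqrt hQ.ne').congr_deriv ?_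
  have := (Real.sqrt_pos.2 hQ).ne'
  field_simp
  norm_num

theorem le_sqrt_sq_add (r z : ℝ) : |z| ≤ √(z ^ 2 + r ^ 2) :=
  Real.abs_le_sqrt (by nlinarith [sq_nonneg r])

theorem exists_crossing {f : ℝ → ℝ} {α β : ℝ} (hab : α ≤ β) (hf : ContinuousOn f (Set.Icc α β))
    (hm : MonotoneOn f (Set.Icc α β)) (c : ℝ) :
    ∃ m ∈ Set.Icc α β, (m = α ∨ ∀ z ∈ Set.Icc α m, f z ≤ c) ∧
      (m = β ∨ ∀ z ∈ Set.Icc m β, c ≤ f z) := by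
  rcases le_total c (f α) with h1 | h1
  · exact ⟨α, ⟨le_rfl, hab⟩, Or.inl rfl, Or.inr fun z hz =>
      h1.trans (hm ⟨le_rfl, hab⟩ hz hz.1)⟩
  rcases le_total (f β) c with h2 | h2
  · exact ⟨β, ⟨hab, le_rfl⟩, Or.inr fun z hz => (hm hz ⟨hab, le_rfl⟩ hz.2).trans h2, Or.inl rfl⟩
  obtain ⟨m, hmem, hfm⟩ := intermediate_value_Icc hab hf ⟨h1, h2⟩
  refine ⟨m, hmem, Or.inr fun z hz => ?_, Or.inr fun z hz => ?_⟩
  · rw [← hfm]; exact hm ⟨hz.1, hz.2.trans hmem.2⟩ hmem hz.2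
  · rw [← hfm]; exact hm hmem ⟨hmem.1.trans hz.1, hz.2⟩ hz.1

section

variable {T r ε : ℝ}

theorem norm_integral_exp_div_le {α β c : ℝ} (hT : 1 ≤ T) (hε : ε ^ 2 = 1) (hα : 0 < α)
    (hab : α ≤ β) (hc : 0 < c)
    (hl : (∀ z ∈ Set.Icc α β, c ≤ T * z + ε * √(z ^ 2 + r ^ 2)) ∨
      (∀ z ∈ Set.Icc α β, T * z + ε * √(z ^ 2 + r ^ 2) ≤ -c)) :
    ‖∫ z in α..β, Complex.exp (Complex.I * ((T * √(z ^ 2 + r ^ 2) + ε * z : ℝ) : ℂ))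
        * ((1 / √(z ^ 2 + r ^ 2) : ℝ) : ℂ)‖ ≤ 4 / c := by
  set h : ℝ → ℝ := fun z => √(z ^ 2 + r ^ 2) with hh
  set l : ℝ → ℝ := fun z => T * z + ε * h z with hldef
  set θ : ℝ → ℝ := fun z => T * h z + ε * z with hθ
  have hε1 : |ε| = 1 := by rw [← sq_eq_sq₀ (abs_nonneg _) zero_le_one, sq_abs, hε, one_pow]
  have hcl : ∀ z ∈ Set.Icc α β, c ≤ |l z| := by
    intro z hz
    rcases hl with hl | hl
    · exact (hl z hz).trans (le_abs_self _)
    · exact le_abs.2 (Or.inr (by linarith [hl z hz]))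
  have hl0 : ∀ z ∈ Set.Icc α β, l z ≠ 0 := fun z hz => abs_pos.1 (hc.trans_le (hcl z hz))
  have hz0 : ∀ z ∈ Set.Icc α β, 0 < z := fun z hz => hα.trans_le hz.1
  have hhp : ∀ z ∈ Set.Icc α β, 0 < h z := fun z hz =>
    Real.sqrt_pos.2 (by have := hz0 z hz; positivity)
  have hzh : ∀ z ∈ Set.Icc α β, z / h z ≤ 1 := by
    intro z hz
    rw [div_le_one (hhp z hz)]
    exact (le_abs_self z).trans (le_sqrt_sq_add r z)
  have hl'nn : ∀ z ∈ Set.Icc α β, 0 ≤ T + ε * (z / h z) := by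
    intro z hz
    have h1 : |ε * (z / h z)| ≤ 1 := by
      rw [abs_mul, hε1, one_mul, abs_of_nonneg (div_nonneg (hz0 z hz).le (hhp z hz).le)]
      exact hzh z hz
    linarith [(abs_le.1 h1).1]
  have dh : ∀ z ∈ Set.Icc α β, HasDerivAt h (z / h z) z := fun z hz =>
    hasDerivAt_sqrt_sq_add (hz0 z hz)
  have dl : ∀ z ∈ Set.Icc α β, HasDerivAt l (T + ε * (z / h z)) z := fun z hz => by
    refine (((hasDerivAt_id z).const_mul T).add ((dh z hz).const_mul ε)).congr_deriv ?_
    rw [mul_one]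
  have dθ : ∀ z ∈ Set.Icc α β, HasDerivAt θ (l z / h z) z := fun z hz => by
    refine (((dh z hz).const_mul T).add ((hasDerivAt_id z).const_mul ε)).congr_deriv ?_
    have := (hhp z hz).ne'
    simp only [hldef]
    field_simp
  have ch : Continuous h := by fun_prop
  have cl : Continuous l := by fun_prop
  have cθ : Continuous θ := by fun_prop
  have cl' : ContinuousOn (fun z => T + ε * (z / h z)) (Set.Icc α β) :=
    continuousOn_const.add (continuousOn_const.mul
      (continuousOn_id.div ch.continuousOn fun z hz => (hhp z hz).ne'))
  have dinv : ∀ z ∈ Set.Icc α β,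
      HasDerivAt (fun y => (l y)⁻¹) (-(T + ε * (z / h z)) / l z ^ 2) z := fun z hz =>
    (dl z hz).inv (hl0 z hz)
  have cinv' : ContinuousOn (fun z => -(T + ε * (z / h z)) / l z ^ 2) (Set.Icc α β) :=
    cl'.neg.div (by fun_prop) fun z hz => pow_ne_zero _ (hl0 z hz)
  have iinv' : IntervalIntegrable (fun z => -(T + ε * (z / h z)) / l z ^ 2) volume α β := by
    apply ContinuousOn.intervalIntegrable
    rwa [Set.uIcc_of_le hab]
  have dE : ∀ z ∈ Set.Icc α β, HasDerivAt (fun y => Complex.exp (Complex.I * (θ y : ℂ)))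
      (Complex.exp (Complex.I * (θ z : ℂ)) * (Complex.I * ((l z / h z : ℝ) : ℂ))) z := fun z hz =>
    ((dθ z hz).ofReal_comp.const_mul Complex.I).cexp
  have cE' : ContinuousOn (fun z => Complex.exp (Complex.I * (θ z : ℂ))
      * (Complex.I * ((l z / h z : ℝ) : ℂ))) (Set.Icc α β) := by
    refine ContinuousOn.mul (by fun_prop) (continuousOn_const.mul ?_)
    exact Complex.continuous_ofReal.comp_continuousOn
      (cl.continuousOn.div ch.continuousOn fun z hz => (hhp z hz).ne')
  have hip := intervalIntegral.integral_mul_deriv_eq_deriv_mul (a := α) (b := β)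
    (u := fun z => (((l z)⁻¹ : ℝ) : ℂ))
    (u' := fun z => ((-(T + ε * (z / h z)) / l z ^ 2 : ℝ) : ℂ))
    (v := fun z => Complex.exp (Complex.I * (θ z : ℂ)))
    (v' := fun z => Complex.exp (Complex.I * (θ z : ℂ)) * (Complex.I * ((l z / h z : ℝ) : ℂ)))
    (fun z hz => (dinv z (by rwa [Set.uIcc_of_le hab] at hz)).ofReal_comp)
    (fun z hz => dE z (by rwa [Set.uIcc_of_le hab] at hz))
    (by
      apply ContinuousOn.intervalIntegrable
      rw [Set.uIcc_of_le hab]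
      exact Complex.continuous_ofReal.comp_continuousOn cinv')
    (by apply ContinuousOn.intervalIntegrable; rwa [Set.uIcc_of_le hab])
  have hnE : ∀ z, ‖Complex.exp (Complex.I * (θ z : ℂ))‖ = 1 := fun z => by
    rw [mul_comm]; exact Complex.norm_exp_ofReal_mul_I _
  have e1 : ∫ z in α..β, Complex.exp (Complex.I * (θ z : ℂ)) * ((1 / h z : ℝ) : ℂ)
      = -Complex.I * ∫ z in α..β, (((l z)⁻¹ : ℝ) : ℂ) *
        (Complex.exp (Complex.I * (θ z : ℂ)) * (Complex.I * ((l z / h z : ℝ) : ℂ))) := by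
    rw [← intervalIntegral.integral_const_mul]
    refine intervalIntegral.integral_congr fun z hz => ?_
    rw [Set.uIcc_of_le hab] at hz
    have a1 : (l z : ℂ) ≠ 0 := by exact_mod_cast hl0 z hz
    have a2 : (h z : ℂ) ≠ 0 := by exact_mod_cast (hhp z hz).ne'
    push_cast
    field_simp
    rw [Complex.I_sq]
    ring
  have e2 : ‖∫ z in α..β, ((-(T + ε * (z / h z)) / l z ^ 2 : ℝ) : ℂ) *
      Complex.exp (Complex.I * (θ z : ℂ))‖ ≤ 2 / c := by
    have hle : ‖∫ z in α..β, ((-(T + ε * (z / h z)) / l z ^ 2 : ℝ) : ℂ) *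
        Complex.exp (Complex.I * (θ z : ℂ))‖ ≤ ∫ z in α..β, (T + ε * (z / h z)) / l z ^ 2 := by
      refine intervalIntegral.norm_integral_le_of_norm_le hab ?_ ?_
      · refine Filter.Eventually.of_forall fun z hz => ?_
        have hz' : z ∈ Set.Icc α β := ⟨hz.1.le, hz.2⟩
        rw [norm_mul, hnE, mul_one, Complex.norm_real, Real.norm_eq_abs, neg_div, abs_neg,
          abs_of_nonneg (div_nonneg (hl'nn z hz') (sq_nonneg _))]
      · refine iinv'.neg.congr fun z _ => ?_
        simp only [Pi.neg_apply, neg_div, neg_neg]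
    have hInt : ∫ z in α..β, (T + ε * (z / h z)) / l z ^ 2 = (l α)⁻¹ - (l β)⁻¹ := by
      have := intervalIntegral.integral_eq_sub_of_hasDerivAt
        (fun z hz => dinv z (by rwa [Set.uIcc_of_le hab] at hz)) iinv'
      simp only [neg_div, intervalIntegral.integral_neg] at this
      linarith
    rw [hInt] at hle
    refine hle.trans ?_
    have b : ∀ z ∈ Set.Icc α β, |(l z)⁻¹| ≤ c⁻¹ := fun z hz => by
      rw [abs_inv]
      exact inv_anti₀ hc (hcl z hz)
    have b1 := abs_le.1 (b α ⟨le_rfl, hab⟩)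
    have b2 := abs_le.1 (b β ⟨hab, le_rfl⟩)
    rw [div_eq_mul_inv]
    linarith [b1.2, b2.1]
  have e3 : ∀ z ∈ Set.Icc α β,
      ‖(((l z)⁻¹ : ℝ) : ℂ) * Complex.exp (Complex.I * (θ z : ℂ))‖ ≤ 1 / c := fun z hz => by
    rw [norm_mul, hnE, mul_one, Complex.norm_real, norm_inv, one_div]
    exact inv_anti₀ hc (hcl z hz)
  change ‖∫ z in α..β, Complex.exp (Complex.I * (θ z : ℂ)) * ((1 / h z : ℝ) : ℂ)‖ ≤ 4 / c
  rw [e1, hip, norm_mul, norm_neg, Complex.norm_I, one_mul]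
  refine (norm_sub_le _ _).trans ?_
  have := (norm_sub_le ((((l β)⁻¹ : ℝ) : ℂ) * Complex.exp (Complex.I * (θ β : ℂ)))
    ((((l α)⁻¹ : ℝ) : ℂ) * Complex.exp (Complex.I * (θ α : ℂ))))
  have f1 := e3 α ⟨le_rfl, hab⟩
  have f2 := e3 β ⟨hab, le_rfl⟩
  have : (4 : ℝ) / c = 1 / c + 1 / c + 2 / c := by ring
  linarith

end

section

variable {T r : ℝ}

theorem continuousOn_exp_div_sqrt (T r ε : ℝ) {α β : ℝ} (hα : 0 < α) :
    ContinuousOn (fun z : ℝ => Complex.exp (Complex.I * ((T * √(z ^ 2 + r ^ 2) + ε * z : ℝ) : ℂ))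
        * ((1 / √(z ^ 2 + r ^ 2) : ℝ) : ℂ)) (Set.Icc α β) := by
  refine ContinuousOn.mul (by fun_prop) ?_
  refine Complex.continuous_ofReal.comp_continuousOn
    (continuousOn_const.div (by fun_prop) fun z hz => ?_)
  have : 0 < z := hα.trans_le hz.1
  exact (Real.sqrt_pos.2 (by positivity)).ne'

theorem intervalIntegrable_exp_div_sqrt (T r ε : ℝ) {α β : ℝ} (hα : 0 < α) (hab : α ≤ β) :
    IntervalIntegrable (fun z : ℝ => Complex.exp
        (Complex.I * ((T * √(z ^ 2 + r ^ 2) + ε * z : ℝ) : ℂ))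
        * ((1 / √(z ^ 2 + r ^ 2) : ℝ) : ℂ)) volume α β := by
  apply ContinuousOn.intervalIntegrable
  rw [Set.uIcc_of_le hab]
  exact continuousOn_exp_div_sqrt T r ε hα

theorem sqrt_sq_add_sub_le (r : ℝ) {a b : ℝ} (ha : 0 < a) (hab : a ≤ b) :
    √(b ^ 2 + r ^ 2) - √(a ^ 2 + r ^ 2) ≤ b - a := by
  have h1 : 0 ≤ √(a ^ 2 + r ^ 2) := Real.sqrt_nonneg _
  have h2 : a ≤ √(a ^ 2 + r ^ 2) := (le_abs_self a).trans (le_sqrt_sq_add r a)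
  have h3 : √(a ^ 2 + r ^ 2) ^ 2 = a ^ 2 + r ^ 2 := Real.sq_sqrt (by positivity)
  have : √(b ^ 2 + r ^ 2) ≤ √(a ^ 2 + r ^ 2) + (b - a) := by
    rw [Real.sqrt_le_left (by linarith)]
    nlinarith
  linarith

theorem norm_integral_exp_add_le {α β : ℝ} (hT : 2 ≤ T) (hα : 1 ≤ α) (hab : α ≤ β) :
    ‖∫ z in α..β, Complex.exp (Complex.I * ((T * √(z ^ 2 + r ^ 2) + 1 * z : ℝ) : ℂ))
        * ((1 / √(z ^ 2 + r ^ 2) : ℝ) : ℂ)‖ ≤ 4 / (T * √α) := by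
  refine norm_integral_exp_div_le (by linarith) (by norm_num) (by linarith) hab
    (by positivity) (Or.inl fun z hz => ?_)
  have h1 : √α ≤ α := (Real.sqrt_le_left (by linarith)).2 (by nlinarith)
  have h2 : 0 ≤ √(z ^ 2 + r ^ 2) := Real.sqrt_nonneg _
  have h3 : T * √α ≤ T * z := by gcongr; exact h1.trans hz.1
  linarith

theorem norm_integral_exp_sub_le {α β : ℝ} (hT : 2 ≤ T) (hα : 1 ≤ α) (hab : α ≤ β) :
    ‖∫ z in α..β, Complex.exp (Complex.I * ((T * √(z ^ 2 + r ^ 2) + (-1) * z : ℝ) : ℂ))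
        * ((1 / √(z ^ 2 + r ^ 2) : ℝ) : ℂ)‖ ≤ 20 / (T * √α) := by
  set l : ℝ → ℝ := fun z => T * z + (-1) * √(z ^ 2 + r ^ 2) with hl
  set c : ℝ := T * √α / 2 with hcdef
  have hα0 : 0 < α := by linarith
  have hs : 1 ≤ √α := Real.one_le_sqrt.2 hα
  have hss : √α ^ 2 = α := Real.sq_sqrt hα0.le
  have hc : 0 < c := by positivity
  have cl : Continuous l := by fun_prop
  have hslope : ∀ a b : ℝ, 0 < a → a ≤ b → (T - 1) * (b - a) ≤ l b - l a := by
    intro a b ha hab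
    have := sqrt_sq_add_sub_le r ha hab
    simp only [hl]
    linarith
  have mono : MonotoneOn l (Set.Icc α β) := by
    intro a ha b hb hab
    have h1 := hslope a b (hα0.trans_le ha.1) hab
    have h2 : 0 ≤ (T - 1) * (b - a) := mul_nonneg (by linarith) (by linarith)
    linarith
  obtain ⟨m, hm, hm1, hm2⟩ := exists_crossing hab cl.continuousOn mono (-c)
  obtain ⟨p, hp, hp1, hp2⟩ := exists_crossing hm.2 cl.continuousOn
    (mono.mono (Set.Icc_subset_Icc_left hm.1)) c
  have hm0 : 0 < m := hα0.trans_le hm.1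
  have hp0 : 0 < p := hm0.trans_le hp.1
  have i1 := intervalIntegrable_exp_div_sqrt T r (-1) hα0 hm.1
  have i2 := intervalIntegrable_exp_div_sqrt T r (-1) hm0 hp.1
  have i3 := intervalIntegrable_exp_div_sqrt T r (-1) hp0 hp.2
  have b1 : ‖∫ z in α..m, Complex.exp (Complex.I * ((T * √(z ^ 2 + r ^ 2) + (-1) * z : ℝ) : ℂ))
        * ((1 / √(z ^ 2 + r ^ 2) : ℝ) : ℂ)‖ ≤ 4 / c := by
    rcases hm1 with h | h
    · rw [h, intervalIntegral.integral_same, norm_zero]; positivity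
    · exact norm_integral_exp_div_le (by linarith) (by norm_num) hα0 hm.1 hc (Or.inr h)
  have b3 : ‖∫ z in p..β, Complex.exp (Complex.I * ((T * √(z ^ 2 + r ^ 2) + (-1) * z : ℝ) : ℂ))
        * ((1 / √(z ^ 2 + r ^ 2) : ℝ) : ℂ)‖ ≤ 4 / c := by
    rcases hp2 with h | h
    · rw [h, intervalIntegral.integral_same, norm_zero]; positivity
    · exact norm_integral_exp_div_le (by linarith) (by norm_num) hp0 hp.2 hc (Or.inl h)
  have b2 : ‖∫ z in m..p, Complex.exp (Complex.I * ((T * √(z ^ 2 + r ^ 2) + (-1) * z : ℝ) : ℂ))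
        * ((1 / √(z ^ 2 + r ^ 2) : ℝ) : ℂ)‖ ≤ 4 / (T * √α) := by
    rcases eq_or_ne p m with h | h
    · rw [h, intervalIntegral.integral_same, norm_zero]; positivity
    have q1 := hp1.resolve_left h
    have q2 := hm2.resolve_left fun h' => h (le_antisymm (h' ▸ hp.2) hp.1)
    have hlen : (T - 1) * (p - m) ≤ 2 * c := by
      have := hslope m p hm0 hp.1
      have := q1 p ⟨hp.1, le_rfl⟩
      have := q2 m ⟨le_rfl, hm.2⟩
      linarith
    have hbd : ∀ z ∈ Set.uIoc m p,
        ‖Complex.exp (Complex.I * ((T * √(z ^ 2 + r ^ 2) + (-1) * z : ℝ) : ℂ))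
        * ((1 / √(z ^ 2 + r ^ 2) : ℝ) : ℂ)‖ ≤ 2 / (T * α) := by
      intro z hz
      rw [Set.uIoc_of_le hp.1] at hz
      have h1 := q1 z ⟨hz.1.le, hz.2⟩
      have h2 : T * α / 2 ≤ √(z ^ 2 + r ^ 2) := by
        have h3 : T * α ≤ T * z := by gcongr; exact hm.1.trans hz.1.le
        have h4 : c ≤ T * α / 2 := by
          rw [hcdef]; gcongr; exact (Real.sqrt_le_left (by linarith)).2 (by nlinarith)
        simp only [hl] at h1
        linarith
      rw [mul_comm Complex.I, norm_mul, Complex.norm_exp_ofReal_mul_I, one_mul,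
        Complex.norm_real, Real.norm_eq_abs, abs_of_nonneg (by positivity)]
      have h5 : 0 < T * α / 2 := by positivity
      calc 1 / √(z ^ 2 + r ^ 2) ≤ 1 / (T * α / 2) := one_div_le_one_div_of_le h5 h2
        _ = _ := by field_simp
    refine (intervalIntegral.norm_integral_le_of_norm_le_const hbd).trans ?_
    rw [abs_of_nonneg (sub_nonneg.2 hp.1)]
    have hpm : p - m ≤ 2 * √α := by
      have : (T - 1) * (p - m) ≤ (T - 1) * (2 * √α) := by
        refine hlen.trans ?_
        rw [hcdef]
        nlinarith
      exact le_of_mul_le_mul_left this (by linarith)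
    calc 2 / (T * α) * (p - m) ≤ 2 / (T * α) * (2 * √α) := by gcongr
      _ = 4 / (T * √α) := by
        rw [← hss]
        have : √α ≠ 0 := by positivity
        field_simp
        rw [Real.sqrt_sq (by positivity)]
        ring
  rw [← intervalIntegral.integral_add_adjacent_intervals (i1.trans i2) i3,
    ← intervalIntegral.integral_add_adjacent_intervals i1 i2]
  have hcc : 4 / c = 8 / (T * √α) := by
    rw [hcdef]; field_simp; norm_num
  have hfin : 20 / (T * √α) = 8 / (T * √α) + 4 / (T * √α) + 8 / (T * √α) := by ring
  rw [hcc] at b1 b3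
  refine (norm_add_le _ _).trans ?_
  have := norm_add_le (∫ z in α..m, Complex.exp
    (Complex.I * ((T * √(z ^ 2 + r ^ 2) + (-1) * z : ℝ) : ℂ)) * ((1 / √(z ^ 2 + r ^ 2) : ℝ) : ℂ))
    (∫ z in m..p, Complex.exp
    (Complex.I * ((T * √(z ^ 2 + r ^ 2) + (-1) * z : ℝ) : ℂ)) * ((1 / √(z ^ 2 + r ^ 2) : ℝ) : ℂ))
  linarith

theorem norm_integral_exp_sinc_le_of_one_le {α β : ℝ} (hT : 2 ≤ T) (hα : 1 ≤ α) (hab : α ≤ β) :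
    ‖∫ z in α..β, Complex.exp (Complex.I * ((T * √(z ^ 2 + r ^ 2) : ℝ) : ℂ))
        * ((Real.sinc z * (z / √(z ^ 2 + r ^ 2)) : ℝ) : ℂ)‖ ≤ 12 / (T * √α) := by
  have hα0 : 0 < α := by linarith
  have e : ∫ z in α..β, Complex.exp (Complex.I * ((T * √(z ^ 2 + r ^ 2) : ℝ) : ℂ))
        * ((Real.sinc z * (z / √(z ^ 2 + r ^ 2)) : ℝ) : ℂ)
      = (∫ z in α..β, (-(Complex.I / 2)) * (Complex.exp
          (Complex.I * ((T * √(z ^ 2 + r ^ 2) + 1 * z : ℝ) : ℂ))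
        * ((1 / √(z ^ 2 + r ^ 2) : ℝ) : ℂ)))
        - ∫ z in α..β, (-(Complex.I / 2)) * (Complex.exp
          (Complex.I * ((T * √(z ^ 2 + r ^ 2) + (-1) * z : ℝ) : ℂ))
        * ((1 / √(z ^ 2 + r ^ 2) : ℝ) : ℂ)) := by
    rw [← intervalIntegral.integral_sub
      ((intervalIntegrable_exp_div_sqrt T r 1 hα0 hab).const_mul _)
      ((intervalIntegrable_exp_div_sqrt T r (-1) hα0 hab).const_mul _)]
    refine intervalIntegral.integral_congr fun z hz => ?_
    rw [Set.uIcc_of_le hab] at hz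
    have hz0 : 0 < z := hα0.trans_le hz.1
    have hs : Real.sinc z * (z / √(z ^ 2 + r ^ 2)) = Real.sin z / √(z ^ 2 + r ^ 2) := by
      rw [Real.sinc_of_ne_zero hz0.ne']
      field_simp
    rw [hs]
    push_cast
    have h1 : Complex.exp (Complex.I * (T * (√(z ^ 2 + r ^ 2) : ℂ) + 1 * (z : ℂ)))
        = Complex.exp (Complex.I * (T * (√(z ^ 2 + r ^ 2) : ℂ))) * Complex.exp (z * Complex.I) := by
      rw [← Complex.exp_add]; ring_nf
    have h2 : Complex.exp (Complex.I * (T * (√(z ^ 2 + r ^ 2) : ℂ) + (-1) * (z : ℂ)))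
        = Complex.exp (Complex.I * (T * (√(z ^ 2 + r ^ 2) : ℂ)))
          * Complex.exp (-z * Complex.I) := by
      rw [← Complex.exp_add]; ring_nf
    simp only [h1, h2, Complex.sin]
    ring
  rw [e, intervalIntegral.integral_const_mul, intervalIntegral.integral_const_mul, ← mul_sub,
    norm_mul]
  have hn : ‖-(Complex.I / 2)‖ = 1 / 2 := by simp
  rw [hn]
  have h1 := norm_integral_exp_add_le (r := r) hT hα hab
  have h2 := norm_integral_exp_sub_le (r := r) hT hα hab
  have h3 : 12 / (T * √α) = 1 / 2 * (4 / (T * √α) + 20 / (T * √α)) := by ring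
  rw [h3]
  gcongr
  exact (norm_sub_le _ _).trans (add_le_add h1 h2)

end

section

variable {T r : ℝ}

theorem intervalIntegrable_div_sqrt (r α β : ℝ) :
    IntervalIntegrable (fun z : ℝ => z / √(z ^ 2 + r ^ 2)) volume α β := by
  refine (intervalIntegrable_const (c := (1 : ℝ))).mono_fun ?_ ?_
  · exact (by fun_prop : Measurable fun z : ℝ => z / √(z ^ 2 + r ^ 2)).aestronglyMeasurable
  · refine Filter.Eventually.of_forall fun z => ?_
    simp only [norm_div, Real.norm_eq_abs, abs_one, abs_of_nonneg (Real.sqrt_nonneg _)]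
    exact div_le_one_of_le₀ (le_sqrt_sq_add r z) (Real.sqrt_nonneg _)

theorem norm_integral_exp_sinc_le_of_le_one {α β : ℝ} (hT : 0 < T) (hα : 0 ≤ α) (hab : α ≤ β)
    (hβ : β ≤ 1) :
    ‖∫ z in α..β, Complex.exp (Complex.I * ((T * √(z ^ 2 + r ^ 2) : ℝ) : ℂ))
        * ((Real.sinc z * (z / √(z ^ 2 + r ^ 2)) : ℝ) : ℂ)‖ ≤ 3 / T := by
  have hTC : (T : ℂ) ≠ 0 := by exact_mod_cast hT.ne'
  have hnE : ∀ z : ℝ, ‖Complex.exp (Complex.I * ((T * √(z ^ 2 + r ^ 2) : ℝ) : ℂ))‖ = 1 :=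
    fun z => by rw [mul_comm]; exact Complex.norm_exp_ofReal_mul_I _
  have hsc : ∀ z ∈ Set.Ioc α β, |(z * Real.cos z - Real.sin z) / z ^ 2| ≤ 1 := by
    intro z hz
    have hz0 : 0 < z := hα.trans_lt hz.1
    rw [abs_div, abs_of_pos (by positivity : 0 < z ^ 2)]
    exact div_le_one_of_le₀ (abs_mul_cos_sub_sin_le hz0 (hz.2.trans hβ)) (by positivity)
  have hip := intervalIntegral.integral_mul_deriv_eq_deriv_mul_of_hasDerivAt (a := α) (b := β)
    (u := fun z => ((Real.sinc z : ℝ) : ℂ))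
    (u' := fun z => (((z * Real.cos z - Real.sin z) / z ^ 2 : ℝ) : ℂ))
    (v := fun z => Complex.exp (Complex.I * ((T * √(z ^ 2 + r ^ 2) : ℝ) : ℂ)))
    (v' := fun z => Complex.exp (Complex.I * ((T * √(z ^ 2 + r ^ 2) : ℝ) : ℂ)) *
      (Complex.I * ((T * (z / √(z ^ 2 + r ^ 2)) : ℝ) : ℂ)))
    (by
      exact (Complex.continuous_ofReal.comp Real.continuous_sinc).continuousOn)
    (by fun_prop)
    (fun z hz => by
      rw [min_eq_left hab, max_eq_right hab] at hz
      exact (hasDerivAt_sinc (hα.trans_lt hz.1).ne').ofReal_comp)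
    (fun z hz => by
      rw [min_eq_left hab, max_eq_right hab] at hz
      exact ((((hasDerivAt_sqrt_sq_add (hα.trans_lt hz.1)).const_mul T).ofReal_comp).const_mul
        Complex.I).cexp)
    (by
      refine (intervalIntegrable_const (c := (1 : ℝ))).mono_fun ?_ ?_
      · exact (by fun_prop : Measurable fun z : ℝ =>
          (((z * Real.cos z - Real.sin z) / z ^ 2 : ℝ) : ℂ)).aestronglyMeasurable
      · rw [Set.uIoc_of_le hab]
        refine (ae_restrict_iff' measurableSet_Ioc).2 (Filter.Eventually.of_forall fun z hz => ?_)
        beta_reduce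
        rw [Complex.norm_real, Real.norm_eq_abs, norm_one]
        exact hsc z hz)
    (by
      refine IntervalIntegrable.continuousOn_mul ?_ (by fun_prop)
      refine IntervalIntegrable.const_mul ?_ _
      have := (intervalIntegrable_div_sqrt r α β).const_mul T
      exact ⟨this.1.ofReal, this.2.ofReal⟩)
  have e1 : ∫ z in α..β, Complex.exp (Complex.I * ((T * √(z ^ 2 + r ^ 2) : ℝ) : ℂ))
        * ((Real.sinc z * (z / √(z ^ 2 + r ^ 2)) : ℝ) : ℂ)
      = -(Complex.I / T) * ∫ z in α..β, ((Real.sinc z : ℝ) : ℂ) *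
        (Complex.exp (Complex.I * ((T * √(z ^ 2 + r ^ 2) : ℝ) : ℂ)) *
      (Complex.I * ((T * (z / √(z ^ 2 + r ^ 2)) : ℝ) : ℂ))) := by
    rw [← intervalIntegral.integral_const_mul]
    refine intervalIntegral.integral_congr fun z _ => ?_
    push_cast
    field_simp
    rw [Complex.I_sq]
    ring
  rw [e1, hip, norm_mul]
  have hn : ‖-(Complex.I / T)‖ = 1 / T := by simp [abs_of_pos hT]
  have b1 : ∀ z : ℝ, ‖((Real.sinc z : ℝ) : ℂ) *
      Complex.exp (Complex.I * ((T * √(z ^ 2 + r ^ 2) : ℝ) : ℂ))‖ ≤ 1 := fun z => by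
    rw [norm_mul, hnE, mul_one, Complex.norm_real]
    exact Real.abs_sinc_le_one z
  have b2 : ‖∫ z in α..β, (((z * Real.cos z - Real.sin z) / z ^ 2 : ℝ) : ℂ) *
      Complex.exp (Complex.I * ((T * √(z ^ 2 + r ^ 2) : ℝ) : ℂ))‖ ≤ 1 * |β - α| := by
    refine intervalIntegral.norm_integral_le_of_norm_le_const fun z hz => ?_
    rw [Set.uIoc_of_le hab] at hz
    rw [norm_mul, hnE, mul_one, Complex.norm_real]
    exact hsc z hz
  rw [abs_of_nonneg (by linarith), one_mul] at b2
  rw [hn]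
  have h3 : 3 / T = 1 / T * 3 := by ring
  rw [h3]
  gcongr
  refine (norm_sub_le _ _).trans ?_
  have := norm_sub_le (((Real.sinc β : ℝ) : ℂ) *
      Complex.exp (Complex.I * ((T * √(β ^ 2 + r ^ 2) : ℝ) : ℂ))) (((Real.sinc α : ℝ) : ℂ) *
      Complex.exp (Complex.I * ((T * √(α ^ 2 + r ^ 2) : ℝ) : ℂ)))
  linarith [b1 α, b1 β]

theorem intervalIntegrable_exp_sinc (T r α β : ℝ) :
    IntervalIntegrable (fun z : ℝ => Complex.exp (Complex.I * ((T * √(z ^ 2 + r ^ 2) : ℝ) : ℂ))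
        * ((Real.sinc z * (z / √(z ^ 2 + r ^ 2)) : ℝ) : ℂ)) volume α β := by
  refine IntervalIntegrable.continuousOn_mul ?_ (by fun_prop)
  have := (intervalIntegrable_div_sqrt r α β).continuousOn_mul
    Real.continuous_sinc.continuousOn
  exact ⟨this.1.ofReal, this.2.ofReal⟩

theorem norm_integral_exp_sinc_le {α β : ℝ} (hT : 2 ≤ T) (hα : 0 ≤ α) (hab : α ≤ β) :
    ‖∫ z in α..β, Complex.exp (Complex.I * ((T * √(z ^ 2 + r ^ 2) : ℝ) : ℂ))
        * ((Real.sinc z * (z / √(z ^ 2 + r ^ 2)) : ℝ) : ℂ)‖ ≤ 15 / (T * √(max 1 α)) := by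
  have hT0 : 0 < T := by linarith
  rcases le_total 1 α with h1 | h1
  · rw [max_eq_right h1]
    refine (norm_integral_exp_sinc_le_of_one_le hT h1 hab).trans ?_
    gcongr
    norm_num
  rw [max_eq_left h1, Real.sqrt_one, mul_one]
  rcases le_total β 1 with h2 | h2
  · refine (norm_integral_exp_sinc_le_of_le_one hT0 hα hab h2).trans ?_
    gcongr
    norm_num
  rw [← intervalIntegral.integral_add_adjacent_intervals
    (intervalIntegrable_exp_sinc T r α 1) (intervalIntegrable_exp_sinc T r 1 β)]
  have e1 := norm_integral_exp_sinc_le_of_le_one (r := r) hT0 hα h1 le_rfl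
  have e2 := norm_integral_exp_sinc_le_of_one_le (r := r) hT le_rfl h2
  rw [Real.sqrt_one, mul_one] at e2
  refine (norm_add_le _ _).trans ?_
  have : 15 / T = 3 / T + 12 / T := by ring
  linarith

theorem inv_sqrt_max_le {x : ℝ} (hx : 0 ≤ x) :
    1 / √(max 1 x) ≤ 2 * (1 + x) ^ (-(1 / 3) : ℝ) := by
  have hm : 1 ≤ max 1 x := le_max_left _ _
  have h1 : 1 / √(max 1 x) = (max 1 x) ^ (-(1 / 2) : ℝ) := by
    rw [Real.sqrt_eq_rpow, Real.rpow_neg (by linarith), one_div]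
  have h2 : (max 1 x) ^ (-(1 / 2) : ℝ) ≤ (max 1 x) ^ (-(1 / 3) : ℝ) :=
    Real.rpow_le_rpow_of_exponent_le hm (by norm_num)
  have h3 : (max 1 x) ^ (-(1 / 3) : ℝ) ≤ ((1 + x) / 2) ^ (-(1 / 3) : ℝ) := by
    refine Real.rpow_le_rpow_of_nonpos (by linarith) ?_ (by norm_num)
    linarith [le_max_right 1 x]
  have h4 : ((1 + x) / 2) ^ (-(1 / 3) : ℝ)
      = (1 + x) ^ (-(1 / 3) : ℝ) * (2 : ℝ) ^ ((1 / 3) : ℝ) := by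
    rw [Real.div_rpow (by linarith) (by norm_num), Real.rpow_neg (by norm_num : (0:ℝ) ≤ 2)]
    field_simp
  have h5 : (2 : ℝ) ^ ((1 / 3) : ℝ) ≤ 2 := by
    conv_rhs => rw [← Real.rpow_one 2]
    exact Real.rpow_le_rpow_of_exponent_le (by norm_num) (by norm_num)
  rw [h1]
  refine (h2.trans h3).trans ?_
  rw [h4, mul_comm]
  have : 0 ≤ (1 + x) ^ (-(1 / 3) : ℝ) := by positivity
  gcongr

end

theorem inv_sqrt_le_deriv {σ : ℝ} (hσ : 1 < σ) :
    1 / √(σ ^ 2 - 1) ≤ σ * (σ ^ 2 - 1) ^ (-(2 / 3) : ℝ) := by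
  have hw : 0 < σ ^ 2 - 1 := by nlinarith
  have h1 : 1 / √(σ ^ 2 - 1) = (σ ^ 2 - 1) ^ ((1 / 6) : ℝ) * (σ ^ 2 - 1) ^ (-(2 / 3) : ℝ) := by
    rw [← Real.rpow_add hw, Real.sqrt_eq_rpow, one_div, ← Real.rpow_neg hw.le]
    norm_num
  rw [h1]
  have h2 : (σ ^ 2 - 1) ^ ((1 / 6) : ℝ) ≤ (σ ^ (6 : ℝ)) ^ ((1 / 6) : ℝ) := by
    refine Real.rpow_le_rpow hw.le ?_ (by norm_num)
    have : σ ^ (6 : ℝ) = σ ^ 6 := by norm_cast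
    rw [this]
    nlinarith [pow_le_pow_right₀ hσ.le (show 2 ≤ 6 by norm_num)]
  rw [← Real.rpow_mul (by linarith)] at h2
  norm_num at h2
  gcongr

theorem hasDerivAt_sq_sub_one_rpow {σ : ℝ} (hσ : 1 < σ) :
    HasDerivAt (fun s : ℝ => 3 / 2 * (s ^ 2 - 1) ^ ((1 / 3) : ℝ))
      (σ * (σ ^ 2 - 1) ^ (-(2 / 3) : ℝ)) σ := by
  have hw : 0 < σ ^ 2 - 1 := by nlinarith
  refine ((((hasDerivAt_pow 2 σ).sub_const 1).rpow_const (p := 1 / 3)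
    (Or.inl hw.ne')).const_mul (3 / 2)).congr_deriv ?_
  norm_num
  ring

theorem norm_integral_exp_sinc_le_of_large {A r τ M : ℝ} (hA : 0 < A) (hr : r ^ 2 ≤ A)
    (hM : 1 ≤ M) :
    ‖∫ σ in (1 : ℝ)..M, Complex.exp (Complex.I * ((τ * σ : ℝ) : ℂ)) *
      ((Real.sinc √(A * σ ^ 2 - r ^ 2) : ℝ) : ℂ)‖
      ≤ 3 / 2 * (M ^ 2 - 1) ^ ((1 / 3) : ℝ) / √A := by
  have hsA : 0 < √A := Real.sqrt_pos.2 hA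
  have hcont : ContinuousOn (fun s : ℝ => 3 / 2 * (s ^ 2 - 1) ^ ((1 / 3) : ℝ)) (Set.Icc 1 M) :=
    continuousOn_const.mul
      (ContinuousOn.rpow_const (by fun_prop) fun _ _ => Or.inr (by norm_num))
  have hInt : IntervalIntegrable (fun σ : ℝ => σ * (σ ^ 2 - 1) ^ (-(2 / 3) : ℝ)) volume 1 M := by
    rw [intervalIntegrable_iff_integrableOn_Ioc_of_le hM]
    refine intervalIntegral.integrableOn_deriv_of_nonneg hcont
      (fun s hs => hasDerivAt_sq_sub_one_rpow hs.1) fun s hs => ?_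
    have : 0 ≤ s ^ 2 - 1 := by nlinarith [hs.1]
    have : 0 ≤ s := by linarith [hs.1]
    positivity
  have hval := intervalIntegral.integral_eq_sub_of_hasDerivAt_of_le hM hcont
    (fun s hs => hasDerivAt_sq_sub_one_rpow hs.1) hInt
  have hle : ‖∫ σ in (1 : ℝ)..M, Complex.exp (Complex.I * ((τ * σ : ℝ) : ℂ)) *
      ((Real.sinc √(A * σ ^ 2 - r ^ 2) : ℝ) : ℂ)‖
      ≤ ∫ σ in (1 : ℝ)..M, (√A)⁻¹ * (σ * (σ ^ 2 - 1) ^ (-(2 / 3) : ℝ)) := by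
    refine intervalIntegral.norm_integral_le_of_norm_le hM ?_ (hInt.const_mul _)
    refine Filter.Eventually.of_forall fun σ hσ => ?_
    have hw : 0 < σ ^ 2 - 1 := by nlinarith [hσ.1]
    rw [mul_comm Complex.I, norm_mul, Complex.norm_exp_ofReal_mul_I, one_mul, Complex.norm_real,
      Real.norm_eq_abs]
    have h1 : √A * √(σ ^ 2 - 1) ≤ √(A * σ ^ 2 - r ^ 2) := by
      rw [← Real.sqrt_mul hA.le]
      apply Real.sqrt_le_sqrt
      nlinarith
    have h2 : 0 < √A * √(σ ^ 2 - 1) := mul_pos hsA (Real.sqrt_pos.2 hw)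
    have h3 : 0 < √(A * σ ^ 2 - r ^ 2) := h2.trans_le h1
    rw [Real.sinc_of_ne_zero h3.ne', abs_div, abs_of_pos h3]
    calc _ ≤ 1 / √(A * σ ^ 2 - r ^ 2) := by gcongr; exact Real.abs_sin_le_one _
      _ ≤ 1 / (√A * √(σ ^ 2 - 1)) := one_div_le_one_div_of_le h2 h1
      _ = (√A)⁻¹ * (1 / √(σ ^ 2 - 1)) := by field_simp
      _ ≤ _ := by gcongr; exact inv_sqrt_le_deriv hσ.1
  refine hle.trans (le_of_eq ?_)
  rw [intervalIntegral.integral_const_mul, hval]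
  norm_num
  field_simp

theorem norm_integral_exp_sinc_le_of_small {A r x τ M : ℝ} (hA : A = r ^ 2 + x ^ 2) (hA0 : 0 < A)
    (hτ : 2 * √A ≤ τ) (hM : 1 ≤ M) :
    ‖∫ σ in (1 : ℝ)..M, Complex.exp (Complex.I * ((τ * σ : ℝ) : ℂ)) *
      ((Real.sinc √(A * σ ^ 2 - r ^ 2) : ℝ) : ℂ)‖
      ≤ 15 / (τ * √(max 1 |x|)) := by
  have hsA : 0 < √A := Real.sqrt_pos.2 hA0
  have hsq : √A ^ 2 = A := Real.sq_sqrt hA0.le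
  set T := τ / √A with hT
  set z₂ := √(A * M ^ 2 - r ^ 2) with hz₂
  have hxx : |x| ^ 2 = x ^ 2 := sq_abs x
  have hM2 : 1 ≤ M ^ 2 := by nlinarith
  have hQ : x ^ 2 ≤ A * M ^ 2 - r ^ 2 := by nlinarith
  have h12 : |x| ≤ z₂ := Real.abs_le_sqrt hQ
  have hz₂sq : z₂ ^ 2 = A * M ^ 2 - r ^ 2 := Real.sq_sqrt (by nlinarith [sq_nonneg x])
  have hf1 : √(|x| ^ 2 + r ^ 2) / √A = 1 := by
    rw [hxx, add_comm, ← hA, div_self hsA.ne']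
  have hf2 : √(z₂ ^ 2 + r ^ 2) / √A = M := by
    rw [hz₂sq, sub_add_cancel, Real.sqrt_mul hA0.le, Real.sqrt_sq (by linarith)]
    field_simp
  have hsub := intervalIntegral.integral_deriv_smul_comp_of_deriv_nonneg (a := |x|) (b := z₂)
    (f := fun z : ℝ => √(z ^ 2 + r ^ 2) / √A)
    (f' := fun z : ℝ => z / √(z ^ 2 + r ^ 2) / √A)
    (g := fun σ : ℝ => Complex.exp (Complex.I * ((τ * σ : ℝ) : ℂ)) *
      ((Real.sinc √(A * σ ^ 2 - r ^ 2) : ℝ) : ℂ))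
    (by fun_prop)
    (fun z hz => by
      rw [min_eq_left h12] at hz
      exact (hasDerivAt_sqrt_sq_add ((abs_nonneg x).trans_lt hz.1)).div_const _)
    (fun z hz => by
      rw [min_eq_left h12] at hz
      have := (abs_nonneg x).trans_lt hz.1
      positivity)
  rw [hf1, hf2] at hsub
  rw [← hsub]
  have e : ∀ z ∈ Set.uIcc |x| z₂, (z / √(z ^ 2 + r ^ 2) / √A) •
      ((fun σ : ℝ => Complex.exp (Complex.I * ((τ * σ : ℝ) : ℂ)) *
      ((Real.sinc √(A * σ ^ 2 - r ^ 2) : ℝ) : ℂ)) ∘ fun z : ℝ => √(z ^ 2 + r ^ 2) / √A) z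
      = (((√A)⁻¹ : ℝ) : ℂ) * (Complex.exp (Complex.I * ((T * √(z ^ 2 + r ^ 2) : ℝ) : ℂ))
        * ((Real.sinc z * (z / √(z ^ 2 + r ^ 2)) : ℝ) : ℂ)) := by
    intro z hz
    rw [Set.uIcc_of_le h12] at hz
    have hz0 : 0 ≤ z := (abs_nonneg x).trans hz.1
    have h1 : A * (√(z ^ 2 + r ^ 2) / √A) ^ 2 - r ^ 2 = z ^ 2 := by
      rw [div_pow, hsq, Real.sq_sqrt (by positivity)]
      field_simp
      ring
    have h2 : τ * (√(z ^ 2 + r ^ 2) / √A) = T * √(z ^ 2 + r ^ 2) := by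
      rw [hT]; ring
    simp only [Function.comp]
    rw [h1, h2, Real.sqrt_sq hz0, Complex.real_smul]
    push_cast
    ring
  rw [intervalIntegral.integral_congr e, intervalIntegral.integral_const_mul, norm_mul,
    Complex.norm_real, norm_inv, Real.norm_eq_abs, abs_of_pos hsA]
  have hb := norm_integral_exp_sinc_le (T := T) (r := r) (by rw [hT, le_div_iff₀ hsA]; exact hτ)
    (abs_nonneg x) h12
  calc _ ≤ (√A)⁻¹ * (15 / (T * √(max 1 |x|))) := by gcongr
    _ = _ := by
      rw [hT]
      field_simp

theorem norm_integral_exp_sinc_sound_le {r x τ M : ℝ} (hτ : 0 < τ) (hM : 1 ≤ M) :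
    ‖∫ σ in (1 : ℝ)..M, Complex.exp (Complex.I * ((τ * σ : ℝ) : ℂ)) *
      ((Real.sinc √((σ ^ 2 - 1) * r ^ 2 + (σ * x) ^ 2) : ℝ) : ℂ)‖
      ≤ 30 / τ * ((M ^ 2 - 1) ^ ((1 / 3) : ℝ) + (1 + |x|) ^ (-(1 / 3) : ℝ)) := by
  set A := r ^ 2 + x ^ 2 with hA
  have hA0 : 0 ≤ A := by positivity
  have hM1 : 0 ≤ (M ^ 2 - 1) ^ ((1 / 3) : ℝ) := Real.rpow_nonneg (by nlinarith) _
  have hx1 : 0 ≤ (1 + |x|) ^ (-(1 / 3) : ℝ) := by positivity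
  have hQ : ∀ σ : ℝ, (σ ^ 2 - 1) * r ^ 2 + (σ * x) ^ 2 = A * σ ^ 2 - r ^ 2 := fun σ => by
    rw [hA]; ring
  simp_rw [hQ]
  rcases hA0.eq_or_lt with h0 | h0
  · have hr : r = 0 := by nlinarith [sq_nonneg r, sq_nonneg x]
    have hx : x = 0 := by nlinarith [sq_nonneg r, sq_nonneg x]
    have hτC : (τ : ℂ) ≠ 0 := by exact_mod_cast hτ.ne'
    have hcongr : ∀ σ : ℝ, Complex.exp (Complex.I * ((τ * σ : ℝ) : ℂ)) *
      ((Real.sinc √(A * σ ^ 2 - r ^ 2) : ℝ) : ℂ) = Complex.exp (Complex.I * τ * σ) := fun σ => by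
      rw [← h0, hr]
      simp [mul_assoc]
    simp_rw [hcongr]
    rw [integral_exp_mul_complex (by simp [hτC]), norm_div]
    have hn : ∀ s : ℝ, ‖Complex.exp (Complex.I * τ * s)‖ = 1 := fun s => by
      have : Complex.I * τ * s = ((τ * s : ℝ) : ℂ) * Complex.I := by push_cast; ring
      rw [this]; exact Complex.norm_exp_ofReal_mul_I _
    have h2 : ‖Complex.I * (τ : ℂ)‖ = τ := by simp [abs_of_pos hτ]
    rw [h2]
    have h3 := norm_sub_le (Complex.exp (Complex.I * τ * M))
      (Complex.exp (Complex.I * τ * (1 : ℝ)))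
    rw [hn, hn] at h3
    rw [hx, abs_zero, add_zero, Real.one_rpow]
    rw [div_mul_eq_mul_div]
    gcongr
    linarith
  rcases le_total τ (2 * √A) with h1 | h1
  · refine (norm_integral_exp_sinc_le_of_large h0 (by nlinarith [sq_nonneg x]) hM).trans ?_
    have hsA : 0 < √A := Real.sqrt_pos.2 h0
    have h2 : (√A)⁻¹ ≤ 2 / τ := by
      rw [inv_le_comm₀ hsA (by positivity), inv_div]
      linarith
    calc _ = 3 / 2 * (M ^ 2 - 1) ^ ((1 / 3) : ℝ) * (√A)⁻¹ := by ring
      _ ≤ 3 / 2 * (M ^ 2 - 1) ^ ((1 / 3) : ℝ) * (2 / τ) := by gcongr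
      _ = 3 / τ * ((M ^ 2 - 1) ^ ((1 / 3) : ℝ) + 0) := by ring
      _ ≤ _ := by gcongr; norm_num
  · refine (norm_integral_exp_sinc_le_of_small hA h0 h1 hM).trans ?_
    calc _ = 15 / τ * (1 / √(max 1 |x|)) := by field_simp
      _ ≤ 15 / τ * (2 * (1 + |x|) ^ (-(1 / 3) : ℝ)) := by
        gcongr; exact inv_sqrt_max_le (abs_nonneg x)
      _ = 30 / τ * (0 + (1 + |x|) ^ (-(1 / 3) : ℝ)) := by ring
      _ ≤ _ := by gcongr

theorem norm_integral_sq_mul_le {f : ℝ → ℂ} (hf : Continuous f) {M B : ℝ} (hM : 1 ≤ M)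
    (hB : ∀ m ∈ Set.Icc 1 M, ‖∫ σ in (1 : ℝ)..m, f σ‖ ≤ B) :
    ‖∫ σ in (1 : ℝ)..M, ((σ ^ 2 : ℝ) : ℂ) * f σ‖ ≤ 2 * M ^ 2 * B := by
  have hip := intervalIntegral.integral_mul_deriv_eq_deriv_mul (a := 1) (b := M)
    (u := fun σ => ((σ ^ 2 : ℝ) : ℂ)) (u' := fun σ => ((2 * σ : ℝ) : ℂ))
    (v := fun s => ∫ σ in (1 : ℝ)..s, f σ) (v' := f)
    (fun σ _ => by simpa using (hasDerivAt_pow 2 σ).ofReal_comp)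
    (fun σ _ => intervalIntegral.integral_hasDerivAt_right (hf.intervalIntegrable _ _)
      (hf.stronglyMeasurableAtFilter _ _) hf.continuousAt)
    ((by fun_prop : Continuous fun σ : ℝ => ((2 * σ : ℝ) : ℂ)).intervalIntegrable _ _)
    (hf.intervalIntegrable _ _)
  have hB0 : 0 ≤ B := (norm_nonneg _).trans (hB 1 ⟨le_rfl, hM⟩)
  have h2 : ‖∫ σ in (1 : ℝ)..M, ((2 * σ : ℝ) : ℂ) * ∫ s in (1 : ℝ)..σ, f s‖
      ≤ ∫ σ in (1 : ℝ)..M, 2 * σ * B := by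
    refine intervalIntegral.norm_integral_le_of_norm_le hM ?_
      ((by fun_prop : Continuous fun σ : ℝ => 2 * σ * B).intervalIntegrable _ _)
    refine Filter.Eventually.of_forall fun σ hσ => ?_
    have : 0 ≤ 2 * σ := by linarith [hσ.1]
    rw [norm_mul, Complex.norm_real, Real.norm_eq_abs, abs_of_nonneg this]
    exact mul_le_mul_of_nonneg_left (hB σ ⟨hσ.1.le, hσ.2⟩) this
  have h3 : ∫ σ in (1 : ℝ)..M, 2 * σ * B = (M ^ 2 - 1) * B := by
    rw [intervalIntegral.integral_mul_const, intervalIntegral.integral_const_mul, integral_id]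
    ring
  rw [hip, intervalIntegral.integral_same, mul_zero, sub_zero]
  refine (norm_sub_le _ _).trans ?_
  rw [norm_mul, Complex.norm_real, Real.norm_eq_abs, abs_of_nonneg (sq_nonneg M)]
  have h4 := mul_le_mul_of_nonneg_left (hB M ⟨hM, le_rfl⟩) (sq_nonneg M)
  rw [h3] at h2
  linarith

/-- Prolate spheroidal coordinates with focal half-distance `c`, as a map to `Fin 3 → ℝ`. -/
def spheroidalPi (c : ℝ) (v : Fin 3 → ℝ) : Fin 3 → ℝ :=
  ![√(v 0 ^ 2 - c ^ 2) * √(1 - v 1 ^ 2) * Real.cos (v 2),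
    √(v 0 ^ 2 - c ^ 2) * √(1 - v 1 ^ 2) * Real.sin (v 2), v 0 * v 1]

/-- The coordinate domain of prolate spheroidal coordinates. -/
def spheroidalDomain (c : ℝ) : Set (Fin 3 → ℝ) :=
  {v | c < v 0 ∧ v 1 ∈ Set.Ioo (-1 : ℝ) 1 ∧ v 2 ∈ Set.Ioo (-Real.pi) Real.pi}

/-- The Jacobian matrix of `spheroidalPi`. -/
def spheroidalJacobian (c : ℝ) (v : Fin 3 → ℝ) : Matrix (Fin 3) (Fin 3) ℝ :=
  !![v 0 / √(v 0 ^ 2 - c ^ 2) * √(1 - v 1 ^ 2) * Real.cos (v 2),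
      -(√(v 0 ^ 2 - c ^ 2) * (v 1 / √(1 - v 1 ^ 2)) * Real.cos (v 2)),
      -(√(v 0 ^ 2 - c ^ 2) * √(1 - v 1 ^ 2) * Real.sin (v 2));
    v 0 / √(v 0 ^ 2 - c ^ 2) * √(1 - v 1 ^ 2) * Real.sin (v 2),
      -(√(v 0 ^ 2 - c ^ 2) * (v 1 / √(1 - v 1 ^ 2)) * Real.sin (v 2)),
      √(v 0 ^ 2 - c ^ 2) * √(1 - v 1 ^ 2) * Real.cos (v 2);
    v 1, v 0, 0]

theorem measurableSet_spheroidalDomain (c : ℝ) : MeasurableSet (spheroidalDomain c) := by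
  have h0 : MeasurableSet {v : Fin 3 → ℝ | c < v 0} :=
    measurableSet_lt measurable_const (measurable_pi_apply 0)
  have h1 : MeasurableSet {v : Fin 3 → ℝ | v 1 ∈ Set.Ioo (-1 : ℝ) 1} :=
    measurable_pi_apply 1 measurableSet_Ioo
  have h2 : MeasurableSet {v : Fin 3 → ℝ | v 2 ∈ Set.Ioo (-Real.pi) Real.pi} :=
    measurable_pi_apply 2 measurableSet_Ioo
  exact h0.inter (h1.inter h2)

section

variable {c : ℝ} {v : Fin 3 → ℝ}

theorem spheroidalDomain_pos (hc : 0 ≤ c) (hv : v ∈ spheroidalDomain c) :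
    0 < v 0 ^ 2 - c ^ 2 ∧ 0 < 1 - v 1 ^ 2 := by
  obtain ⟨h0, h1, -⟩ := hv
  exact ⟨by nlinarith, by nlinarith [h1.1, h1.2]⟩

theorem det_spheroidalJacobian (hc : 0 ≤ c) (hv : v ∈ spheroidalDomain c) :
    (spheroidalJacobian c v).det = -(v 0 ^ 2 - c ^ 2 * v 1 ^ 2) := by
  obtain ⟨hA, hB⟩ := spheroidalDomain_pos hc hv
  have hA' := Real.sqrt_pos.2 hA
  have hB' := Real.sqrt_pos.2 hB
  have eA := Real.sq_sqrt hA.le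
  have eB := Real.sq_sqrt hB.le
  have et := Real.sin_sq_add_cos_sq (v 2)
  rw [spheroidalJacobian, Matrix.det_fin_three]
  simp only [Matrix.of_apply, Matrix.cons_val', Matrix.cons_val_zero, Matrix.cons_val_one,
    Matrix.cons_val]
  set A := √(v 0 ^ 2 - c ^ 2)
  set B := √(1 - v 1 ^ 2)
  field_simp
  linear_combination (-v 1 ^ 2 * A ^ 2 - v 0 ^ 2 * B ^ 2) * et - v 1 ^ 2 * eA - v 0 ^ 2 * eB

theorem hasFDerivAt_spheroidalPi (hc : 0 ≤ c) (hv : v ∈ spheroidalDomain c) :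
    HasFDerivAt (spheroidalPi c)
      (Matrix.toLin' (spheroidalJacobian c v)).toContinuousLinearMap v := by
  obtain ⟨hA, hB⟩ := spheroidalDomain_pos hc hv
  have p : ∀ i : Fin 3, HasFDerivAt (fun w : Fin 3 → ℝ => w i)
      (ContinuousLinearMap.proj (R := ℝ) (φ := fun _ : Fin 3 => ℝ) i) v := fun i =>
    (ContinuousLinearMap.proj (R := ℝ) (φ := fun _ : Fin 3 => ℝ) i).hasFDerivAt
  have dA := (((p 0).pow 2).sub_const (c ^ 2)).sqrt hA.ne'
  have dB := ((((p 1).pow 2).const_sub 1)).sqrt hB.ne'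
  have dC := (Real.hasDerivAt_cos (v 2)).comp_hasFDerivAt v (p 2)
  have dS := (Real.hasDerivAt_sin (v 2)).comp_hasFDerivAt v (p 2)
  have hA' := (Real.sqrt_pos.2 hA).ne'
  have hB' := (Real.sqrt_pos.2 hB).ne'
  rw [hasFDerivAt_pi']
  intro i
  fin_cases i
  · refine ((dA.mul dB).mul dC).congr_fderiv ?_
    ext w
    simp [Matrix.toLin'_apply, spheroidalJacobian, dotProduct, Fin.sum_univ_three]
    field_simp
    ring
  · refine ((dA.mul dB).mul dS).congr_fderiv ?_
    ext w
    simp [Matrix.toLin'_apply, spheroidalJacobian, dotProduct, Fin.sum_univ_three]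
    field_simp
    ring
  · refine ((p 0).mul (p 1)).congr_fderiv ?_
    ext w
    simp [Matrix.toLin'_apply, spheroidalJacobian, dotProduct, Fin.sum_univ_three]
    ring

theorem injOn_spheroidalPi (hc : 0 ≤ c) : Set.InjOn (spheroidalPi c) (spheroidalDomain c) := by
  intro v hv w hw h
  obtain ⟨hA, hB⟩ := spheroidalDomain_pos hc hv
  obtain ⟨hA', hB'⟩ := spheroidalDomain_pos hc hw
  have h0 := congrFun h 0
  have h1 := congrFun h 1
  have h2 := congrFun h 2
  simp only [spheroidalPi, Matrix.cons_val_zero, Matrix.cons_val_one, Matrix.cons_val] at h0 h1 h2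
  have hv0 : 0 < v 0 := hc.trans_lt hv.1
  have hw0 : 0 < w 0 := hc.trans_lt hw.1
  have hsq : ∀ u : Fin 3 → ℝ, 0 < u 0 ^ 2 - c ^ 2 → 0 < 1 - u 1 ^ 2 →
      (√(u 0 ^ 2 - c ^ 2) * √(1 - u 1 ^ 2) * Real.cos (u 2)) ^ 2 +
      (√(u 0 ^ 2 - c ^ 2) * √(1 - u 1 ^ 2) * Real.sin (u 2)) ^ 2
      = (u 0 ^ 2 - c ^ 2) * (1 - u 1 ^ 2) := by
    intro u a b
    simp only [mul_pow, Real.sq_sqrt a.le, Real.sq_sqrt b.le]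
    linear_combination (u 0 ^ 2 - c ^ 2) * (1 - u 1 ^ 2) * Real.sin_sq_add_cos_sq (u 2)
  have hρ := hsq v hA hB
  rw [h0, h1, hsq w hA' hB'] at hρ
  have hzz : v 0 ^ 2 * v 1 ^ 2 = w 0 ^ 2 * w 1 ^ 2 := by rw [← mul_pow, ← mul_pow, h2]
  have hfac : (v 0 ^ 2 - w 0 ^ 2) * (v 0 ^ 2 - c ^ 2 * w 1 ^ 2) = 0 := by
    linear_combination (-v 0 ^ 2) * hρ + (v 0 ^ 2 - c ^ 2) * hzz
  have hne : v 0 ^ 2 - c ^ 2 * w 1 ^ 2 ≠ 0 := by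
    have : c ^ 2 * w 1 ^ 2 ≤ c ^ 2 := by nlinarith [sq_nonneg c]
    intro h'
    linarith
  have e0 : v 0 = w 0 := by
    have := (mul_eq_zero.1 hfac).resolve_right hne
    exact (sq_eq_sq₀ hv0.le hw0.le).1 (by linarith)
  have e1 : v 1 = w 1 := by
    rw [e0] at h2
    exact mul_left_cancel₀ hw0.ne' h2
  have hAB : √(w 0 ^ 2 - c ^ 2) * √(1 - w 1 ^ 2) ≠ 0 :=
    mul_ne_zero (Real.sqrt_pos.2 hA').ne' (Real.sqrt_pos.2 hB').ne'
  rw [e0, e1] at h0 h1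
  have hcos := mul_left_cancel₀ hAB h0
  have hsin := mul_left_cancel₀ hAB h1
  have e2 : v 2 = w 2 := by
    rw [← Complex.arg_cos_add_sin_mul_I (θ := v 2) ⟨hv.2.2.1, hv.2.2.2.le⟩,
      ← Complex.arg_cos_add_sin_mul_I (θ := w 2) ⟨hw.2.2.1, hw.2.2.2.le⟩,
      ← Complex.ofReal_cos, ← Complex.ofReal_sin, hcos, hsin, Complex.ofReal_cos,
      Complex.ofReal_sin]
  funext i
  fin_cases i
  exacts [e0, e1, e2]

theorem mem_image_spheroidalPi {q : Fin 3 → ℝ} (hq : q 1 ≠ 0) :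
    q ∈ spheroidalPi c '' spheroidalDomain c := by
  set ζ : ℂ := ⟨q 0, q 1⟩ with hζ
  set ρ : ℝ := ‖ζ‖ with hρ
  have hζ0 : ζ ≠ 0 := fun h => hq (by simpa [hζ] using congrArg Complex.im h)
  have hρ0 : 0 < ρ := norm_pos_iff.2 hζ0
  set z := q 2 with hz
  set s := ρ ^ 2 + z ^ 2 + c ^ 2 with hs
  have hD1 : s ^ 2 - 4 * c ^ 2 * z ^ 2 = (ρ ^ 2 + z ^ 2 - c ^ 2) ^ 2 + 4 * c ^ 2 * ρ ^ 2 := by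
    rw [hs]; ring
  have hD2 : s ^ 2 - 4 * c ^ 2 * z ^ 2 = (ρ ^ 2 + c ^ 2 - z ^ 2) ^ 2 + 4 * z ^ 2 * ρ ^ 2 := by
    rw [hs]; ring
  set R := √(s ^ 2 - 4 * c ^ 2 * z ^ 2) with hR
  have hR0 : 0 ≤ R := Real.sqrt_nonneg _
  have hR2 : R ^ 2 = s ^ 2 - 4 * c ^ 2 * z ^ 2 := Real.sq_sqrt (by rw [hD1]; positivity)
  set u := (s + R) / 2 with hu
  have hρ2 : 0 < ρ ^ 2 := by positivity
  have key : ∀ m b : ℝ, R ^ 2 = m ^ 2 + 4 * b ^ 2 * ρ ^ 2 → (b = 0 → 0 < m) → 0 < m + R := by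
    intro m b h1 h2
    by_contra! h3
    have h4 : R ^ 2 ≤ m ^ 2 := by nlinarith
    have h5 : b = 0 := by
      by_contra hb
      have : 0 < 4 * b ^ 2 * ρ ^ 2 := by positivity
      linarith
    linarith [h2 h5]
  have huc : c ^ 2 < u := by
    have := key (ρ ^ 2 + z ^ 2 - c ^ 2) c (hR2.trans hD1) (fun h => by
      rw [h]; nlinarith [sq_nonneg z])
    rw [hu, hs]; linarith
  have huz : z ^ 2 < u := by
    have := key (ρ ^ 2 + c ^ 2 - z ^ 2) z (hR2.trans hD2) (fun h => by
      rw [h]; nlinarith [sq_nonneg c])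
    rw [hu, hs]; linarith
  have hroot : u ^ 2 = s * u - c ^ 2 * z ^ 2 := by
    rw [hu]; linear_combination hR2 / 4
  have hu0 : 0 < u := (sq_nonneg c).trans_lt huc
  have hσ0 : 0 < √u := Real.sqrt_pos.2 hu0
  have hσ2 : √u ^ 2 = u := Real.sq_sqrt hu0.le
  have hω2 : (z / √u) ^ 2 = z ^ 2 / u := by rw [div_pow, hσ2]
  have hω1 : (z / √u) ^ 2 < 1 := by rw [hω2, div_lt_one hu0]; exact huz
  have hωabs : |z / √u| < 1 := by rwa [sq_lt_one_iff_abs_lt_one] at hω1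
  have hprod : √(√u ^ 2 - c ^ 2) * √(1 - (z / √u) ^ 2) = ρ := by
    rw [← Real.sqrt_mul (by rw [hσ2]; linarith), hω2, hσ2]
    have : (u - c ^ 2) * (1 - z ^ 2 / u) = ρ ^ 2 := by
      field_simp
      rw [hs] at hroot
      linear_combination hroot
    rw [this, Real.sqrt_sq hρ0.le]
  refine ⟨![√u, z / √u, Complex.arg ζ], ⟨?_, ?_, ?_⟩, ?_⟩
  · exact Real.lt_sqrt_of_sq_lt huc
  · exact abs_lt.1 hωabs
  · refine ⟨Complex.neg_pi_lt_arg ζ, lt_of_le_of_ne (Complex.arg_le_pi ζ) fun h => ?_⟩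
    exact hq (Complex.arg_eq_pi_iff.1 h).2
  · funext i
    fin_cases i
    · change √(√u ^ 2 - c ^ 2) * √(1 - (z / √u) ^ 2) * Real.cos (Complex.arg ζ) = q 0
      rw [hprod, hρ, Complex.norm_mul_cos_arg]
    · change √(√u ^ 2 - c ^ 2) * √(1 - (z / √u) ^ 2) * Real.sin (Complex.arg ζ) = q 1
      rw [hprod, hρ, Complex.norm_mul_sin_arg]
    · change √u * (z / √u) = q 2
      field_simp
      exact hz.symm

theorem integral_spheroidalPi (hc : 0 ≤ c) (g : (Fin 3 → ℝ) → ℂ) :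
    ∫ q, g q = ∫ v in spheroidalDomain c,
      ((v 0 ^ 2 - c ^ 2 * v 1 ^ 2 : ℝ) : ℂ) * g (spheroidalPi c v) := by
  have hnull : volume (spheroidalPi c '' spheroidalDomain c)ᶜ = 0 := by
    refine measure_mono_null (t := {q : Fin 3 → ℝ | q 1 = 0}) (fun q hq => ?_) ?_
    · by_contra h
      exact hq (mem_image_spheroidalPi h)
    · exact Measure.addHaar_submodule volume
        (LinearMap.ker (LinearMap.proj (R := ℝ) (φ := fun _ : Fin 3 => ℝ) 1))
        (fun h => by
          have : (fun _ => 1 : Fin 3 → ℝ) ∈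
            LinearMap.ker (LinearMap.proj (R := ℝ) (φ := fun _ : Fin 3 => ℝ) 1) := by
            rw [h]; trivial
          simp at this)
  have h := integral_image_eq_integral_abs_det_fderiv_smul (μ := volume)
    (measurableSet_spheroidalDomain c)
    (fun v hv => (hasFDerivAt_spheroidalPi hc hv).hasFDerivWithinAt) (injOn_spheroidalPi hc) g
  have hae : (spheroidalPi c '' spheroidalDomain c) =ᵐ[volume] Set.univ :=
    ae_eq_univ.2 hnull
  rw [setIntegral_congr_set hae, setIntegral_univ] at h
  rw [h]
  refine setIntegral_congr_fun (measurableSet_spheroidalDomain c) fun v hv => ?_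
  have hdet : (Matrix.toLin' (spheroidalJacobian c v)).toContinuousLinearMap.det
      = -(v 0 ^ 2 - c ^ 2 * v 1 ^ 2) := by
    rw [ContinuousLinearMap.det, LinearMap.coe_toContinuousLinearMap, LinearMap.det_toLin',
      det_spheroidalJacobian hc hv]
  obtain ⟨hA, hB⟩ := spheroidalDomain_pos hc hv
  have hpos : 0 ≤ v 0 ^ 2 - c ^ 2 * v 1 ^ 2 := by nlinarith [sq_nonneg c]
  rw [hdet, abs_neg, abs_of_nonneg hpos, Complex.real_smul]

/-- Prolate spheroidal coordinates with focal half-distance `c`. -/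
def spheroidal (c : ℝ) (v : Fin 3 → ℝ) : E3 := WithLp.toLp 2 (spheroidalPi c v)

theorem integral_spheroidal (hc : 0 ≤ c) (g : E3 → ℂ) :
    ∫ η, g η = ∫ v in spheroidalDomain c,
      ((v 0 ^ 2 - c ^ 2 * v 1 ^ 2 : ℝ) : ℂ) * g (spheroidal c v) := by
  have h := integral_spheroidalPi hc fun q => g (WithLp.toLp 2 q)
  rw [← (PiLp.volume_preserving_toLp (Fin 3)).integral_comp
    (MeasurableEquiv.toLp 2 (Fin 3 → ℝ)).measurableEmbedding g]
  exact h

end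

/-- The angular coordinate domain `(-1, 1) × (-π, π)`. -/
def angleBox : Set (Fin 2 → ℝ) :=
  {u | u 0 ∈ Set.Ioo (-1 : ℝ) 1 ∧ u 1 ∈ Set.Ioo (-Real.pi) Real.pi}

/-- Coordinate boxes with radial coordinate in `I`. -/
def shellBox (I : Set ℝ) : Set (Fin 3 → ℝ) :=
  {v | v 0 ∈ I ∧ v 1 ∈ Set.Ioo (-1 : ℝ) 1 ∧ v 2 ∈ Set.Ioo (-Real.pi) Real.pi}

theorem spheroidalDomain_eq_shellBox (c : ℝ) : spheroidalDomain c = shellBox (Set.Ioi c) := rfl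

theorem measurableSet_shellBox {I : Set ℝ} (hI : MeasurableSet I) : MeasurableSet (shellBox I) :=
  (measurable_pi_apply 0 hI).inter
    ((measurable_pi_apply 1 measurableSet_Ioo).inter (measurable_pi_apply 2 measurableSet_Ioo))

theorem preimage_finTwoArrow_eq_angleBox :
    (MeasurableEquiv.finTwoArrow (α := ℝ)) ⁻¹' (Set.Ioo (-1) 1 ×ˢ Set.Ioo (-Real.pi) Real.pi)
      = angleBox := rfl

theorem preimage_piFinSuccAbove_eq_shellBox (I : Set ℝ) :
    (MeasurableEquiv.piFinSuccAbove (fun _ : Fin 3 => ℝ) 0) ⁻¹' (I ×ˢ angleBox)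
      = shellBox I := rfl

theorem volume_angleBox_lt_top : volume angleBox < ⊤ := by
  rw [← preimage_finTwoArrow_eq_angleBox, (volume_preserving_finTwoArrow ℝ).measure_preimage_equiv,
    Measure.volume_eq_prod, Measure.prod_prod, Real.volume_Ioo, Real.volume_Ioo]
  exact ENNReal.mul_lt_top ENNReal.ofReal_lt_top ENNReal.ofReal_lt_top

theorem volume_shellBox_lt_top {I : Set ℝ} (hI : volume I < ⊤) : volume (shellBox I) < ⊤ := by
  rw [← preimage_piFinSuccAbove_eq_shellBox,
    (volume_preserving_piFinSuccAbove (fun _ : Fin 3 => ℝ) 0).measure_preimage_equiv,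
    Measure.volume_eq_prod, Measure.prod_prod]
  exact ENNReal.mul_lt_top hI volume_angleBox_lt_top

theorem setIntegral_shellBox {I : Set ℝ} {F : (Fin 3 → ℝ) → ℂ}
    (hF : IntegrableOn F (shellBox I)) :
    ∫ v in shellBox I, F v = ∫ σ in I, ∫ u in angleBox, F (Fin.cons σ u) := by
  set e := MeasurableEquiv.piFinSuccAbove (fun _ : Fin 3 => ℝ) 0 with he
  have hmp := volume_preserving_piFinSuccAbove (fun _ : Fin 3 => ℝ) 0
  have h1 := hmp.setIntegral_preimage_emb e.measurableEmbedding (fun p => F (e.symm p))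
    (I ×ˢ angleBox)
  have h3 : ∀ v, F (e.symm (e v)) = F v := fun v => by rw [e.symm_apply_apply]
  have h2 : IntegrableOn (fun p => F (e.symm p)) (I ×ˢ angleBox) (volume.prod volume) := by
    rw [← Measure.volume_eq_prod, ← hmp.integrableOn_comp_preimage e.measurableEmbedding]
    exact hF.congr_fun_ae (Filter.Eventually.of_forall fun v => (h3 v).symm)
  rw [preimage_piFinSuccAbove_eq_shellBox] at h1
  rw [Measure.volume_eq_prod, setIntegral_prod _ h2] at h1
  rw [show (fun v => F (e.symm ((MeasurableEquiv.piFinSuccAbove (fun _ : Fin 3 => ℝ) 0) v)))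
    = F from funext h3] at h1
  rw [h1]
  have h4 : ∀ (σ : ℝ) (u : Fin 2 → ℝ), e.symm (σ, u) = (Fin.cons σ u : Fin 3 → ℝ) :=
    fun σ u => e.symm_apply_eq.2 rfl
  simp only [h4]

/-- The Fourier transform of the surface measure of the unit sphere, in angular coordinates. -/
def sphereIntegral (Y : E3) : ℂ :=
  ∫ u in angleBox, Complex.exp (Complex.I *
    ((√(1 - u 0 ^ 2) * (Y 0 * Real.cos (u 1) + Y 1 * Real.sin (u 1)) + Y 2 * u 0 : ℝ) : ℂ))

theorem norm_exp_I_mul_ofReal (t : ℝ) : ‖Complex.exp (Complex.I * (t : ℂ))‖ = 1 := by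
  rw [mul_comm]; exact Complex.norm_exp_ofReal_mul_I t

theorem continuous_sphereIntegral : Continuous sphereIntegral := by
  have : IsFiniteMeasure (volume.restrict angleBox) := ⟨by simpa using volume_angleBox_lt_top⟩
  refine continuous_of_dominated (bound := fun _ => 1) (fun Y => ?_) (fun Y => ?_)
    (integrable_const _) ?_
  · exact (by fun_prop : Continuous fun u : Fin 2 → ℝ => Complex.exp (Complex.I *
      ((√(1 - u 0 ^ 2) * (Y 0 * Real.cos (u 1) + Y 1 * Real.sin (u 1)) + Y 2 * u 0 : ℝ) :
        ℂ))).aestronglyMeasurable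
  · exact Filter.Eventually.of_forall fun u => (norm_exp_I_mul_ofReal _).le
  · exact Filter.Eventually.of_forall fun u => by fun_prop

theorem sphereIntegral_smul_axis (t : ℝ) :
    sphereIntegral (t • EuclideanSpace.single 2 1) = 4 * Real.pi * Real.sinc t := by
  have h1 : sphereIntegral (t • EuclideanSpace.single 2 1)
      = ∫ u in angleBox, Complex.exp (Complex.I * ((t * u 0 : ℝ) : ℂ)) := by
    simp [sphereIntegral]
  have h2 := (volume_preserving_finTwoArrow ℝ).setIntegral_preimage_emb
    MeasurableEquiv.finTwoArrow.measurableEmbedding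
    (fun p => Complex.exp (Complex.I * ((t * p.1 : ℝ) : ℂ)))
    (Set.Ioo (-1) 1 ×ˢ Set.Ioo (-Real.pi) Real.pi)
  rw [preimage_finTwoArrow_eq_angleBox] at h2
  have h3 : ∫ u in angleBox, Complex.exp (Complex.I * ((t * u 0 : ℝ) : ℂ))
      = ∫ p in Set.Ioo (-1) 1 ×ˢ Set.Ioo (-Real.pi) Real.pi,
        Complex.exp (Complex.I * ((t * p.1 : ℝ) : ℂ)) * (1 : ℂ) := by
    simp only [mul_one]
    exact h2
  rw [h1, h3, Measure.volume_eq_prod,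
    setIntegral_prod_mul (fun ω : ℝ => Complex.exp (Complex.I * ((t * ω : ℝ) : ℂ)))
      (fun _ : ℝ => (1 : ℂ))]
  have h4 : ∫ _ in Set.Ioo (-Real.pi) Real.pi, (1 : ℂ) = 2 * Real.pi := by
    rw [setIntegral_const]
    simp [Measure.real, Real.volume_Ioo]
    rw [ENNReal.toReal_ofReal (by positivity)]
    push_cast; ring
  have h5 : ∫ ω in Set.Ioo (-1 : ℝ) 1, Complex.exp (Complex.I * ((t * ω : ℝ) : ℂ))
      = 2 * Real.sinc t := by
    rw [← integral_Ioc_eq_integral_Ioo, ← intervalIntegral.integral_of_le (by norm_num)]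
    rcases eq_or_ne t 0 with rfl | ht
    · simp; norm_num
    have htC : (t : ℂ) ≠ 0 := by exact_mod_cast ht
    have h6 := integral_exp_mul_I_eq_sinc t
    have h7 : ∫ ω in (-1 : ℝ)..1, Complex.exp (Complex.I * ((t * ω : ℝ) : ℂ))
        = ∫ ω in (-1 : ℝ)..1, (fun s : ℝ => Complex.exp (s * Complex.I)) (t * ω) := by
      refine intervalIntegral.integral_congr fun ω _ => ?_
      simp only
      rw [mul_comm]
    rw [h7, intervalIntegral.integral_comp_mul_left (fun s : ℝ => Complex.exp (s * Complex.I)) ht,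
      mul_neg, mul_one, h6, Complex.real_smul]
    push_cast
    field_simp
  rw [h4, h5]
  ring

theorem norm_spheroidal_sq {c : ℝ} {v : Fin 3 → ℝ} (hc : 0 ≤ c) (hv : v ∈ spheroidalDomain c) :
    ‖spheroidal c v‖ ^ 2 = v 0 ^ 2 - c ^ 2 + c ^ 2 * v 1 ^ 2 := by
  obtain ⟨hA, hB⟩ := spheroidalDomain_pos hc hv
  rw [EuclideanSpace.norm_sq_eq, Fin.sum_univ_three]
  simp only [spheroidal, spheroidalPi, Real.norm_eq_abs, sq_abs, Matrix.cons_val_zero,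
    Matrix.cons_val_one, Matrix.cons_val, mul_pow, Real.sq_sqrt hA.le, Real.sq_sqrt hB.le]
  linear_combination (v 0 ^ 2 - c ^ 2) * (1 - v 1 ^ 2) * Real.sin_sq_add_cos_sq (v 2)

theorem dot3_spheroidal (c : ℝ) (x : E3) (v : Fin 3 → ℝ) :
    dot3 x (spheroidal c v) = √(v 0 ^ 2 - c ^ 2) * (√(1 - v 1 ^ 2) *
      (x 0 * Real.cos (v 2) + x 1 * Real.sin (v 2))) + v 0 * x 2 * v 1 := by
  simp only [dot3, spheroidal, spheroidalPi, Matrix.cons_val_zero,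
    Matrix.cons_val_one, Matrix.cons_val]
  ring

theorem dot3_eq_inner (x y : E3) : dot3 x y = inner ℝ x y := by
  simp only [dot3, PiLp.inner_apply, Fin.sum_univ_three, RCLike.inner_apply, conj_trivial]
  ring

theorem integral_ball_exp_dot3 {T : ℝ} (Y : E3) :
    ∫ η : E3, (Metric.ball (0 : E3) T).indicator
        (fun η => Complex.exp (Complex.I * (dot3 Y η : ℂ))) η
      = ∫ σ in Set.Ioo 0 T, ((σ ^ 2 : ℝ) : ℂ) * sphereIntegral (σ • Y) := by
  rw [integral_spheroidal le_rfl, spheroidalDomain_eq_shellBox]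
  have hsub : shellBox (Set.Ioo 0 T) ⊆ shellBox (Set.Ioi 0) := fun v hv => ⟨hv.1.1, hv.2⟩
  have hcont : Continuous fun v : Fin 3 → ℝ => ((v 0 ^ 2 : ℝ) : ℂ) *
      Complex.exp (Complex.I * (dot3 Y (spheroidal 0 v) : ℂ)) := by
    simp only [dot3_spheroidal]
    fun_prop
  have h1 : ∫ v in shellBox (Set.Ioi 0), ((v 0 ^ 2 - 0 ^ 2 * v 1 ^ 2 : ℝ) : ℂ) *
      (Metric.ball (0 : E3) T).indicator
        (fun η => Complex.exp (Complex.I * (dot3 Y η : ℂ))) (spheroidal 0 v)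
      = ∫ v in shellBox (Set.Ioo 0 T), ((v 0 ^ 2 : ℝ) : ℂ) *
      Complex.exp (Complex.I * (dot3 Y (spheroidal 0 v) : ℂ)) := by
    rw [← integral_indicator (measurableSet_shellBox measurableSet_Ioi),
      ← integral_indicator (measurableSet_shellBox measurableSet_Ioo)]
    congr 1
    funext v
    by_cases hv : v ∈ shellBox (Set.Ioi 0)
    · have hn : ‖spheroidal 0 v‖ = v 0 := by
        have h0 : 0 < v 0 := hv.1
        have := norm_spheroidal_sq le_rfl (c := 0) hv
        refine (sq_eq_sq₀ (norm_nonneg _) h0.le).1 ?_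
        simpa using this
      rw [Set.indicator_of_mem hv]
      by_cases hT : v 0 < T
      · rw [Set.indicator_of_mem (show v ∈ shellBox (Set.Ioo 0 T) from ⟨⟨hv.1, hT⟩, hv.2⟩),
          Set.indicator_of_mem (by rw [mem_ball_zero_iff, hn]; exact hT)]
        norm_num
      · rw [Set.indicator_of_notMem (fun h : v ∈ shellBox (Set.Ioo 0 T) => hT h.1.2),
          Set.indicator_of_notMem (by rw [mem_ball_zero_iff, hn]; exact hT), mul_zero]
    · rw [Set.indicator_of_notMem hv, Set.indicator_of_notMem fun h => hv (hsub h)]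
  rw [h1, setIntegral_shellBox]
  · refine setIntegral_congr_fun measurableSet_Ioo fun σ hσ => ?_
    simp only [Fin.cons_zero, sphereIntegral]
    rw [integral_const_mul]
    congr 2
    funext u
    rw [dot3_spheroidal]
    congr 3
    have e0 : (Fin.cons σ u : Fin 3 → ℝ) 0 = σ := rfl
    have e1 : (Fin.cons σ u : Fin 3 → ℝ) 1 = u 0 := rfl
    have e2 : (Fin.cons σ u : Fin 3 → ℝ) 2 = u 1 := rfl
    rw [e0, e1, e2]
    simp only [PiLp.smul_apply, smul_eq_mul]
    norm_num
    rw [Real.sqrt_sq hσ.1.le]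
    ring
  · refine Measure.integrableOn_of_bounded (M := T ^ 2)
      (volume_shellBox_lt_top (by simp)).ne hcont.aestronglyMeasurable ?_
    refine (ae_restrict_iff' (measurableSet_shellBox measurableSet_Ioo)).2
      (Filter.Eventually.of_forall fun v hv => ?_)
    rw [norm_mul, norm_exp_I_mul_ofReal, mul_one, Complex.norm_real, Real.norm_eq_abs,
      abs_of_nonneg (sq_nonneg _)]
    exact pow_le_pow_left₀ hv.1.1.le hv.1.2.le 2

theorem sphereIntegral_eq (Y : E3) : sphereIntegral Y = 4 * Real.pi * Real.sinc ‖Y‖ := by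
  rw [← sphereIntegral_smul_axis]
  set Z : E3 := ‖Y‖ • EuclideanSpace.single 2 1 with hZ
  have hnorm : ‖Y‖ = ‖Z‖ := by rw [hZ, norm_smul]; simp
  obtain ⟨L, hL⟩ : ∃ L : E3 ≃ₗᵢ[ℝ] E3, L Y = Z :=
    ⟨_, Submodule.reflection_sub hnorm⟩
  have hball : ∀ T : ℝ, ∫ σ in Set.Ioo 0 T, ((σ ^ 2 : ℝ) : ℂ) * sphereIntegral (σ • Y)
      = ∫ σ in Set.Ioo 0 T, ((σ ^ 2 : ℝ) : ℂ) * sphereIntegral (σ • Z) := by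
    intro T
    rw [← integral_ball_exp_dot3, ← integral_ball_exp_dot3,
      ← L.measurePreserving.integral_comp L.toHomeomorph.measurableEmbedding
        (fun η => (Metric.ball (0 : E3) T).indicator
          (fun η => Complex.exp (Complex.I * (dot3 Z η : ℂ))) η)]
    congr 1
    funext η
    simp only [Set.indicator, mem_ball_zero_iff, L.norm_map]
    rw [← hL, dot3_eq_inner, dot3_eq_inner, L.inner_map_map]
  have hc : ∀ W : E3, Continuous fun σ : ℝ => ((σ ^ 2 : ℝ) : ℂ) * sphereIntegral (σ • W) :=
    fun W => Continuous.mul (by fun_prop) (continuous_sphereIntegral.comp (by fun_prop))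
  have hd : ∀ W : E3, HasDerivAt (fun T => ∫ σ in (0 : ℝ)..T, ((σ ^ 2 : ℝ) : ℂ) *
      sphereIntegral (σ • W)) (sphereIntegral W) 1 := fun W => by
    have := intervalIntegral.integral_hasDerivAt_right ((hc W).intervalIntegrable 0 1)
      ((hc W).stronglyMeasurableAtFilter _ _) (hc W).continuousAt
    simpa using this
  refine (hd Y).unique ((hd Z).congr_of_eventuallyEq ?_)
  filter_upwards [lt_mem_nhds (zero_lt_one (α := ℝ))] with T hT
  rw [intervalIntegral.integral_of_le hT.le, intervalIntegral.integral_of_le hT.le,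
    integral_Ioc_eq_integral_Ioo, integral_Ioc_eq_integral_Ioo, hball T]

theorem prod_inv_mul_eq (n : ℝ → ℝ) (y : Fin 3 → ℝ) :
    (∏ i, (1 + y i ^ 2)⁻¹) * n (y 2)
      = ∏ i, (fun (j : Fin 3) (s : ℝ) => (1 + s ^ 2)⁻¹ * (if j = 2 then n s else 1)) i (y i) := by
  simp [Fin.prod_univ_three]
  ring

theorem integrable_prod_inv_mul {n : ℝ → ℝ} (hn : Integrable fun s : ℝ => (1 + s ^ 2)⁻¹ * n s) :
    Integrable fun y : E3 => (∏ i, (1 + y i ^ 2)⁻¹) * n (y 2) := by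
  have h : Integrable fun y : Fin 3 → ℝ => (∏ i, (1 + y i ^ 2)⁻¹) * n (y 2) := by
    simp only [prod_inv_mul_eq]
    refine Integrable.fintype_prod (μ := fun _ => volume) (f := fun (j : Fin 3) (s : ℝ) =>
      (1 + s ^ 2)⁻¹ * (if j = 2 then n s else 1)) fun i => ?_
    by_cases hi : i = 2
    · simpa [hi] using hn
    · simpa [hi] using integrable_inv_one_add_sq
  exact (PiLp.volume_preserving_ofLp (Fin 3)).integrable_comp_of_integrable h

theorem integral_prod_inv_mul (n : ℝ → ℝ) :
    ∫ y : E3, (∏ i, (1 + y i ^ 2)⁻¹) * n (y 2) = Real.pi ^ 2 * ∫ s : ℝ, (1 + s ^ 2)⁻¹ * n s := by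
  have h := (PiLp.volume_preserving_ofLp (Fin 3)).integral_comp
    (MeasurableEquiv.toLp 2 (Fin 3 → ℝ)).symm.measurableEmbedding
    (fun y : Fin 3 → ℝ => (∏ i, (1 + y i ^ 2)⁻¹) * n (y 2))
  refine h.trans ?_
  simp only [prod_inv_mul_eq]
  rw [integral_fintype_prod_volume_eq_prod (E := fun _ : Fin 3 => ℝ)
    (fun (j : Fin 3) (s : ℝ) => (1 + s ^ 2)⁻¹ * (if j = 2 then n s else 1))]
  simp [Fin.prod_univ_three]
  exact Or.inl (by ring)

/-- A test function is a superposition of characters with a rapidly decaying amplitude. -/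
theorem exists_fourier_superposition {f : E3 → ℂ} (hf : HasCompactSupport f)
    (hf' : ContDiff ℝ (⊤ : ℕ∞) f) :
    ∃ g : E3 → ℂ, Continuous g ∧ (∃ C, 0 ≤ C ∧ ∀ y, ‖g y‖ ≤ C * ∏ i, (1 + y i ^ 2)⁻¹) ∧
      ∀ P, f P = ∫ y, Complex.exp (Complex.I * ((2 * Real.pi * dot3 y P : ℝ) : ℂ)) * g y := by
  set F : SchwartzMap E3 ℂ := hf.toSchwartzMap hf' with hF
  set G : SchwartzMap E3 ℂ := FourierTransform.fourier F with hG
  refine ⟨G, G.continuous, ?_, fun P => ?_⟩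
  · set S := 2 ^ 6 * (Finset.Iic ((6, 0) : ℕ × ℕ)).sup
      (fun m => SchwartzMap.seminorm ℝ m.1 m.2) G
    refine ⟨S, by positivity, fun y => ?_⟩
    have h1 : (1 + ‖y‖) ^ 6 * ‖G y‖ ≤ S := by
      simpa using SchwartzMap.one_add_le_sup_seminorm_apply (𝕜 := ℝ) (m := (6, 0)) (k := 6) (n := 0)
        le_rfl le_rfl G y
    have h2 : ∀ i, 1 + y i ^ 2 ≤ (1 + ‖y‖) ^ 2 := fun i => by
      have h3 : y i ^ 2 ≤ ‖y‖ ^ 2 := sq_le_sq' (by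
        have := PiLp.norm_apply_le y i
        rw [Real.norm_eq_abs] at this
        linarith [neg_abs_le (y i)]) (by
        have := PiLp.norm_apply_le y i
        rw [Real.norm_eq_abs] at this
        linarith [le_abs_self (y i)])
      nlinarith [norm_nonneg y]
    have h4 : ∏ i, (1 + y i ^ 2) ≤ (1 + ‖y‖) ^ 6 := by
      refine (Finset.prod_le_prod (fun i _ => by positivity) fun i _ => h2 i).trans_eq ?_
      simp
      ring
    have h5 : 0 < ∏ i, (1 + y i ^ 2) := Finset.prod_pos fun i _ => by positivity
    rw [Finset.prod_inv_distrib, ← div_eq_mul_inv, le_div_iff₀ h5, mul_comm]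
    exact (mul_le_mul_of_nonneg_right h4 (norm_nonneg _)).trans h1
  · have h1 : F = FourierTransformInv.fourierInv G := by
      rw [hG, FourierTransform.fourierInv_fourier_eq]
    have h2 : f P = F P := rfl
    rw [h2, h1, SchwartzMap.fourierInv_coe, Real.fourierInv_eq']
    congr 1
    funext y
    rw [dot3_eq_inner, smul_eq_mul, mul_comm Complex.I]

/-- Integrating a test function against an oscillating density is controlled by the modulated
integrals, averaged in the frequency shift. -/
theorem norm_integral_mul_superposition_le {α : Type*} [MeasurableSpace α] {ν : Measure α}
    [IsFiniteMeasure ν] {h : α → ℂ} {P : α → E3} {g : E3 → ℂ} {n : ℝ → ℝ} {B C : ℝ}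
    (hm : Measurable h) (hB : ∀ᵐ v ∂ν, ‖h v‖ ≤ B) (hP : Measurable P) (hg : Continuous g)
    (hC : ∀ y, ‖g y‖ ≤ C * ∏ i, (1 + y i ^ 2)⁻¹)
    (hn : Integrable fun s : ℝ => (1 + s ^ 2)⁻¹ * n s)
    (hle : ∀ y : E3,
      ‖∫ v, h v * Complex.exp (Complex.I * ((2 * Real.pi * dot3 y (P v) : ℝ) : ℂ)) ∂ν‖
      ≤ n (y 2)) :
    ‖∫ v, h v * (∫ y, Complex.exp (Complex.I * ((2 * Real.pi * dot3 y (P v) : ℝ) : ℂ)) * g y) ∂ν‖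
      ≤ C * (Real.pi ^ 2 * ∫ s : ℝ, (1 + s ^ 2)⁻¹ * n s) := by
  have hgi : Integrable g := by
    have h1 := (integrable_prod_inv_mul (n := fun _ => 1)
      (by simpa using integrable_inv_one_add_sq)).const_mul C
    refine h1.mono' hg.aestronglyMeasurable (Filter.Eventually.of_forall fun y => ?_)
    simpa using hC y
  have hhi : Integrable h ν := Integrable.of_bound hm.aestronglyMeasurable B hB
  have hdot : Measurable fun z : α × E3 => dot3 z.2 (P z.1) := by
    have h1 : Measurable fun z : α × E3 => P z.1 := hP.comp measurable_fst
    have h2 : ∀ i : Fin 3, Measurable fun z : α × E3 => z.2 i := fun i =>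
      (by fun_prop : Measurable fun y : E3 => y i).comp measurable_snd
    have h3 : ∀ i : Fin 3, Measurable fun z : α × E3 => P z.1 i := fun i =>
      (by fun_prop : Measurable fun y : E3 => y i).comp h1
    exact (((h2 0).mul (h3 0)).add ((h2 1).mul (h3 1))).add ((h2 2).mul (h3 2))
  have hInt : Integrable (Function.uncurry fun (v : α) (y : E3) =>
      Complex.exp (Complex.I * ((2 * Real.pi * dot3 y (P v) : ℝ) : ℂ)) * (h v * g y))
      (ν.prod volume) := by
    refine (hhi.mul_prod hgi).bdd_mul (c := 1) (Measurable.aestronglyMeasurable ?_)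
      (Filter.Eventually.of_forall fun z => (norm_exp_I_mul_ofReal _).le)
    exact Complex.measurable_exp.comp ((Complex.measurable_ofReal.comp
      (hdot.const_mul (2 * Real.pi))).const_mul Complex.I)
  have hswap : ∫ v, h v *
      (∫ y, Complex.exp (Complex.I * ((2 * Real.pi * dot3 y (P v) : ℝ) : ℂ)) * g y) ∂ν
      = ∫ y, (∫ v, h v * Complex.exp (Complex.I * ((2 * Real.pi * dot3 y (P v) : ℝ) : ℂ)) ∂ν)
        * g y := by
    rw [← integral_congr_ae (Filter.Eventually.of_forall fun v => integral_const_mul (h v) _)]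
    simp only [← integral_mul_const]
    rw [← integral_integral_swap (hInt.congr (Filter.Eventually.of_forall fun z => ?_))]
    · congr 1; funext v; congr 1; funext y; ring
    · simp only [Function.uncurry]; ring
  rw [hswap, ← integral_prod_inv_mul, ← integral_const_mul]
  refine norm_integral_le_of_norm_le ((integrable_prod_inv_mul hn).const_mul C)
    (Filter.Eventually.of_forall fun y => ?_)
  rw [norm_mul, mul_comm]
  calc ‖g y‖ * _ ≤ (C * ∏ i, (1 + y i ^ 2)⁻¹) * n (y 2) :=
        mul_le_mul (hC y) (hle y) (norm_nonneg _) ((norm_nonneg _).trans (hC y))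
    _ = _ := by ring

theorem d2_one_spheroidal {v : Fin 3 → ℝ} (hv : v ∈ spheroidalDomain 1) :
    d2 1 (spheroidal 1 v) = v 0 + v 1 := by
  obtain ⟨hA, hB⟩ := spheroidalDomain_pos zero_le_one hv
  have h0 : 0 ≤ v 0 + v 1 := by linarith [hv.1, hv.2.1.1]
  rw [d2, ← Real.sqrt_sq h0]
  congr 1
  simp only [spheroidal, spheroidalPi, Matrix.cons_val_zero,
    Matrix.cons_val_one, Matrix.cons_val, mul_pow, Real.sq_sqrt hA.le, Real.sq_sqrt hB.le]
  linear_combination (v 0 ^ 2 - 1 ^ 2) * (1 - v 1 ^ 2) * Real.sin_sq_add_cos_sq (v 2)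

theorem d1_one_spheroidal {v : Fin 3 → ℝ} (hv : v ∈ spheroidalDomain 1) :
    d1 1 (spheroidal 1 v) = v 0 - v 1 := by
  obtain ⟨hA, hB⟩ := spheroidalDomain_pos zero_le_one hv
  have h0 : 0 ≤ v 0 - v 1 := by linarith [hv.1, hv.2.1.2]
  rw [d1, ← Real.sqrt_sq h0]
  congr 1
  simp only [spheroidal, spheroidalPi, Matrix.cons_val_zero,
    Matrix.cons_val_one, Matrix.cons_val, mul_pow, Real.sq_sqrt hA.le, Real.sq_sqrt hB.le]
  linear_combination (v 0 ^ 2 - 1 ^ 2) * (1 - v 1 ^ 2) * Real.sin_sq_add_cos_sq (v 2)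

theorem Sig_one_spheroidal {v : Fin 3 → ℝ} (hv : v ∈ spheroidalDomain 1) :
    Sig 1 (spheroidal 1 v) = v 0 := by
  rw [Sig, d2_one_spheroidal hv, d1_one_spheroidal hv]; ring

theorem Om_one_spheroidal {v : Fin 3 → ℝ} (hv : v ∈ spheroidalDomain 1) :
    Om 1 (spheroidal 1 v) = v 1 := by
  rw [Om, d2_one_spheroidal hv, d1_one_spheroidal hv]; ring

theorem continuous_dot3_spheroidal (c : ℝ) (x : E3) :
    Continuous fun v : Fin 3 → ℝ => dot3 x (spheroidal c v) := by
  simp only [dot3_spheroidal]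
  fun_prop

/-- Integrating a plane wave over confocal spheroids, one spheroid at a time. -/
theorem setIntegral_shellBox_mul_exp {w : ℝ → ℂ} (hw : Continuous w) {m : ℝ} (hm : 1 ≤ m)
    (τ : ℝ) (x : E3) :
    ∫ v in shellBox (Set.Ioc 1 m), w (v 0) *
        Complex.exp (Complex.I * ((τ * v 1 + dot3 x (spheroidal 1 v) : ℝ) : ℂ))
      = 4 * Real.pi * ∫ σ in (1 : ℝ)..m, w σ * ((Real.sinc
        √((σ ^ 2 - 1) * √(x 0 ^ 2 + x 1 ^ 2) ^ 2 + (τ + σ * x 2) ^ 2) : ℝ) : ℂ) := by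
  have hcont : Continuous fun v : Fin 3 → ℝ => w (v 0) *
      Complex.exp (Complex.I * ((τ * v 1 + dot3 x (spheroidal 1 v) : ℝ) : ℂ)) := by
    have := continuous_dot3_spheroidal 1 x
    fun_prop
  rw [setIntegral_shellBox, intervalIntegral.integral_of_le hm, ← integral_const_mul]
  · refine setIntegral_congr_fun measurableSet_Ioc fun σ hσ => ?_
    have hp : 0 ≤ σ ^ 2 - 1 := by nlinarith [hσ.1]
    have hY := sphereIntegral_eq
      !₂[√(σ ^ 2 - 1) * x 0, √(σ ^ 2 - 1) * x 1, τ + σ * x 2]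
    rw [EuclideanSpace.norm_eq, Fin.sum_univ_three] at hY
    simp only [Real.norm_eq_abs, sq_abs, Matrix.cons_val_zero,
      Matrix.cons_val_one, Matrix.cons_val, mul_pow, Real.sq_sqrt hp] at hY
    have hr : √((σ ^ 2 - 1) * √(x 0 ^ 2 + x 1 ^ 2) ^ 2 + (τ + σ * x 2) ^ 2)
        = √((σ ^ 2 - 1) * x 0 ^ 2 + (σ ^ 2 - 1) * x 1 ^ 2 + (τ + σ * x 2) ^ 2) := by
      rw [Real.sq_sqrt (by positivity)]; congr 1; ring
    beta_reduce
    rw [hr, mul_left_comm, ← hY, sphereIntegral, ← integral_const_mul]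
    congr 1
    funext u
    rw [dot3_spheroidal]
    have e0 : (Fin.cons σ u : Fin 3 → ℝ) 0 = σ := rfl
    have e1 : (Fin.cons σ u : Fin 3 → ℝ) 1 = u 0 := rfl
    have e2 : (Fin.cons σ u : Fin 3 → ℝ) 2 = u 1 := rfl
    rw [e0, e1, e2]
    congr 4
    simp only [Matrix.cons_val_zero, Matrix.cons_val_one, Matrix.cons_val, one_pow]
    ring
  · obtain ⟨B, hB⟩ := (isCompact_Icc (a := 1) (b := m)).exists_bound_of_continuousOn hw.continuousOn
    refine Measure.integrableOn_of_bounded (M := B)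
      (volume_shellBox_lt_top (by simp)).ne hcont.aestronglyMeasurable ?_
    refine (ae_restrict_iff' (measurableSet_shellBox measurableSet_Ioc)).2
      (Filter.Eventually.of_forall fun v hv => ?_)
    rw [norm_mul, norm_exp_I_mul_ofReal, mul_one]
    exact hB _ ⟨hv.1.1.le, hv.1.2⟩

/-- A uniform bound for the plain and the `σ²`-weighted oscillatory integral with phase `q` over
the spheroidal shell `1 < σ ≤ M`, for all linear modulations. -/
def ShellBound (q : (Fin 3 → ℝ) → ℝ) (M : ℝ) (n : ℝ → ℝ) : Prop :=
  ∀ x : E3,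
    ‖∫ v in shellBox (Set.Ioc 1 M),
      Complex.exp (Complex.I * ((q v + dot3 x (spheroidal 1 v) : ℝ) : ℂ))‖ ≤ n (x 2) ∧
    ‖∫ v in shellBox (Set.Ioc 1 M), ((v 0 ^ 2 : ℝ) : ℂ) *
      Complex.exp (Complex.I * ((q v + dot3 x (spheroidal 1 v) : ℝ) : ℂ))‖ ≤ 2 * M ^ 2 * n (x 2)

theorem norm_four_pi_mul_le {z : ℂ} {B : ℝ} (h : ‖z‖ ≤ B) :
    ‖4 * (Real.pi : ℂ) * z‖ ≤ 4 * Real.pi * B := by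
  rw [norm_mul, norm_mul, Complex.norm_real, Real.norm_eq_abs, abs_of_pos Real.pi_pos]
  norm_num
  gcongr

theorem shellBound_inertial {τ M : ℝ} (hτ : 0 < τ) (hM : 1 ≤ M) :
    ShellBound (fun v => τ * v 1) M fun _ => 4 * Real.pi * (16 * M / τ) := by
  intro x
  set f : ℝ → ℂ := fun σ => ((Real.sinc
    √((σ ^ 2 - 1) * √(x 0 ^ 2 + x 1 ^ 2) ^ 2 + (τ + σ * x 2) ^ 2) : ℝ) : ℂ) with hf
  have hfc : Continuous f := by
    have := Real.continuous_sinc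
    fun_prop
  have hb : ∀ m ∈ Set.Icc 1 M, ‖∫ σ in (1 : ℝ)..m, f σ‖ ≤ 16 * M / τ := fun m hm => by
    rw [hf, intervalIntegral.integral_ofReal, Complex.norm_real, Real.norm_eq_abs]
    refine (abs_integral_sinc_inertial_le hτ hm.1).trans ?_
    gcongr
    exact hm.2
  constructor
  · have h := setIntegral_shellBox_mul_exp (w := fun _ => 1) continuous_const hM τ x
    simp only [one_mul] at h
    rw [h]
    exact norm_four_pi_mul_le (hb M ⟨hM, le_rfl⟩)
  · have h := setIntegral_shellBox_mul_exp (w := fun σ => ((σ ^ 2 : ℝ) : ℂ)) (by fun_prop) hM τ x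
    rw [h]
    exact (norm_four_pi_mul_le (norm_integral_sq_mul_le hfc hM hb)).trans_eq (by ring)

theorem shellBound_sound {τ M : ℝ} (hτ : 0 < τ) (hM : 1 ≤ M) :
    ShellBound (fun v => τ * v 0) M fun s => 4 * Real.pi *
      (30 / τ * ((M ^ 2 - 1) ^ ((1 / 3) : ℝ) + (1 + |s|) ^ (-(1 / 3) : ℝ))) := by
  intro x
  set f : ℝ → ℂ := fun σ => Complex.exp (Complex.I * ((τ * σ : ℝ) : ℂ)) * ((Real.sinc
    √((σ ^ 2 - 1) * √(x 0 ^ 2 + x 1 ^ 2) ^ 2 + (σ * x 2) ^ 2) : ℝ) : ℂ) with hf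
  have hfc : Continuous f := by
    have := Real.continuous_sinc
    fun_prop
  have hb : ∀ m ∈ Set.Icc 1 M, ‖∫ σ in (1 : ℝ)..m, f σ‖
      ≤ 30 / τ * ((M ^ 2 - 1) ^ ((1 / 3) : ℝ) + (1 + |x 2|) ^ (-(1 / 3) : ℝ)) := fun m hm => by
    refine (norm_integral_exp_sinc_sound_le hτ hm.1).trans ?_
    have h1 : 0 ≤ m ^ 2 - 1 := by nlinarith [hm.1]
    have h2 : m ^ 2 ≤ M ^ 2 := pow_le_pow_left₀ (by linarith [hm.1]) hm.2 2
    gcongr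
  have hexp : ∀ v : Fin 3 → ℝ, Complex.exp (Complex.I *
      ((τ * v 0 + dot3 x (spheroidal 1 v) : ℝ) : ℂ))
      = Complex.exp (Complex.I * ((τ * v 0 : ℝ) : ℂ)) * Complex.exp (Complex.I *
        ((0 * v 1 + dot3 x (spheroidal 1 v) : ℝ) : ℂ)) := fun v => by
    rw [← Complex.exp_add]; congr 1; push_cast; ring
  simp only [hexp]
  constructor
  · have h := setIntegral_shellBox_mul_exp
      (w := fun σ => Complex.exp (Complex.I * ((τ * σ : ℝ) : ℂ))) (by fun_prop) hM 0 x
    simp only [zero_add] at h ⊢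
    rw [h]
    exact norm_four_pi_mul_le (hb M ⟨hM, le_rfl⟩)
  · have h := setIntegral_shellBox_mul_exp
      (w := fun σ => ((σ ^ 2 : ℝ) : ℂ) * Complex.exp (Complex.I * ((τ * σ : ℝ) : ℂ)))
      (by fun_prop) hM 0 x
    simp only [zero_add, mul_assoc (((_ : ℝ) : ℂ))] at h ⊢
    rw [h]
    exact (norm_four_pi_mul_le (norm_integral_sq_mul_le hfc hM hb)).trans_eq (by ring)

section

variable {ψ : ℝ → ℝ}

theorem lpBump_eq_zero_of_le_one (hψ : IsCutoff ψ) {y : ℝ} (hy : |y| ≤ 1) : lpBump ψ y = 0 := by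
  rw [lpBump, hψ.2.2.2 y hy, hψ.2.2.2 (y / 2), sub_self]
  rw [abs_div, abs_two]
  linarith [abs_nonneg y]

theorem lpBump_eq_zero_of_four_lt (hψ : IsCutoff ψ) {y : ℝ} (hy : 4 < |y|) : lpBump ψ y = 0 := by
  rw [lpBump, hψ.2.2.1 y (by linarith), hψ.2.2.1 (y / 2), sub_self]
  rw [abs_div, abs_two]
  linarith

theorem contDiff_lpBump_norm (hψ : IsCutoff ψ) :
    ContDiff ℝ (⊤ : ℕ∞) fun P : E3 => ((lpBump ψ ‖P‖ : ℝ) : ℂ) := by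
  refine Complex.ofRealCLM.contDiff.comp (contDiff_iff_contDiffAt.2 fun P => ?_)
  by_cases hP : P = 0
  · have h : (fun P : E3 => lpBump ψ ‖P‖) =ᶠ[nhds P] fun _ => 0 := by
      filter_upwards [Metric.ball_mem_nhds P one_pos] with Q hQ
      rw [hP, mem_ball_zero_iff] at hQ
      exact lpBump_eq_zero_of_le_one hψ (by rw [abs_norm]; exact hQ.le)
    exact contDiffAt_const.congr_of_eventuallyEq h
  · have h : ContDiff ℝ (⊤ : ℕ∞) (lpBump ψ) := by
      have := hψ.1
      unfold lpBump
      fun_prop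
    exact h.contDiffAt.comp P (contDiffAt_norm ℝ hP)

theorem hasCompactSupport_lpBump_norm (hψ : IsCutoff ψ) :
    HasCompactSupport fun P : E3 => ((lpBump ψ ‖P‖ : ℝ) : ℂ) := by
  refine HasCompactSupport.of_support_subset_isCompact (isCompact_closedBall (0 : E3) 4) ?_
  intro P hP
  rw [mem_closedBall_zero_iff]
  by_contra! h
  exact hP (Complex.ofReal_eq_zero.2 (lpBump_eq_zero_of_four_lt hψ (by rwa [abs_norm])))

end

theorem ShellBound.nonneg {q : (Fin 3 → ℝ) → ℝ} {M : ℝ} {n : ℝ → ℝ} (h : ShellBound q M n)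
    (s : ℝ) : 0 ≤ n s := by
  have := (norm_nonneg _).trans (h !₂[0, 0, s]).1
  simpa using this

theorem dot3_add_smul (x y z : E3) (b : ℝ) :
    dot3 (x + (2 * Real.pi * b) • y) z = dot3 x z + 2 * Real.pi * dot3 y (b • z) := by
  simp only [dot3, PiLp.add_apply, PiLp.smul_apply, smul_eq_mul]
  ring

/-- Oscillatory integrals over a spheroidal shell against a dilated test function. -/
theorem ShellBound.exists_const {f : E3 → ℂ} (hf : HasCompactSupport f)
    (hf' : ContDiff ℝ (⊤ : ℕ∞) f) :
    ∃ C, 0 ≤ C ∧ ∀ {q : (Fin 3 → ℝ) → ℝ} {M : ℝ} {n : ℝ → ℝ} {b : ℝ} {x : E3},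
      ShellBound q M n → Continuous q →
      Integrable (fun s : ℝ => (1 + s ^ 2)⁻¹ * n (x 2 + 2 * Real.pi * b * s)) →
      ‖∫ v in shellBox (Set.Ioc 1 M),
        Complex.exp (Complex.I * ((q v + dot3 x (spheroidal 1 v) : ℝ) : ℂ)) *
          f (b • spheroidal 1 v)‖
        ≤ C * ∫ s : ℝ, (1 + s ^ 2)⁻¹ * n (x 2 + 2 * Real.pi * b * s) ∧
      ‖∫ v in shellBox (Set.Ioc 1 M), ((v 0 ^ 2 : ℝ) : ℂ) *
        Complex.exp (Complex.I * ((q v + dot3 x (spheroidal 1 v) : ℝ) : ℂ)) *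
          f (b • spheroidal 1 v)‖
        ≤ C * (2 * M ^ 2 * ∫ s : ℝ, (1 + s ^ 2)⁻¹ * n (x 2 + 2 * Real.pi * b * s)) := by
  obtain ⟨g, hg, ⟨C, hC0, hC⟩, hfg⟩ := exists_fourier_superposition hf hf'
  refine ⟨C * Real.pi ^ 2, by positivity, fun {q M n b x} hS hq hn => ?_⟩
  have : IsFiniteMeasure (volume.restrict (shellBox (Set.Ioc 1 M))) :=
    ⟨by simpa using volume_shellBox_lt_top (I := Set.Ioc 1 M) (by simp)⟩
  have hsc := continuous_dot3_spheroidal 1 x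
  have hP : Measurable fun v : Fin 3 → ℝ => b • spheroidal 1 v := by
    have h1 : Continuous fun v : Fin 3 → ℝ => spheroidal 1 v := by
      unfold spheroidal spheroidalPi
      fun_prop
    exact (h1.const_smul b).measurable
  have hshift : ∀ (y : E3) (v : Fin 3 → ℝ),
      Complex.exp (Complex.I * ((q v + dot3 x (spheroidal 1 v) : ℝ) : ℂ)) *
        Complex.exp (Complex.I * ((2 * Real.pi * dot3 y (b • spheroidal 1 v) : ℝ) : ℂ))
      = Complex.exp (Complex.I *
        ((q v + dot3 (x + (2 * Real.pi * b) • y) (spheroidal 1 v) : ℝ) : ℂ)) := fun y v => by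
    rw [← Complex.exp_add, dot3_add_smul]
    congr 1
    push_cast
    ring
  have hx : ∀ y : E3, (x + (2 * Real.pi * b) • y) 2 = x 2 + 2 * Real.pi * b * y 2 := fun y => rfl
  have hInt : ∀ c, ∫ s : ℝ, (1 + s ^ 2)⁻¹ * (c * n (x 2 + 2 * Real.pi * b * s))
      = c * ∫ s : ℝ, (1 + s ^ 2)⁻¹ * n (x 2 + 2 * Real.pi * b * s) := fun c => by
    rw [← integral_const_mul]
    congr 1
    funext s
    ring
  simp only [hfg]
  constructor
  · refine (norm_integral_mul_superposition_le (B := 1)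
      (n := fun s => n (x 2 + 2 * Real.pi * b * s))
      (Continuous.measurable (by fun_prop)) (Filter.Eventually.of_forall fun v =>
      (norm_exp_I_mul_ofReal _).le) hP hg hC hn fun y => ?_).trans_eq (by ring)
    simp only [hshift, ← hx]
    exact (hS _).1
  · refine (norm_integral_mul_superposition_le (B := M ^ 2)
      (n := fun s => 2 * M ^ 2 * n (x 2 + 2 * Real.pi * b * s))
      (Continuous.measurable (by fun_prop)) ?_ hP hg hC ?_ fun y => ?_).trans_eq ?_
    · refine (ae_restrict_iff' (measurableSet_shellBox measurableSet_Ioc)).2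
        (Filter.Eventually.of_forall fun v hv => ?_)
      rw [norm_mul, norm_exp_I_mul_ofReal, mul_one, Complex.norm_real, Real.norm_eq_abs,
        abs_of_nonneg (sq_nonneg _)]
      exact pow_le_pow_left₀ (by linarith [hv.1.1]) hv.1.2 2
    · exact (hn.const_mul (2 * M ^ 2)).congr (Filter.Eventually.of_forall fun s => by ring)
    · simp only [mul_assoc (((_ : ℝ) : ℂ)), hshift, ← hx]
      exact (hS _).2
    · rw [hInt]; ring

/-- The frequency-localized oscillatory integral in spheroidal coordinates. -/
theorem integral_exp_mul_lpBump_eq {ψ : ℝ → ℝ} (hψ : IsCutoff ψ) {θ : E3 → ℝ}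
    {q : (Fin 3 → ℝ) → ℝ} (hθ : ∀ v ∈ spheroidalDomain 1, θ (spheroidal 1 v) = q v) {a : ℝ}
    (ha : 0 < a) (x : E3) :
    ∫ η : E3, Complex.exp (Complex.I * ((θ η + dot3 x η : ℝ) : ℂ)) *
        ((lpBump ψ (a⁻¹ * ‖η‖) : ℝ) : ℂ)
      = ∫ v in shellBox (Set.Ioc 1 √(1 + 16 * a ^ 2)), ((v 0 ^ 2 - v 1 ^ 2 : ℝ) : ℂ) *
        (Complex.exp (Complex.I * ((q v + dot3 x (spheroidal 1 v) : ℝ) : ℂ)) *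
          ((lpBump ψ ‖a⁻¹ • spheroidal 1 v‖ : ℝ) : ℂ)) := by
  rw [integral_spheroidal zero_le_one, ← integral_indicator (measurableSet_spheroidalDomain 1),
      ← integral_indicator (measurableSet_shellBox measurableSet_Ioc)]
  congr 1
  funext v
  have hnorm : ‖a⁻¹ • spheroidal 1 v‖ = a⁻¹ * ‖spheroidal 1 v‖ := by
    rw [norm_smul, Real.norm_eq_abs, abs_of_pos (inv_pos.2 ha)]
  by_cases hv : v ∈ spheroidalDomain 1
  · rw [Set.indicator_of_mem hv]
    by_cases hM : v 0 ≤ √(1 + 16 * a ^ 2)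
    · rw [Set.indicator_of_mem (show v ∈ shellBox (Set.Ioc 1 √(1 + 16 * a ^ 2)) from
        ⟨⟨hv.1, hM⟩, hv.2⟩), hθ v hv, hnorm]
      simp
    · rw [Set.indicator_of_notMem (fun h : v ∈ shellBox (Set.Ioc 1 √(1 + 16 * a ^ 2)) => hM h.1.2),
        lpBump_eq_zero_of_four_lt hψ, Complex.ofReal_zero, mul_zero, mul_zero]
      have h0 : 1 < v 0 := hv.1
      have h1 := (Real.sqrt_lt' (by linarith)).1 (not_le.1 hM)
      have h2 := norm_spheroidal_sq zero_le_one hv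
      have h3 : 4 * a < ‖spheroidal 1 v‖ := by
        refine lt_of_pow_lt_pow_left₀ 2 (norm_nonneg _) ?_
        nlinarith [sq_nonneg (v 1)]
      rw [abs_of_nonneg (by positivity), inv_mul_eq_div, lt_div_iff₀ ha]
      exact h3
  · rw [Set.indicator_of_notMem hv,
      Set.indicator_of_notMem fun h : v ∈ shellBox (Set.Ioc 1 √(1 + 16 * a ^ 2)) => hv ⟨h.1.1, h.2⟩]

theorem integral_two_mul_sub_sub_const_mul {α : Type*} [MeasurableSpace α] {μ : Measure α}
    {A B D : α → ℂ} (hA : Integrable A μ) (hB : Integrable B μ) (hD : Integrable D μ) (c : ℂ) :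
    ∫ v, (2 * A v - B v - c * D v) ∂μ
      = 2 * (∫ v, A v ∂μ) - (∫ v, B v ∂μ) - c * ∫ v, D v ∂μ := by
  have hAB : Integrable (fun v => 2 * A v - B v) μ := (hA.const_mul 2).sub hB
  rw [integral_sub hAB (hD.const_mul c), integral_sub (hA.const_mul 2) hB, integral_const_mul,
    integral_const_mul]

theorem exists_norm_integral_exp_mul_lpBump_le {ψ : ℝ → ℝ} (hψ : IsCutoff ψ) :
    ∃ C, 0 ≤ C ∧ ∀ {θ : E3 → ℝ} {q : (Fin 3 → ℝ) → ℝ} {n : ℝ → ℝ} {a : ℝ} {x : E3}, 0 < a →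
      Continuous q → (∀ v ∈ spheroidalDomain 1, θ (spheroidal 1 v) = q v) →
      ShellBound q √(1 + 16 * a ^ 2) n →
      Integrable (fun s : ℝ => (1 + s ^ 2)⁻¹ * n (x 2 + 2 * Real.pi * a⁻¹ * s)) →
      ‖∫ η : E3, Complex.exp (Complex.I * ((θ η + dot3 x η : ℝ) : ℂ)) *
        ((lpBump ψ (a⁻¹ * ‖η‖) : ℝ) : ℂ)‖
        ≤ C * (1 + a ^ 2) * ∫ s : ℝ, (1 + s ^ 2)⁻¹ * n (x 2 + 2 * Real.pi * a⁻¹ * s) := by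
  have hf1 := contDiff_lpBump_norm hψ
  have hs1 := hasCompactSupport_lpBump_norm hψ
  have hf2 : ContDiff ℝ (⊤ : ℕ∞)
      fun P : E3 => ((‖P‖ ^ 2 : ℝ) : ℂ) * ((lpBump ψ ‖P‖ : ℝ) : ℂ) :=
    (Complex.ofRealCLM.contDiff.comp (contDiff_norm_sq ℝ)).mul hf1
  have hs2 : HasCompactSupport
      fun P : E3 => ((‖P‖ ^ 2 : ℝ) : ℂ) * ((lpBump ψ ‖P‖ : ℝ) : ℂ) := hs1.mul_left
  obtain ⟨C1, hC1, h1⟩ := ShellBound.exists_const hs1 hf1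
  obtain ⟨C2, hC2, h2⟩ := ShellBound.exists_const hs2 hf2
  refine ⟨80 * C1 + C2, by positivity, fun {θ q n a x} ha hq hθ hS hn => ?_⟩
  rw [integral_exp_mul_lpBump_eq hψ hθ ha]
  set M := √(1 + 16 * a ^ 2) with hM
  have hM2 : M ^ 2 = 1 + 16 * a ^ 2 := Real.sq_sqrt (by positivity)
  obtain ⟨hT1, hT2⟩ := h1 hS hq hn
  obtain ⟨hT3, -⟩ := h2 hS hq hn
  set J := ∫ s : ℝ, (1 + s ^ 2)⁻¹ * n (x 2 + 2 * Real.pi * a⁻¹ * s)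
  have hJ : 0 ≤ J := integral_nonneg fun s => mul_nonneg (by positivity) (hS.nonneg _)
  have : IsFiniteMeasure (volume.restrict (shellBox (Set.Ioc 1 M))) :=
    ⟨by simpa using volume_shellBox_lt_top (I := Set.Ioc 1 M) (by simp)⟩
  have hcs : Continuous fun v : Fin 3 → ℝ => a⁻¹ • spheroidal 1 v := by
    unfold spheroidal spheroidalPi
    fun_prop
  have hce : Continuous fun v : Fin 3 → ℝ =>
      Complex.exp (Complex.I * ((q v + dot3 x (spheroidal 1 v) : ℝ) : ℂ)) := by
    have := continuous_dot3_spheroidal 1 x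
    fun_prop
  have hbd : ∀ {f : E3 → ℂ} (hc : Continuous f) (hs : HasCompactSupport f),
      Integrable (fun v : Fin 3 → ℝ =>
        Complex.exp (Complex.I * ((q v + dot3 x (spheroidal 1 v) : ℝ) : ℂ)) *
          f (a⁻¹ • spheroidal 1 v)) (volume.restrict (shellBox (Set.Ioc 1 M))) := by
    intro f hc hs
    obtain ⟨B, hB⟩ := hs.exists_bound_of_continuous hc
    refine Integrable.of_bound (hce.mul (hc.comp hcs)).aestronglyMeasurable B
      (Filter.Eventually.of_forall fun v => ?_)
    rw [norm_mul, norm_exp_I_mul_ofReal, one_mul]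
    exact hB _
  have hi1 := hbd hf1.continuous hs1
  have hi2 := hbd hf2.continuous hs2
  have hi3 : Integrable (fun v : Fin 3 → ℝ => ((v 0 ^ 2 : ℝ) : ℂ) *
      Complex.exp (Complex.I * ((q v + dot3 x (spheroidal 1 v) : ℝ) : ℂ)) *
          ((lpBump ψ ‖a⁻¹ • spheroidal 1 v‖ : ℝ) : ℂ))
      (volume.restrict (shellBox (Set.Ioc 1 M))) := by
    simp only [mul_assoc]
    refine hi1.bdd_mul (c := M ^ 2)
      (by fun_prop : Continuous fun v : Fin 3 → ℝ => ((v 0 ^ 2 : ℝ) : ℂ)).aestronglyMeasurable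
      ((ae_restrict_iff' (measurableSet_shellBox measurableSet_Ioc)).2
        (Filter.Eventually.of_forall fun v hv => ?_))
    rw [Complex.norm_real, Real.norm_eq_abs, abs_of_nonneg (sq_nonneg _)]
    exact pow_le_pow_left₀ (by linarith [hv.1.1]) hv.1.2 2
  have hsplit : ∫ v in shellBox (Set.Ioc 1 M), ((v 0 ^ 2 - v 1 ^ 2 : ℝ) : ℂ) *
        (Complex.exp (Complex.I * ((q v + dot3 x (spheroidal 1 v) : ℝ) : ℂ)) *
          ((lpBump ψ ‖a⁻¹ • spheroidal 1 v‖ : ℝ) : ℂ))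
      = 2 * (∫ v in shellBox (Set.Ioc 1 M), ((v 0 ^ 2 : ℝ) : ℂ) *
          Complex.exp (Complex.I * ((q v + dot3 x (spheroidal 1 v) : ℝ) : ℂ)) *
          ((lpBump ψ ‖a⁻¹ • spheroidal 1 v‖ : ℝ) : ℂ))
        - (∫ v in shellBox (Set.Ioc 1 M),
          Complex.exp (Complex.I * ((q v + dot3 x (spheroidal 1 v) : ℝ) : ℂ)) *
          ((lpBump ψ ‖a⁻¹ • spheroidal 1 v‖ : ℝ) : ℂ))
        - ((a ^ 2 : ℝ) : ℂ) * (∫ v in shellBox (Set.Ioc 1 M),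
          Complex.exp (Complex.I * ((q v + dot3 x (spheroidal 1 v) : ℝ) : ℂ)) *
          (((‖a⁻¹ • spheroidal 1 v‖ ^ 2 : ℝ) : ℂ) *
            ((lpBump ψ ‖a⁻¹ • spheroidal 1 v‖ : ℝ) : ℂ))) := by
    rw [← integral_two_mul_sub_sub_const_mul hi3 hi1 hi2]
    refine setIntegral_congr_fun (measurableSet_shellBox measurableSet_Ioc) fun v hv => ?_
    have hv' : v ∈ spheroidalDomain 1 := ⟨hv.1.1, hv.2⟩
    have h3 : v 0 ^ 2 - v 1 ^ 2 = 2 * v 0 ^ 2 - 1 - a ^ 2 * ‖a⁻¹ • spheroidal 1 v‖ ^ 2 := by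
      rw [norm_smul, mul_pow, norm_spheroidal_sq zero_le_one hv', Real.norm_eq_abs, sq_abs]
      field_simp
      ring
    beta_reduce
    rw [h3]
    push_cast
    ring
  rw [hsplit]
  refine (norm_sub_le _ _).trans ((add_le_add_left (norm_sub_le _ _) _).trans ?_)
  rw [norm_mul, norm_mul, Complex.norm_real, Real.norm_eq_abs, abs_of_nonneg (sq_nonneg a),
    RCLike.norm_ofNat]
  have hT3' := mul_le_mul_of_nonneg_left hT3 (sq_nonneg a)
  have hp1 : 0 ≤ C1 * J := mul_nonneg hC1 hJ
  have hp2 : 0 ≤ C2 * J := mul_nonneg hC2 hJ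
  rw [hM2] at hT2
  nlinarith [mul_nonneg hp1 (sq_nonneg a)]

theorem integrable_indicator_abs_rpow :
    Integrable ((Set.Ioc (-1 : ℝ) 1).indicator fun s : ℝ => |s| ^ (-(1 / 3) : ℝ)) := by
  rw [integrable_indicator_iff measurableSet_Ioc, ← intervalIntegrable_iff_integrableOn_Ioc_of_le
    (by norm_num)]
  have h1 : IntervalIntegrable (fun s : ℝ => |s| ^ (-(1 / 3) : ℝ)) volume 0 1 := by
    refine (intervalIntegral.intervalIntegrable_rpow' (r := -(1 / 3)) (by norm_num)).congr ?_
    intro s hs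
    rw [Set.uIoc_of_le zero_le_one] at hs
    beta_reduce
    rw [abs_of_pos hs.1]
  have h2 : IntervalIntegrable (fun s : ℝ => |s| ^ (-(1 / 3) : ℝ)) volume (-1) 0 := by
    rw [IntervalIntegrable.iff_comp_neg]
    simpa using h1.symm
  exact h2.trans h1

/-- Averaging `(1 + |z + 2πs/a|)^(-1/3)` against an integrable density gains a factor `a^(1/3)`. -/
theorem exists_integral_one_add_abs_rpow_le :
    ∃ K, 0 ≤ K ∧ ∀ {a : ℝ} (z : ℝ), 0 < a →
      Integrable (fun s : ℝ => (1 + s ^ 2)⁻¹ *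
        (1 + |z + 2 * Real.pi * a⁻¹ * s|) ^ (-(1 / 3) : ℝ)) ∧
      ∫ s : ℝ, (1 + s ^ 2)⁻¹ * (1 + |z + 2 * Real.pi * a⁻¹ * s|) ^ (-(1 / 3) : ℝ)
        ≤ K * a ^ ((1 / 3) : ℝ) := by
  set k : ℝ → ℝ := (Set.Ioc (-1 : ℝ) 1).indicator fun s : ℝ => |s| ^ (-(1 / 3) : ℝ) with hk
  have hk0 : ∀ s, 0 ≤ k s := fun s => Set.indicator_nonneg (fun s _ => by positivity) s
  have hki : Integrable k := integrable_indicator_abs_rpow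
  refine ⟨Real.pi + ∫ s, k s, add_nonneg Real.pi_pos.le (integral_nonneg hk0), fun {a} z ha => ?_⟩
  set c := a * z / (2 * Real.pi) with hc
  have hdom : Integrable fun s : ℝ => a ^ ((1 / 3) : ℝ) * ((1 + s ^ 2)⁻¹ + k (s + c)) :=
    (integrable_inv_one_add_sq.add (hki.comp_add_right c)).const_mul _
  have hmeas : Continuous fun s : ℝ => (1 + s ^ 2)⁻¹ *
        (1 + |z + 2 * Real.pi * a⁻¹ * s|) ^ (-(1 / 3) : ℝ) := by
    refine Continuous.mul (Continuous.inv₀ (by fun_prop) fun s => by positivity)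
      (Continuous.rpow_const (by fun_prop) fun s => Or.inl (by positivity))
  have hle : ∀ᵐ s : ℝ, (1 + s ^ 2)⁻¹ * (1 + |z + 2 * Real.pi * a⁻¹ * s|) ^ (-(1 / 3) : ℝ)
      ≤ a ^ ((1 / 3) : ℝ) * ((1 + s ^ 2)⁻¹ + k (s + c)) := by
    have hne : ∀ᵐ s : ℝ, s ≠ -c := by
      rw [ae_iff]
      simp
    filter_upwards [hne] with s hs
    have hu : 0 < |s + c| := abs_pos.2 fun h => hs (by linarith)
    have hinv1 : (1 + s ^ 2)⁻¹ ≤ 1 := inv_le_one_of_one_le₀ (by nlinarith [sq_nonneg s])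
    have hinv0 : 0 ≤ (1 + s ^ 2)⁻¹ := by positivity
    have h1 : a⁻¹ * |s + c| ≤ 1 + |z + 2 * Real.pi * a⁻¹ * s| := by
      have h2 : z + 2 * Real.pi * a⁻¹ * s = 2 * Real.pi * (a⁻¹ * (s + c)) := by
        rw [hc]; field_simp; ring
      rw [h2, abs_mul, abs_mul a⁻¹, abs_of_pos (inv_pos.2 ha), abs_of_pos Real.two_pi_pos]
      have h3 : 0 ≤ a⁻¹ * |s + c| := by positivity
      nlinarith [Real.pi_gt_three]
    have h2 : (1 + |z + 2 * Real.pi * a⁻¹ * s|) ^ (-(1 / 3) : ℝ)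
        ≤ a ^ ((1 / 3) : ℝ) * |s + c| ^ (-(1 / 3) : ℝ) := by
      refine (Real.rpow_le_rpow_of_nonpos (by positivity) h1 (by norm_num)).trans_eq ?_
      rw [Real.mul_rpow (by positivity) hu.le, Real.inv_rpow ha.le, ← Real.rpow_neg ha.le, neg_neg]
    refine (mul_le_mul_of_nonneg_left h2 hinv0).trans ?_
    rw [mul_left_comm]
    refine mul_le_mul_of_nonneg_left ?_ (by positivity)
    by_cases h3 : s + c ∈ Set.Ioc (-1 : ℝ) 1
    · have h4 : k (s + c) = |s + c| ^ (-(1 / 3) : ℝ) := Set.indicator_of_mem h3 _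
      rw [← h4]
      nlinarith [hk0 (s + c)]
    · have h4 : 1 ≤ |s + c| := by
        by_contra! h5
        exact h3 ⟨(abs_lt.1 h5).1, (abs_lt.1 h5).2.le⟩
      have h5 : |s + c| ^ (-(1 / 3) : ℝ) ≤ 1 :=
        Real.rpow_le_one_of_one_le_of_nonpos h4 (by norm_num)
      nlinarith [hk0 (s + c)]
  have hInt := hdom.mono' hmeas.aestronglyMeasurable (by
    filter_upwards [hle] with s hs
    rwa [Real.norm_eq_abs, abs_of_nonneg (by positivity)])
  refine ⟨hInt, (integral_mono_ae hInt hdom hle).trans_eq ?_⟩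
  rw [integral_const_mul, integral_add integrable_inv_one_add_sq (hki.comp_add_right c),
    integral_univ_inv_one_add_sq, integral_add_right_eq_self]
  ring

theorem rpow_sixteen_mul_sq_le {a : ℝ} (ha : 0 < a) :
    (16 * a ^ 2) ^ ((1 / 3) : ℝ)
      ≤ 16 * (a ^ ((1 / 3) : ℝ) * (1 + a ^ 2) ^ ((1 / 6) : ℝ)) := by
  have h1 : (16 : ℝ) ^ ((1 / 3) : ℝ) ≤ 16 :=
    (Real.rpow_le_rpow_of_exponent_le (by norm_num) (by norm_num)).trans_eq (Real.rpow_one 16)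
  have h2 : a ^ ((1 / 3) : ℝ) ≤ (1 + a ^ 2) ^ ((1 / 6) : ℝ) := by
    have h3 : a ^ ((1 / 3) : ℝ) = (a ^ 2) ^ ((1 / 6) : ℝ) := by
      rw [← Real.rpow_natCast, ← Real.rpow_mul ha.le]; norm_num
    rw [h3]
    exact Real.rpow_le_rpow (by positivity) (by linarith) (by norm_num)
  rw [Real.mul_rpow (by norm_num) (by positivity), sq, Real.mul_rpow ha.le ha.le]
  rw [sq] at h2
  gcongr

theorem exists_norm_integral_inertial_le {ψ : ℝ → ℝ} (hψ : IsCutoff ψ) :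
    ∃ C, 0 ≤ C ∧ ∀ {τ a : ℝ} {x : E3}, 0 < τ → 0 < a →
      ‖∫ η : E3, Complex.exp (Complex.I * ((τ * Om 1 η + dot3 x η : ℝ) : ℂ)) *
        ((lpBump ψ (a⁻¹ * ‖η‖) : ℝ) : ℂ)‖ ≤ C * τ⁻¹ * (1 + a ^ 2) ^ ((3 / 2) : ℝ) := by
  obtain ⟨C, hC, h⟩ := exists_norm_integral_exp_mul_lpBump_le hψ
  refine ⟨C * (4 * Real.pi * 64 * Real.pi), by positivity, fun {τ a x} hτ ha => ?_⟩
  have hM : 1 ≤ √(1 + 16 * a ^ 2) := Real.one_le_sqrt.2 (by nlinarith [sq_nonneg a])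
  refine (h (θ := fun η => τ * Om 1 η) ha (by fun_prop)
    (fun v hv => by rw [Om_one_spheroidal hv]) (shellBound_inertial hτ hM)
    (integrable_inv_one_add_sq.mul_const _)).trans ?_
  rw [integral_mul_const, integral_univ_inv_one_add_sq]
  have h1 : √(1 + 16 * a ^ 2) ≤ 4 * (1 + a ^ 2) ^ ((1 / 2) : ℝ) := by
    rw [← Real.sqrt_eq_rpow]
    refine Real.sqrt_le_iff.2 ⟨by positivity, ?_⟩
    rw [mul_pow, Real.sq_sqrt (by positivity)]
    linarith [sq_nonneg a]
  have h2 : (1 + a ^ 2) ^ ((3 / 2) : ℝ) = (1 + a ^ 2) * (1 + a ^ 2) ^ ((1 / 2) : ℝ) := by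
    rw [show ((3 / 2) : ℝ) = 1 + 1 / 2 by norm_num, Real.rpow_add (by positivity), Real.rpow_one]
  rw [h2, div_eq_mul_inv]
  calc C * (1 + a ^ 2) * (Real.pi * (4 * Real.pi * (16 * √(1 + 16 * a ^ 2) * τ⁻¹)))
      ≤ C * (1 + a ^ 2) * (Real.pi * (4 * Real.pi *
        (16 * (4 * (1 + a ^ 2) ^ ((1 / 2) : ℝ)) * τ⁻¹))) := by gcongr
    _ = _ := by ring

theorem exists_norm_integral_sound_le {ψ : ℝ → ℝ} (hψ : IsCutoff ψ) :
    ∃ C, 0 ≤ C ∧ ∀ {τ a : ℝ} {x : E3}, 0 < τ → 0 < a →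
      ‖∫ η : E3, Complex.exp (Complex.I * ((τ * Sig 1 η + dot3 x η : ℝ) : ℂ)) *
        ((lpBump ψ (a⁻¹ * ‖η‖) : ℝ) : ℂ)‖
        ≤ C * τ⁻¹ * a ^ ((1 / 3) : ℝ) * (1 + a ^ 2) ^ ((7 / 6) : ℝ) := by
  obtain ⟨C, hC, h⟩ := exists_norm_integral_exp_mul_lpBump_le hψ
  obtain ⟨K, hK, hK'⟩ := exists_integral_one_add_abs_rpow_le
  refine ⟨C * (120 * Real.pi * (16 * Real.pi + K)), by positivity, fun {τ a x} hτ ha => ?_⟩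
  have hM : 1 ≤ √(1 + 16 * a ^ 2) := Real.one_le_sqrt.2 (by nlinarith [sq_nonneg a])
  obtain ⟨hi, hle⟩ := hK' (x 2) ha
  set A := (16 * a ^ 2) ^ ((1 / 3) : ℝ) with hA
  have hM2 : (√(1 + 16 * a ^ 2) ^ 2 - 1) ^ ((1 / 3) : ℝ) = A := by
    rw [Real.sq_sqrt (by positivity), add_sub_cancel_left]
  have heq : ∀ s : ℝ, (1 + s ^ 2)⁻¹ * (4 * Real.pi * (30 / τ *
      (A + (1 + |x 2 + 2 * Real.pi * a⁻¹ * s|) ^ (-(1 / 3) : ℝ))))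
      = 4 * Real.pi * (30 / τ) * (A * (1 + s ^ 2)⁻¹ + (1 + s ^ 2)⁻¹ *
        (1 + |x 2 + 2 * Real.pi * a⁻¹ * s|) ^ (-(1 / 3) : ℝ)) := fun s => by ring
  have hs := shellBound_sound hτ hM
  rw [hM2] at hs
  refine (h (θ := fun η => τ * Sig 1 η) ha (by fun_prop)
    (fun v hv => by rw [Sig_one_spheroidal hv]) hs ?_).trans ?_
  · simp only [heq]
    exact ((integrable_inv_one_add_sq.const_mul A).add hi).const_mul _
  simp only [heq]
  rw [integral_const_mul, integral_add (integrable_inv_one_add_sq.const_mul A) hi,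
    integral_const_mul, integral_univ_inv_one_add_sq]
  have h6 : 1 ≤ (1 + a ^ 2) ^ ((1 / 6) : ℝ) :=
    Real.one_le_rpow (by nlinarith [sq_nonneg a]) (by norm_num)
  have h1 := rpow_sixteen_mul_sq_le ha
  rw [← hA] at h1
  have h2 : (1 + a ^ 2) ^ ((7 / 6) : ℝ) = (1 + a ^ 2) * (1 + a ^ 2) ^ ((1 / 6) : ℝ) := by
    rw [show ((7 / 6) : ℝ) = 1 + 1 / 6 by norm_num, Real.rpow_add (by positivity), Real.rpow_one]
  have h3 : K * a ^ ((1 / 3) : ℝ) ≤ K * (a ^ ((1 / 3) : ℝ) * (1 + a ^ 2) ^ ((1 / 6) : ℝ)) :=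
    mul_le_mul_of_nonneg_left (le_mul_of_one_le_right (by positivity) h6) hK
  rw [h2, div_eq_mul_inv]
  calc C * (1 + a ^ 2) * (4 * Real.pi * (30 * τ⁻¹) * (A * Real.pi + _))
      ≤ C * (1 + a ^ 2) * (4 * Real.pi * (30 * τ⁻¹) *
        (16 * (a ^ ((1 / 3) : ℝ) * (1 + a ^ 2) ^ ((1 / 6) : ℝ)) * Real.pi
          + K * (a ^ ((1 / 3) : ℝ) * (1 + a ^ 2) ^ ((1 / 6) : ℝ)))) := by
        gcongr
        exact hle.trans h3
    _ = _ := by ring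

theorem d1_inv_smul {κ : ℝ} (hκ : 0 < κ) (η : E3) : d1 κ (κ⁻¹ • η) = κ⁻¹ * d1 1 η := by
  rw [d1, d1, ← Real.sqrt_sq (inv_pos.2 hκ).le, ← Real.sqrt_mul (sq_nonneg _),
    Real.sqrt_sq (inv_pos.2 hκ).le]
  congr 1
  simp only [PiLp.smul_apply, smul_eq_mul, inv_one]
  ring

theorem d2_inv_smul {κ : ℝ} (hκ : 0 < κ) (η : E3) : d2 κ (κ⁻¹ • η) = κ⁻¹ * d2 1 η := by
  rw [d2, d2, ← Real.sqrt_sq (inv_pos.2 hκ).le, ← Real.sqrt_mul (sq_nonneg _),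
    Real.sqrt_sq (inv_pos.2 hκ).le]
  congr 1
  simp only [PiLp.smul_apply, smul_eq_mul, inv_one]
  ring

/-- Rescaling to unit focal distance. -/
theorem integral_exp_mul_lpBump_rescale {κ : ℝ} (hκ : 0 < κ) (ψ : ℝ → ℝ) (t : ℝ) (k : ℤ) (x : E3)
    {θ θ₁ : E3 → ℝ} (hθ : ∀ η, θ (κ⁻¹ • η) = κ⁻¹ * θ₁ η) :
    ‖∫ ξ : E3, Complex.exp (Complex.I * ((t * θ ξ + dot3 x ξ : ℝ) : ℂ)) *
        ((lpBump ψ ((2 : ℝ) ^ (-k) * ‖ξ‖) : ℝ) : ℂ)‖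
      = κ⁻¹ ^ 3 * ‖∫ η : E3, Complex.exp (Complex.I *
        ((t * κ⁻¹ * θ₁ η + dot3 (κ⁻¹ • x) η : ℝ) : ℂ)) *
        ((lpBump ψ (((2 : ℝ) ^ k * κ)⁻¹ * ‖η‖) : ℝ) : ℂ)‖ := by
  have hi := inv_pos.2 hκ
  have h := Measure.integral_comp_smul (volume : Measure E3) (fun ξ : E3 =>
    Complex.exp (Complex.I * ((t * θ ξ + dot3 x ξ : ℝ) : ℂ)) *
        ((lpBump ψ ((2 : ℝ) ^ (-k) * ‖ξ‖) : ℝ) : ℂ)) κ⁻¹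
  rw [finrank_euclideanSpace_fin, abs_of_pos (by positivity)] at h
  have h2 : ∀ η : E3, Complex.exp (Complex.I *
      ((t * θ (κ⁻¹ • η) + dot3 x (κ⁻¹ • η) : ℝ) : ℂ)) *
        ((lpBump ψ ((2 : ℝ) ^ (-k) * ‖κ⁻¹ • η‖) : ℝ) : ℂ)
      = Complex.exp (Complex.I * ((t * κ⁻¹ * θ₁ η + dot3 (κ⁻¹ • x) η : ℝ) : ℂ)) *
        ((lpBump ψ (((2 : ℝ) ^ k * κ)⁻¹ * ‖η‖) : ℝ) : ℂ) := fun η => by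
    have h3 : dot3 x (κ⁻¹ • η) = dot3 (κ⁻¹ • x) η := by
      simp only [dot3, PiLp.smul_apply, smul_eq_mul]
      ring
    rw [hθ, h3, norm_smul, Real.norm_eq_abs, abs_of_pos hi, zpow_neg, mul_inv, ← mul_assoc,
      ← mul_assoc]
  simp only [h2] at h
  rw [h, norm_smul, Real.norm_eq_abs, abs_of_pos (by positivity)]
  field_simp

/-- Convolution-kernel form of the `t⁻¹` dispersive decay estimates
`‖e^{itΩ_κ}P_k f‖_∞ ≤ Cκ⁻²t⁻¹⟨2ᵏκ⟩³‖P_k f‖₁` and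
`‖e^{itΣ_κ}P_k f‖_∞ ≤ Cκ^{−5/3}t⁻¹⟨2ᵏκ⟩^{7/3}2^{k/3}‖P_k f‖₁`. -/
theorem kernel_decay_t_inv (ψ : ℝ → ℝ) (hψ : IsCutoff ψ) :
    ∃ C > 0, ∀ (κ t : ℝ) (k : ℤ) (x : E3), 0 < κ → 0 < t →
      ‖∫ ξ : E3, Complex.exp (Complex.I * ((t * Om κ ξ + dot3 x ξ : ℝ) : ℂ)) *
          ((lpBump ψ ((2 : ℝ) ^ (-k) * ‖ξ‖) : ℝ) : ℂ)‖
        ≤ C * κ⁻¹ ^ 2 * t⁻¹ * (1 + ((2 : ℝ) ^ k * κ) ^ 2) ^ ((3 / 2) : ℝ) ∧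
      ‖∫ ξ : E3, Complex.exp (Complex.I * ((t * Sig κ ξ + dot3 x ξ : ℝ) : ℂ)) *
          ((lpBump ψ ((2 : ℝ) ^ (-k) * ‖ξ‖) : ℝ) : ℂ)‖
        ≤ C * κ ^ (-(5 / 3) : ℝ) * t⁻¹ * (1 + ((2 : ℝ) ^ k * κ) ^ 2) ^ ((7 / 6) : ℝ)
          * (2 : ℝ) ^ ((k : ℝ) / 3) := by
  obtain ⟨C₁, hC₁, h₁⟩ := exists_norm_integral_inertial_le hψ
  obtain ⟨C₂, hC₂, h₂⟩ := exists_norm_integral_sound_le hψ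
  refine ⟨C₁ + C₂ + 1, by positivity, fun κ t k x hκ ht => ⟨?_, ?_⟩⟩
  · rw [integral_exp_mul_lpBump_rescale hκ ψ t k x (θ₁ := Om 1) fun η => by
      rw [Om, Om, d1_inv_smul hκ, d2_inv_smul hκ]; ring]
    calc _ ≤ κ⁻¹ ^ 3 * (C₁ * (t * κ⁻¹)⁻¹ * (1 + ((2 : ℝ) ^ k * κ) ^ 2) ^ ((3 / 2) : ℝ)) := by
          gcongr
          exact h₁ (by positivity) (by positivity)
      _ = C₁ * κ⁻¹ ^ 2 * t⁻¹ * (1 + ((2 : ℝ) ^ k * κ) ^ 2) ^ ((3 / 2) : ℝ) := by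
          field_simp
      _ ≤ _ := by
          gcongr
          linarith
  · rw [integral_exp_mul_lpBump_rescale hκ ψ t k x (θ₁ := Sig 1) fun η => by
      rw [Sig, Sig, d1_inv_smul hκ, d2_inv_smul hκ]; ring]
    have hpow : κ⁻¹ ^ 2 * ((2 : ℝ) ^ k * κ) ^ ((1 / 3) : ℝ)
        = κ ^ (-(5 / 3) : ℝ) * (2 : ℝ) ^ ((k : ℝ) / 3) := by
      rw [Real.mul_rpow (by positivity) hκ.le, ← Real.rpow_intCast, ← Real.rpow_mul two_pos.le,
        show (-(5 / 3) : ℝ) = -2 + 1 / 3 by norm_num, Real.rpow_add hκ, Real.rpow_neg hκ.le,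
        Real.rpow_two, inv_pow, mul_one_div]
      ring
    calc _ ≤ κ⁻¹ ^ 3 * (C₂ * (t * κ⁻¹)⁻¹ * ((2 : ℝ) ^ k * κ) ^ ((1 / 3) : ℝ) *
          (1 + ((2 : ℝ) ^ k * κ) ^ 2) ^ ((7 / 6) : ℝ)) := by
          gcongr
          exact h₂ (by positivity) (by positivity)
      _ = C₂ * t⁻¹ * (1 + ((2 : ℝ) ^ k * κ) ^ 2) ^ ((7 / 6) : ℝ) *
          (κ⁻¹ ^ 2 * ((2 : ℝ) ^ k * κ) ^ ((1 / 3) : ℝ)) := by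
          rw [mul_inv, inv_inv]
          field_simp
      _ = C₂ * κ ^ (-(5 / 3) : ℝ) * t⁻¹ * (1 + ((2 : ℝ) ^ k * κ) ^ 2) ^ ((7 / 6) : ℝ)
          * (2 : ℝ) ^ ((k : ℝ) / 3) := by
          rw [hpow]; ring
      _ ≤ _ := by
          gcongr
          linarith
end
end

section
/- (Optimality of the t⁻¹ decay rate.) There exists a constant c₁ > 0 such that the following holds for all κ > 0 and c > 0. Let g : ℝ³ → ℝ be smooth with 0 ≤ g ≤ 1, radially symmetric about the point P = (0,0,κ⁻¹) (i.e. g(ξ) depends only on |ξ − P|), with g(ξ) = 1 whenever |ξ − P| ≤ (4κ)⁻¹ and g(ξ) = 0 whenever |ξ − P| ≥ (2κ)⁻¹. Then for each Λ ∈ {Σ_κ, Ω_κ} there exists T₀ > 0 (depending on c and κ) such that for all t ≥ T₀: |∫_{ℝ³} e^{i·t·c·Λ(ξ)} g(ξ) dξ| ≥ c₁·(c·κ²)⁻¹·t⁻¹. In particular, the t⁻¹ decay rate for the frequency-localized evolutions e^{itcΛ_κ} is optimal. -/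
noncomputable section

open MeasureTheory

open Set Filter Topology

/-- Integration over `ℝ³` as an iterated integral, the third coordinate being outermost. -/
lemma integral_E3_eq_iterated {f : ℝ → ℝ × ℝ → ℂ} (hf : Continuous (Function.uncurry f))
    (hc : HasCompactSupport (Function.uncurry f)) :
    ∫ ξ : E3, f (ξ 2) (ξ 0, ξ 1) = ∫ z : ℝ, ∫ p : ℝ × ℝ, f z p := by
  have h1 := (EuclideanSpace.volume_preserving_symm_measurableEquiv_toLp (Fin 3)).integral_comp'
    (fun v : Fin 3 → ℝ => f (v 2) (v 0, v 1))
  have h2 := (volume_preserving_piFinSuccAbove (fun _ : Fin 3 => ℝ) 2).integral_comp'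
    (fun q : ℝ × (Fin 2 → ℝ) => f q.1 (q.2 0, q.2 1))
  have h3 := ((MeasurePreserving.id (volume : Measure ℝ)).prod
    (volume_preserving_finTwoArrow ℝ)).integral_comp
    ((MeasurableEquiv.refl ℝ).prodCongr MeasurableEquiv.finTwoArrow).measurableEmbedding
    (Function.uncurry f)
  calc ∫ ξ : E3, f (ξ 2) (ξ 0, ξ 1) = ∫ v : Fin 3 → ℝ, f (v 2) (v 0, v 1) := h1
    _ = ∫ q : ℝ × (Fin 2 → ℝ), f q.1 (q.2 0, q.2 1) := h2
    _ = ∫ q : ℝ × (ℝ × ℝ), Function.uncurry f q := h3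
    _ = _ := integral_prod _ (hf.integrable_of_hasCompactSupport hc)

/-- The integral over the plane of a radial function. -/
lemma integral_radial_plane (h : ℝ → ℂ) :
    ∫ p : ℝ × ℝ, h (p.1 ^ 2 + p.2 ^ 2)
      = 2 * Real.pi * ∫ s in Ioi (0 : ℝ), s * h (s ^ 2) := by
  rw [← integral_comp_polarCoord_symm]
  have : ∀ p : ℝ × ℝ, p.1 • h ((polarCoord.symm p).1 ^ 2 + (polarCoord.symm p).2 ^ 2)
      = (p.1 * h (p.1 ^ 2)) * (1 : ℂ) := by
    intro p
    have h1 : (p.1 * Real.cos p.2) ^ 2 + (p.1 * Real.sin p.2) ^ 2 = p.1 ^ 2 := by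
      linear_combination p.1 ^ 2 * Real.sin_sq_add_cos_sq p.2
    simp [h1]
  simp_rw [this]
  rw [polarCoord_target, Measure.volume_eq_prod,
    setIntegral_prod_mul (fun s : ℝ => (s : ℂ) * h (s ^ 2)) (fun _ => (1 : ℂ))]
  simp only [integral_const, MeasurableSet.univ, measureReal_restrict_apply, univ_inter,
    Real.volume_real_Ioo, Complex.real_smul]
  rw [max_eq_left (by linarith [Real.pi_pos])]
  push_cast
  ring

/-- The integral of an even function over `ℝ` is twice its integral over the half-line. -/
lemma integral_even {u : ℝ → ℂ} (hu : Integrable u) (he : ∀ s, u (-s) = u s) :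
    ∫ s, u s = 2 * ∫ s in Ioi (0 : ℝ), u s := by
  rw [← intervalIntegral.integral_Iic_add_Ioi (b := 0) hu.integrableOn hu.integrableOn]
  have := integral_comp_neg_Iic 0 u
  simp only [he, neg_zero] at this
  rw [this, two_mul]

/-- Spherical coordinates with the third axis as polar axis, for integrands depending only on the
distance to the origin and on the third coordinate. -/
lemma integral_E3_spherical {f : ℝ → ℝ → ℂ} (hf : Continuous (Function.uncurry f)) {R : ℝ}
    (hR : ∀ r w, R ≤ r → f r w = 0) :
    ∫ ξ : E3, f (√(ξ 0 ^ 2 + ξ 1 ^ 2 + ξ 2 ^ 2)) (ξ 2)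
      = Real.pi * ∫ r in Ioi (0 : ℝ), ∫ θ in Ioo (-Real.pi) Real.pi,
          (r ^ 2 * |Real.sin θ| : ℝ) * f r (r * Real.cos θ) := by
  have hle : ∀ x y : ℝ, 0 ≤ y → |x| ≤ √(x ^ 2 + y) := fun x y hy =>
    Real.abs_le_sqrt (by linarith)
  have e1 : ∫ ξ : E3, f (√(ξ 0 ^ 2 + ξ 1 ^ 2 + ξ 2 ^ 2)) (ξ 2)
      = ∫ z : ℝ, ∫ p : ℝ × ℝ, f (√(p.1 ^ 2 + p.2 ^ 2 + z ^ 2)) z := by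
    refine integral_E3_eq_iterated (f := fun z p => f (√(p.1 ^ 2 + p.2 ^ 2 + z ^ 2)) z) ?_ ?_
    · exact hf.comp (f := fun q : ℝ × ℝ × ℝ => (√(q.2.1 ^ 2 + q.2.2 ^ 2 + q.1 ^ 2), q.1))
        (by fun_prop)
    · refine HasCompactSupport.intro (isCompact_closedBall (0 : ℝ × ℝ × ℝ) R) ?_
      rintro ⟨z, x, y⟩ hq
      refine hR _ _ (le_of_lt ?_)
      simp only [mem_closedBall_zero_iff, not_le, Prod.norm_mk, Real.norm_eq_abs,
        lt_sup_iff] at hq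
      rcases hq with h | h | h
      · exact h.trans_le 
          ((hle z (x ^ 2 + y ^ 2) (by positivity)).trans_eq (congrArg _ (by ring)))
      · exact h.trans_le 
          ((hle x (y ^ 2 + z ^ 2) (by positivity)).trans_eq (congrArg _ (by ring)))
      · exact h.trans_le 
          ((hle y (z ^ 2 + x ^ 2) (by positivity)).trans_eq (congrArg _ (by ring)))
  have hcF : Continuous fun q : ℝ × ℝ => ((|q.2| : ℝ) : ℂ) * f (√(q.2 ^ 2 + q.1 ^ 2)) q.1 := by
    refine Continuous.mul (by fun_prop) ?_
    exact hf.comp (f := fun q : ℝ × ℝ => (√(q.2 ^ 2 + q.1 ^ 2), q.1)) (by fun_prop)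
  have hsF : HasCompactSupport
      fun q : ℝ × ℝ => ((|q.2| : ℝ) : ℂ) * f (√(q.2 ^ 2 + q.1 ^ 2)) q.1 := by
    refine HasCompactSupport.intro (isCompact_closedBall (0 : ℝ × ℝ) R) ?_
    rintro ⟨z, s⟩ hq
    refine mul_eq_zero_of_right _ (hR _ _ (le_of_lt ?_))
    simp only [mem_closedBall_zero_iff, not_le, Prod.norm_mk, Real.norm_eq_abs,
      lt_sup_iff] at hq
    rcases hq with h | h
    · exact h.trans_le ((hle z (s ^ 2) (by positivity)).trans_eq (by rw [add_comm]))
    · exact h.trans_le (hle s (z ^ 2) (by positivity))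
  have hiF : Integrable (fun q : ℝ × ℝ => ((|q.2| : ℝ) : ℂ) * f (√(q.2 ^ 2 + q.1 ^ 2)) q.1)
      (volume.prod volume) := hcF.integrable_of_hasCompactSupport hsF
  have e2 : ∀ z : ℝ, ∫ p : ℝ × ℝ, f (√(p.1 ^ 2 + p.2 ^ 2 + z ^ 2)) z
      = Real.pi * ∫ s : ℝ, ((|s| : ℝ) : ℂ) * f (√(s ^ 2 + z ^ 2)) z := by
    intro z
    rw [integral_radial_plane (fun m => f (√(m + z ^ 2)) z), integral_even]
    · have : ∫ s in Ioi (0 : ℝ), ((|s| : ℝ) : ℂ) * f (√(s ^ 2 + z ^ 2)) z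
          = ∫ s in Ioi (0 : ℝ), (s : ℂ) * f (√(s ^ 2 + z ^ 2)) z := by
        refine setIntegral_congr_fun measurableSet_Ioi fun s hs => ?_
        simp only [abs_of_pos (mem_Ioi.1 hs)]
      rw [this]
      ring
    · have hc : Continuous fun s : ℝ => ((|s| : ℝ) : ℂ) * f (√(s ^ 2 + z ^ 2)) z :=
        hcF.comp (f := fun s => (z, s)) (by fun_prop)
      refine hc.integrable_of_hasCompactSupport
        (HasCompactSupport.intro (isCompact_closedBall (0 : ℝ) R) fun s hs => ?_)
      simp only [mem_closedBall_zero_iff, not_le, Real.norm_eq_abs] at hs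
      exact mul_eq_zero_of_right _ (hR _ _ (hs.le.trans (hle s (z ^ 2) (by positivity))))
    · intro s
      simp
  rw [e1]
  simp_rw [e2]
  rw [integral_const_mul, ← integral_prod (μ := volume) (ν := volume) _ hiF,
    ← Measure.volume_eq_prod, ← integral_comp_polarCoord_symm]
  congr 1
  have e3 : ∀ p ∈ polarCoord.target, p.1 • (((|(polarCoord.symm p).2| : ℝ) : ℂ) *
        f (√((polarCoord.symm p).2 ^ 2 + (polarCoord.symm p).1 ^ 2)) (polarCoord.symm p).1)
      = (p.1 ^ 2 * |Real.sin p.2| : ℝ) * f p.1 (p.1 * Real.cos p.2) := by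
    rintro ⟨r, θ⟩ hp
    have hr : 0 < r := hp.1
    have h1 : (r * Real.sin θ) ^ 2 + (r * Real.cos θ) ^ 2 = r ^ 2 := by
      linear_combination r ^ 2 * Real.sin_sq_add_cos_sq θ
    simp only [polarCoord_symm_apply, h1, Real.sqrt_sq hr.le, abs_mul, abs_of_pos hr,
      Complex.real_smul]
    push_cast
    ring
  rw [setIntegral_congr_fun (polarCoord.open_target.measurableSet) e3, polarCoord_target,
    Measure.volume_eq_prod,
    setIntegral_prod (fun p : ℝ × ℝ => (p.1 ^ 2 * |Real.sin p.2| : ℝ) * f p.1 (p.1 * Real.cos p.2))]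
  have hc : Continuous fun p : ℝ × ℝ =>
      ((p.1 ^ 2 * |Real.sin p.2| : ℝ) : ℂ) * f p.1 (p.1 * Real.cos p.2) := by
    refine Continuous.mul (by fun_prop) ?_
    exact hf.comp (f := fun p : ℝ × ℝ => (p.1, p.1 * Real.cos p.2)) (by fun_prop)
  have hK : IntegrableOn (fun p : ℝ × ℝ =>
      ((p.1 ^ 2 * |Real.sin p.2| : ℝ) : ℂ) * f p.1 (p.1 * Real.cos p.2))
      (Icc 0 R ×ˢ Icc (-Real.pi) Real.pi) :=
    hc.continuousOn.integrableOn_compact (isCompact_Icc.prod isCompact_Icc)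
  refine IntegrableOn.of_forall_sdiff_eq_zero hK
    (measurableSet_Ioi.prod measurableSet_Ioo) ?_
  rintro ⟨r, θ⟩ ⟨⟨h1, h2⟩, h3⟩
  refine mul_eq_zero_of_right _ (hR _ _ ?_)
  by_contra! h
  exact h3 ⟨⟨le_of_lt h1, h.le⟩, Ioo_subset_Icc_self h2⟩

/-- A primitive of `ρ ↦ ρ e^{iτρ}`. -/
def expPrimitive (τ ρ : ℝ) : ℂ :=
  (ρ / (Complex.I * τ) + 1 / (τ : ℂ) ^ 2) * Complex.exp (Complex.I * τ * ρ)

lemma hasDerivAt_expPrimitive {τ : ℝ} (hτ : τ ≠ 0) (ρ : ℝ) :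
    HasDerivAt (expPrimitive τ) (ρ * Complex.exp (Complex.I * τ * ρ)) ρ := by
  have h0 : HasDerivAt (fun ρ : ℝ => (ρ : ℂ)) 1 ρ := Complex.ofRealCLM.hasDerivAt
  have h1 := ((h0.div_const (Complex.I * τ)).add_const (1 / (τ : ℂ) ^ 2)).mul
    (h0.const_mul (Complex.I * τ)).cexp
  refine h1.congr_deriv ?_
  have hτ' : (τ : ℂ) ≠ 0 := by exact_mod_cast hτ
  have hI := Complex.I_ne_zero
  field_simp
  linear_combination Complex.I_sq

/-- Integral over a sphere of radius `r` of the oscillating exponential of the distance to a point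
at distance `a > r` from the centre. -/
lemma integral_abs_sin_mul_exp {a r τ : ℝ} (hr : 0 < r) (hra : r < a) (hτ : τ ≠ 0) :
    ∫ θ in Ioo (-Real.pi) Real.pi, ((|Real.sin θ| : ℝ) : ℂ) *
        Complex.exp (Complex.I * τ * (√(r ^ 2 + 2 * a * (r * Real.cos θ) + a ^ 2) : ℝ))
      = 2 / (a * r) * (expPrimitive τ (a + r) - expPrimitive τ (a - r)) := by
  set ρ : ℝ → ℝ := fun θ => √(r ^ 2 + 2 * a * (r * Real.cos θ) + a ^ 2) with hρ
  have ha : 0 < a := hr.trans hra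
  have hpos : ∀ θ, 0 < r ^ 2 + 2 * a * (r * Real.cos θ) + a ^ 2 := fun θ => by
    nlinarith [Real.neg_one_le_cos θ, mul_pos ha hr, pow_pos (sub_pos.2 hra) 2]
  have hc : Continuous ρ := by fun_prop
  set u : ℝ → ℂ := fun θ => ((|Real.sin θ| : ℝ) : ℂ) * Complex.exp (Complex.I * τ * (ρ θ : ℝ))
    with hu
  have huc : Continuous u := by fun_prop
  have hd : ∀ θ, HasDerivAt (fun θ => -(1 / (a * r) : ℂ) * expPrimitive τ (ρ θ))
      (Real.sin θ * Complex.exp (Complex.I * τ * (ρ θ : ℝ))) θ := by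
    intro θ
    have h1 : HasDerivAt ρ (-(a * r * Real.sin θ) / ρ θ) θ := by
      have := (((((Real.hasDerivAt_cos θ).const_mul r).const_mul (2 * a)).const_add
        (r ^ 2)).add_const (a ^ 2)).sqrt (hpos θ).ne'
      refine this.congr_deriv ?_
      simp only [hρ]
      field_simp
    have h2 := (((hasDerivAt_expPrimitive hτ (ρ θ)).scomp θ h1)).const_mul (-(1 / (a * r) : ℂ))
    refine h2.congr_deriv ?_
    have hρ0 : (ρ θ : ℂ) ≠ 0 := by exact_mod_cast (Real.sqrt_pos.2 (hpos θ)).ne'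
    have ha' : (a : ℂ) ≠ 0 := by exact_mod_cast ha.ne'
    have hr' : (r : ℂ) ≠ 0 := by exact_mod_cast hr.ne'
    simp only [Complex.real_smul]
    push_cast
    field_simp
  have hhalf : ∫ θ in (0 : ℝ)..Real.pi, u θ
      = 1 / (a * r) * (expPrimitive τ (a + r) - expPrimitive τ (a - r)) := by
    have h1 : ∫ θ in (0 : ℝ)..Real.pi, u θ
        = ∫ θ in (0 : ℝ)..Real.pi, Real.sin θ * Complex.exp (Complex.I * τ * (ρ θ : ℝ)) := by
      refine intervalIntegral.integral_congr fun θ hθ => ?_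
      rw [uIcc_of_le Real.pi_pos.le] at hθ
      simp only [hu, abs_of_nonneg (Real.sin_nonneg_of_nonneg_of_le_pi hθ.1 hθ.2)]
    rw [h1, intervalIntegral.integral_eq_sub_of_hasDerivAt (fun θ _ => hd θ)
      (Continuous.intervalIntegrable (by fun_prop) _ _)]
    have e0 : ρ 0 = a + r := by
      rw [hρ]
      simp only [Real.cos_zero]
      rw [Real.sqrt_eq_iff_mul_self_eq_of_pos (by linarith)]
      ring
    have eπ : ρ Real.pi = a - r := by
      rw [hρ]
      simp only [Real.cos_pi]
      rw [Real.sqrt_eq_iff_mul_self_eq_of_pos (by linarith)]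
      ring
    rw [e0, eπ]
    ring
  have hneg : ∫ θ in (-Real.pi)..0, u θ = ∫ θ in (0 : ℝ)..Real.pi, u θ := by
    have := intervalIntegral.integral_comp_neg (a := 0) (b := Real.pi) u
    simp only [neg_zero] at this
    rw [← this]
    refine intervalIntegral.integral_congr fun θ _ => ?_
    simp [hu, hρ]
  calc ∫ θ in Ioo (-Real.pi) Real.pi, u θ = ∫ θ in (-Real.pi)..Real.pi, u θ := by
        rw [intervalIntegral.integral_of_le (by linarith [Real.pi_pos]),
          integral_Ioc_eq_integral_Ioo]
    _ = (∫ θ in (-Real.pi)..0, u θ) + ∫ θ in (0 : ℝ)..Real.pi, u θ :=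
        (intervalIntegral.integral_add_adjacent_intervals (huc.intervalIntegrable _ _)
          (huc.intervalIntegrable _ _)).symm
    _ = _ := by
        rw [hneg, hhalf]
        ring

/-- The Riemann–Lebesgue lemma on the half-line. -/
lemma tendsto_integral_Ioi_mul_exp (h : ℝ → ℂ) {b : ℝ} (hb : b ≠ 0) :
    Tendsto (fun τ : ℝ => ∫ r in Ioi (0 : ℝ), h r * Complex.exp (Complex.I * (b * τ * r : ℝ)))
      atTop (𝓝 0) := by
  have h1 := Real.tendsto_integral_exp_smul_cocompact ((Ioi (0 : ℝ)).indicator h)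
  have h2 : Tendsto (fun τ : ℝ => -b / (2 * Real.pi) * τ) atTop (cocompact ℝ) := by
    have hne : -b / (2 * Real.pi) ≠ 0 := div_ne_zero (neg_ne_zero.2 hb) (by positivity)
    exact (Homeomorph.mulLeft₀ _ hne).isClosedEmbedding.tendsto_cocompact.comp atTop_le_cocompact
  refine (h1.comp h2).congr fun τ => ?_
  rw [← integral_indicator measurableSet_Ioi]
  refine integral_congr_ae (Eventually.of_forall fun r => ?_)
  by_cases hr : r ∈ Ioi (0 : ℝ)
  · simp only [indicator_of_mem hr, Circle.smul_def, Real.fourierChar_apply, smul_eq_mul]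
    rw [mul_comm]
    congr 2
    push_cast
    have : (Real.pi : ℂ) ≠ 0 := by exact_mod_cast Real.pi_ne_zero
    field_simp
  · simp [indicator_of_notMem hr]

lemma integrableOn_Ioi_of_eq_zero {E : Type*} [NormedAddCommGroup E] {h : ℝ → E} (R : ℝ)
    (hc : Continuous h) (hR : ∀ r, R ≤ r → h r = 0) : IntegrableOn h (Ioi 0) := by
  refine IntegrableOn.of_forall_sdiff_eq_zero (hc.integrableOn_Icc (a := 0) (b := R))
    measurableSet_Ioi ?_
  rintro r ⟨h1, h2⟩
  refine hR _ ?_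
  by_contra! h
  exact h2 ⟨le_of_lt h1, h.le⟩

lemma tendsto_integral_Ioi_mul_exp_ite (h : ℝ → ℂ) (b : ℝ) :
    Tendsto (fun τ : ℝ => ∫ r in Ioi (0 : ℝ), h r * Complex.exp (Complex.I * (b * τ * r : ℝ)))
      atTop (𝓝 (if b = 0 then ∫ r in Ioi (0 : ℝ), h r else 0)) := by
  split_ifs with hb
  · simp [hb]
  · exact tendsto_integral_Ioi_mul_exp h hb

/-- Asymptotics of the radial oscillatory integral obtained after the angular integration. -/
lemma tendsto_radial_integral {H : ℝ → ℂ} {R a : ℝ} (hc : Continuous H)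
    (hR : ∀ r, R ≤ r → H r = 0) {σ : ℝ} (hσ : σ = 1 ∨ σ = -1) :
    Tendsto (fun τ : ℝ => τ * ‖∫ r in Ioi (0 : ℝ), H r * Complex.exp (Complex.I * (σ * τ * r : ℝ)) *
        (expPrimitive τ (a + r) - expPrimitive τ (a - r))‖)
      atTop (𝓝 ‖∫ r in Ioi (0 : ℝ), H r * (a - σ * r)‖) := by
  set A : ℝ → ℝ → ℂ := fun s τ =>
    ∫ r in Ioi (0 : ℝ), H r * (a + s * r) * Complex.exp (Complex.I * ((σ + s) * τ * r : ℝ)) with hA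
  set B : ℝ → ℝ → ℂ := fun s τ =>
    ∫ r in Ioi (0 : ℝ), H r * Complex.exp (Complex.I * ((σ + s) * τ * r : ℝ)) with hB
  have key : ∀ τ : ℝ, 0 < τ → τ * ‖∫ r in Ioi (0 : ℝ),
        H r * Complex.exp (Complex.I * (σ * τ * r : ℝ)) *
        (expPrimitive τ (a + r) - expPrimitive τ (a - r))‖
      = ‖(A 1 τ - A (-1) τ) + Complex.I * (τ⁻¹ : ℝ) * (B 1 τ - B (-1) τ)‖ := by
    intro τ hτ
    have hτ' : (τ : ℂ) ≠ 0 := by exact_mod_cast hτ.ne'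
    have iA : ∀ s : ℝ, Integrable (fun r : ℝ => H r * (a + s * r) *
        Complex.exp (Complex.I * ((σ + s) * τ * r : ℝ))) (volume.restrict (Ioi 0)) := fun s =>
      integrableOn_Ioi_of_eq_zero R (by fun_prop) (fun r hr => by simp [hR r hr])
    have iB : ∀ s : ℝ, Integrable (fun r : ℝ => H r *
        Complex.exp (Complex.I * ((σ + s) * τ * r : ℝ))) (volume.restrict (Ioi 0)) := fun s =>
      integrableOn_Ioi_of_eq_zero R (by fun_prop) (fun r hr => by simp [hR r hr])
    have e1 : (A 1 τ - A (-1) τ) + Complex.I * (τ⁻¹ : ℝ) * (B 1 τ - B (-1) τ)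
        = (Complex.I * τ * Complex.exp ((-(τ * a) : ℝ) * Complex.I)) * ∫ r in Ioi (0 : ℝ),
          H r * Complex.exp (Complex.I * (σ * τ * r : ℝ)) *
          (expPrimitive τ (a + r) - expPrimitive τ (a - r)) := by
      rw [← integral_sub (iA 1) (iA (-1)), ← integral_sub (iB 1) (iB (-1)),
        ← integral_const_mul, ← integral_const_mul]
      refine (integral_add ((iA 1).sub (iA (-1)))
        (((iB 1).sub (iB (-1))).const_mul _)).symm.trans ?_
      refine integral_congr_ae (Eventually.of_forall fun r => ?_)
      have x1 : ∀ s : ℝ, Complex.exp (Complex.I * ((σ + s) * τ * r : ℝ))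
          = Complex.exp ((-(τ * a) : ℝ) * Complex.I) * Complex.exp (Complex.I * (σ * τ * r : ℝ))
            * Complex.exp (Complex.I * τ * (a + s * r : ℝ)) := by
        intro s
        rw [← Complex.exp_add, ← Complex.exp_add]
        congr 1
        push_cast
        ring
      have x2 : ∀ s : ℝ, Complex.I * τ * expPrimitive τ (a + s * r)
          = ((a + s * r) + Complex.I * (τ⁻¹ : ℝ)) *
            Complex.exp (Complex.I * τ * (a + s * r : ℝ)) := by
        intro s
        unfold expPrimitive
        push_cast
        field_simp
      have y1 := x2 1
      have y2 := x2 (-1)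
      simp only [Pi.sub_apply, x1]
      rw [one_mul] at y1
      rw [neg_one_mul, ← sub_eq_add_neg] at y2
      rw [one_mul, neg_one_mul, ← sub_eq_add_neg]
      push_cast at y1 y2 ⊢
      linear_combination (-(H r) * Complex.exp (-(τ * a) * Complex.I) *
        Complex.exp (Complex.I * (σ * τ * r))) * (y1 - y2)
    rw [e1, norm_mul, norm_mul, norm_mul, Complex.norm_exp_ofReal_mul_I, Complex.norm_I,
      Complex.norm_real, Real.norm_of_nonneg hτ.le, one_mul, mul_one]
  have tA : ∀ s, Tendsto (A s) atTop
      (𝓝 (if σ + s = 0 then ∫ r in Ioi (0 : ℝ), H r * (a + s * r) else 0)) := fun s =>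
    tendsto_integral_Ioi_mul_exp_ite (fun r => H r * (a + s * r)) (σ + s)
  have tB : ∀ s, Tendsto (B s) atTop
      (𝓝 (if σ + s = 0 then ∫ r in Ioi (0 : ℝ), H r else 0)) := fun s =>
    tendsto_integral_Ioi_mul_exp_ite H (σ + s)
  have tinv : Tendsto (fun τ : ℝ => Complex.I * (τ⁻¹ : ℝ)) atTop (𝓝 0) := by
    have := (Complex.continuous_ofReal.tendsto 0).comp tendsto_inv_atTop_zero
    simpa using this.const_mul Complex.I
  have tt := (((tA 1).sub (tA (-1))).add (tinv.mul ((tB 1).sub (tB (-1))))).norm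
  refine (tt.congr' ?_).trans_eq ?_
  · filter_upwards [eventually_gt_atTop 0] with τ hτ using (key τ hτ).symm
  · rcases hσ with rfl | rfl
    · norm_num [sub_eq_add_neg]
    · norm_num [sub_eq_add_neg]

/-- Lower bound for the leading coefficient. -/
lemma le_integral_radial_coefficient {G : ℝ → ℝ} {a : ℝ} (ha : 0 < a) (hG : Continuous G)
    (h0 : ∀ r, 0 ≤ G r) (h1 : ∀ r, 0 < r → r ≤ a / 8 → G r = 1) (hR : ∀ r, a / 4 ≤ r → G r = 0)
    {σ : ℝ} (hσ : σ = 1 ∨ σ = -1) :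
    a ^ 3 / 256 ≤ ‖∫ r in Ioi (0 : ℝ), ((r * G r : ℝ) : ℂ) * (a - σ * r)‖ := by
  have hσr : ∀ r, 0 ≤ r → a - r ≤ a - σ * r := by
    rcases hσ with rfl | rfl <;> intro r hr <;> linarith
  have h_int : IntegrableOn (fun r => r * G r * (a - σ * r)) (Ioi 0) :=
    integrableOn_Ioi_of_eq_zero (a / 4) (by fun_prop) (fun r hr => by simp [hR r hr])
  have hnn : ∀ r ∈ Ioi (0 : ℝ), 0 ≤ r * G r * (a - σ * r) := by
    intro r hr
    have hr' : 0 < r := hr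
    rcases le_total (a / 4) r with h | h
    · simp [hR r h]
    · exact mul_nonneg (mul_nonneg hr'.le (h0 r)) (by linarith [hσr r hr'.le])
  have hval : ∫ r in Ioc (0 : ℝ) (a / 8), r * (a / 2) = a ^ 3 / 256 := by
    rw [← intervalIntegral.integral_of_le (by positivity), intervalIntegral.integral_mul_const,
      integral_id]
    ring
  have hle : a ^ 3 / 256 ≤ ∫ r in Ioi (0 : ℝ), r * G r * (a - σ * r) := by
    calc a ^ 3 / 256 = ∫ r in Ioc (0 : ℝ) (a / 8), r * (a / 2) := hval.symm
      _ ≤ ∫ r in Ioc (0 : ℝ) (a / 8), r * G r * (a - σ * r) := by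
        refine setIntegral_mono_on (Continuous.integrableOn_Ioc (by fun_prop))
          (h_int.mono_set Ioc_subset_Ioi_self) measurableSet_Ioc fun r hr => ?_
        rw [h1 r hr.1 hr.2, mul_one]
        exact mul_le_mul_of_nonneg_left (by linarith [hσr r hr.1.le, hr.2]) hr.1.le
      _ ≤ _ := setIntegral_mono_set h_int
        ((ae_restrict_iff' measurableSet_Ioi).2 (Eventually.of_forall hnn))
        (LE.le.eventuallyLE Ioc_subset_Ioi_self)
  have hcast : ∫ r in Ioi (0 : ℝ), ((r * G r : ℝ) : ℂ) * (a - σ * r)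
      = ((∫ r in Ioi (0 : ℝ), r * G r * (a - σ * r) : ℝ) : ℂ) := by
    refine Eq.trans ?_ (integral_ofReal (𝕜 := ℂ))
    refine integral_congr_ae (Eventually.of_forall fun r => ?_)
    push_cast
    rfl
  rw [hcast, Complex.norm_real]
  exact hle.trans (le_abs_self _)

/-- Reduction of the oscillatory integral with a radial amplitude to a one-dimensional one. -/
lemma integral_exp_mul_radial {κ : ℝ} (hκ : 0 < κ) {G : ℝ → ℝ} (hG : Continuous G)
    (hR : ∀ r, (2 * κ)⁻¹ ≤ r → G r = 0) (σ : ℝ) {τ : ℝ} (hτ : τ ≠ 0) :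
    ∫ ξ : E3, Complex.exp (Complex.I * (τ * (d2 κ ξ + σ * d1 κ ξ) : ℝ)) * (G (d1 κ ξ) : ℂ)
      = (Real.pi * κ : ℝ) * ∫ r in Ioi (0 : ℝ), ((r * G r : ℝ) : ℂ) *
        Complex.exp (Complex.I * (σ * τ * r : ℝ)) *
        (expPrimitive τ (2 * κ⁻¹ + r) - expPrimitive τ (2 * κ⁻¹ - r)) := by
  set a : ℝ := 2 * κ⁻¹ with ha
  have ha0 : 0 < a := by positivity
  set f : ℝ → ℝ → ℂ := fun r w =>
    Complex.exp (Complex.I * (τ * (√(r ^ 2 + 2 * a * w + a ^ 2) + σ * r) : ℝ)) * (G r : ℂ) with hf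
  have hfc : Continuous (Function.uncurry f) := by
    simp only [hf, Function.uncurry_def]
    fun_prop
  have e1 : ∫ ξ : E3, Complex.exp (Complex.I * (τ * (d2 κ ξ + σ * d1 κ ξ) : ℝ)) * (G (d1 κ ξ) : ℂ)
      = ∫ ξ : E3, f (√(ξ 0 ^ 2 + ξ 1 ^ 2 + ξ 2 ^ 2)) (ξ 2) := by
    rw [← integral_add_right_eq_self _ (!₂[0, 0, κ⁻¹] : E3)]
    refine integral_congr_ae (Eventually.of_forall fun ξ => ?_)
    have x1 : d1 κ (ξ + !₂[0, 0, κ⁻¹]) = √(ξ 0 ^ 2 + ξ 1 ^ 2 + ξ 2 ^ 2) := by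
      simp [d1]
    have x2 : d2 κ (ξ + !₂[0, 0, κ⁻¹])
        = √((√(ξ 0 ^ 2 + ξ 1 ^ 2 + ξ 2 ^ 2)) ^ 2 + 2 * a * ξ 2 + a ^ 2) := by
      rw [Real.sq_sqrt (by positivity)]
      simp only [d2, ha]
      congr 1
      simp
      ring
    simp only [hf, x1, x2]
  rw [e1, integral_E3_spherical hfc (R := (2 * κ)⁻¹) (fun r w hr => by simp [hf, hR r hr])]
  push_cast
  rw [mul_assoc, ← integral_const_mul (κ : ℂ)]
  congr 1
  refine setIntegral_congr_fun measurableSet_Ioi fun r hr => ?_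
  have hr0 : 0 < r := hr
  rcases le_or_gt (2 * κ)⁻¹ r with h | h
  · simp [hf, hR r h]
  · have hra : r < a := by
      refine h.trans ?_
      rw [ha, mul_inv]
      have := inv_pos.2 hκ
      linarith
    have x := integral_abs_sin_mul_exp hr0 hra hτ
    have hr' : (r : ℂ) ≠ 0 := by exact_mod_cast hr0.ne'
    have hκ' : (κ : ℂ) ≠ 0 := by exact_mod_cast hκ.ne'
    have e2 : ∀ θ : ℝ, (r : ℂ) ^ 2 * ((|Real.sin θ| : ℝ) : ℂ) * f r (r * Real.cos θ)
        = (r ^ 2 * G r * Complex.exp (Complex.I * (σ * τ * r : ℝ))) *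
          (((|Real.sin θ| : ℝ) : ℂ) *
          Complex.exp (Complex.I * τ * (√(r ^ 2 + 2 * a * (r * Real.cos θ) + a ^ 2) : ℝ))) := by
      intro θ
      simp only [hf]
      have : Complex.exp (Complex.I *
            (τ * (√(r ^ 2 + 2 * a * (r * Real.cos θ) + a ^ 2) + σ * r) : ℝ))
          = Complex.exp (Complex.I * (σ * τ * r : ℝ)) *
            Complex.exp (Complex.I * τ * (√(r ^ 2 + 2 * a * (r * Real.cos θ) + a ^ 2) : ℝ)) := by
        rw [← Complex.exp_add]
        congr 1
        push_cast
        ring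
      rw [this]
      ring
    simp only [e2]
    rw [integral_const_mul, x]
    have ha' : (a : ℂ) = 2 * (κ : ℂ)⁻¹ := by
      rw [ha]
      push_cast
      rfl
    rw [ha']
    push_cast
    field_simp

/-- Optimality of the `t⁻¹` decay rate: for data whose Fourier transform
is a radial bump around the singular point `(0,0,κ⁻¹)`, the evolution `e^{itcΛ_κ}` decays no
faster than `t⁻¹` at `x = 0`, for both `Λ = Σ_κ` and `Λ = Ω_κ`. -/
theorem t_inv_decay_optimal :
    ∃ c₁ > 0, ∀ κ c : ℝ, 0 < κ → 0 < c →
      ∀ g : E3 → ℝ, ContDiff ℝ (⊤ : ℕ∞) g → (∀ ξ, 0 ≤ g ξ ∧ g ξ ≤ 1) →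
        (∀ ξ η : E3, d1 κ ξ = d1 κ η → g ξ = g η) →
        (∀ ξ : E3, d1 κ ξ ≤ (4 * κ)⁻¹ → g ξ = 1) →
        (∀ ξ : E3, (2 * κ)⁻¹ ≤ d1 κ ξ → g ξ = 0) →
        ∀ Λ : E3 → ℝ, (Λ = Sig κ ∨ Λ = Om κ) →
          ∃ T₀ > 0, ∀ t : ℝ, T₀ ≤ t →
            c₁ * (c * κ ^ 2)⁻¹ * t⁻¹
              ≤ ‖∫ ξ : E3, Complex.exp (Complex.I * ((t * c * Λ ξ : ℝ) : ℂ)) * ((g ξ : ℝ) : ℂ)‖ := by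
  refine ⟨1 / 10, by norm_num, ?_⟩
  intro κ c hκ hc g hg hg01 hrad hone hzero Λ hΛ
  obtain ⟨σ, hσ, hΛσ⟩ : ∃ σ : ℝ, (σ = 1 ∨ σ = -1) ∧ ∀ ξ, Λ ξ = (d2 κ ξ + σ * d1 κ ξ) / 2 := by
    rcases hΛ with rfl | rfl
    · exact ⟨1, Or.inl rfl, fun ξ => by simp [Sig]⟩
    · exact ⟨-1, Or.inr rfl, fun ξ => by simp [Om, sub_eq_add_neg]⟩
  set G : ℝ → ℝ := fun r => g !₂[0, 0, κ⁻¹ + r] with hG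
  have hd1 : ∀ r, d1 κ !₂[0, 0, κ⁻¹ + r] = |r| := fun r => by simp [d1, Real.sqrt_sq_eq_abs]
  have hGc : Continuous G := hg.continuous.comp (by fun_prop)
  have hgG : ∀ ξ, g ξ = G (d1 κ ξ) := fun ξ =>
    hrad _ _ (by rw [hd1, abs_of_nonneg (show 0 ≤ d1 κ ξ from Real.sqrt_nonneg _)])
  have hGR : ∀ r, (2 * κ)⁻¹ ≤ r → G r = 0 := fun r hr =>
    hzero _ (by rw [hd1]; exact hr.trans (le_abs_self r))
  have hG1 : ∀ r, 0 < r → r ≤ (2 * κ⁻¹) / 8 → G r = 1 := fun r hr hr' =>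
    hone _ (by
      rw [hd1, abs_of_pos hr]
      refine hr'.trans_eq ?_
      field_simp
      norm_num)
  have hM := le_integral_radial_coefficient (a := 2 * κ⁻¹) (by positivity) hGc
    (fun r => (hg01 _).1) hG1
    (fun r hr => hGR r ((by field_simp; norm_num : (2 * κ)⁻¹ = 2 * κ⁻¹ / 4).trans_le hr)) hσ
  have hlim := tendsto_radial_integral (H := fun r => ((r * G r : ℝ) : ℂ)) (R := (2 * κ)⁻¹)
    (a := 2 * κ⁻¹) (by fun_prop) (fun r hr => by simp [hGR r hr]) hσ
  have hlt : κ⁻¹ ^ 3 / 40 < ‖∫ r in Ioi (0 : ℝ), ((r * G r : ℝ) : ℂ) *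
      (((2 * κ⁻¹ : ℝ) : ℂ) - σ * r)‖ := by
    refine lt_of_lt_of_le ?_ hM
    have := pow_pos (inv_pos.2 hκ) 3
    linarith [mul_pow (2 : ℝ) κ⁻¹ 3]
  have hτ : Tendsto (fun t : ℝ => t * (c / 2)) atTop atTop :=
    tendsto_id.atTop_mul_const (by positivity)
  obtain ⟨T, hT⟩ := eventually_atTop.1 (hτ.eventually (hlim.eventually (lt_mem_nhds hlt)))
  refine ⟨max T 1, by positivity, fun t ht => ?_⟩
  have ht0 : 0 < t := lt_of_lt_of_le one_pos ((le_max_right _ _).trans ht)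
  have hbound := hT t ((le_max_left _ _).trans ht)
  have hI := integral_exp_mul_radial hκ hGc hGR σ (τ := t * (c / 2)) (by positivity)
  have h_int : ∫ ξ : E3, Complex.exp (Complex.I * ((t * c * Λ ξ : ℝ) : ℂ)) * ((g ξ : ℝ) : ℂ)
      = ∫ ξ : E3, Complex.exp (Complex.I * (t * (c / 2) * (d2 κ ξ + σ * d1 κ ξ) : ℝ)) *
          (G (d1 κ ξ) : ℂ) := by
    refine integral_congr_ae (Eventually.of_forall fun ξ => ?_)
    have : t * c * Λ ξ = t * (c / 2) * (d2 κ ξ + σ * d1 κ ξ) := by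
      rw [hΛσ]
      ring
    simp only [this, ← hgG]
  rw [h_int, hI, norm_mul, Complex.norm_real, Real.norm_of_nonneg (by positivity)]
  set N := ‖∫ r in Ioi (0 : ℝ), ((r * G r : ℝ) : ℂ) *
    Complex.exp (Complex.I * (σ * (t * (c / 2)) * r : ℝ)) *
    (expPrimitive (t * (c / 2)) ((2 * κ⁻¹ : ℝ) + r) -
      expPrimitive (t * (c / 2)) ((2 * κ⁻¹ : ℝ) - r))‖ with hN
  have hN' : κ⁻¹ ^ 3 / 40 < t * (c / 2) * N := hbound
  have h3 : 3 * (κ * (κ⁻¹ ^ 3 / 40)) ≤ Real.pi * (κ * (t * (c / 2) * N)) := by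
    have hk := mul_lt_mul_of_pos_left hN' hκ
    exact mul_le_mul Real.pi_gt_three.le hk.le (by positivity) Real.pi_pos.le
  have h4 : κ * (κ⁻¹ ^ 3 / 40) = (κ ^ 2)⁻¹ / 40 := by field_simp
  have h5 : (κ ^ 2)⁻¹ / 10 ≤ Real.pi * κ * N * (t * c) := by
    have := inv_pos.2 (pow_pos hκ 2)
    linarith
  rw [mul_inv]
  calc 1 / 10 * (c⁻¹ * (κ ^ 2)⁻¹) * t⁻¹ = ((κ ^ 2)⁻¹ / 10) / (t * c) := by
        field_simp
    _ ≤ _ := (div_le_iff₀ (by positivity)).2 h5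
end
end
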